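/- Let p be an odd prime, q a power of p, and let P be a Sylow p-subgroup of the symplectic group Sp_14(F_q). Then the number of conjugacy classes of P equals v¹⁴ + 18v¹³ + 158v¹² + 899v¹¹ + 3740v¹⁰ + 11985v⁹ + 29328v⁸ + 52055v⁷ + 62930v⁶ + 48797v⁵ + 22855v⁴ + 6020v³ + 812v² + 49v + 1, where v = q − 1. -/

import Mathlib

namespace SpC
noncomputable section
/-- static list of variables -/
def vars : List ℕ := [(nat_lit 23), (nat_lit 29), (nat_lit 31), (nat_lit 37), (nat_lit 41), (nat_lit 43), (nat_lit 47), (nat_lit 53), (nat_lit 59), (nat_lit 61), (nat_lit 67), (nat_lit 71), (nat_lit 73), (nat_lit 79), (nat_lit 83), (nat_lit 89), (nat_lit 97), (nat_lit 101), (nat_lit 103), (nat_lit 107), (nat_lit 109), (nat_lit 113), (nat_lit 127), (nat_lit 131), (nat_lit 137), (nat_lit 139), (nat_lit 149), (nat_lit 151), (nat_lit 157), (nat_lit 163), (nat_lit 167), (nat_lit 173), (nat_lit 179), (nat_lit 181), (nat_lit 191), (nat_lit 193), (nat_lit 197), (nat_lit 199), (nat_lit 211), (nat_lit 223), (nat_lit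 227), (nat_lit 229), (nat_lit 233), (nat_lit 239), (nat_lit 241), (nat_lit 251), (nat_lit 257), (nat_lit 263), (nat_lit 269)]
def mask : ℕ := (nat_lit 963625389567747080217655423798202412336081362283425584849741406050656018187157504)
def isVar (x : ℕ) : Bool := bif Nat.ble x (nat_lit 511) then Nat.beq (Nat.land (Nat.shiftRight mask x) (nat_lit 1)) (nat_lit 1) else false

def lrec {β : Type} (z : β) (f : ℕ → List ℕ → β → β) (l : List ℕ) : β := List.rec z f l
def lrec2 {β : Type} (z : β) (f : List ℕ → List (List ℕ) → β → β) (l : List (List ℕ)) : β := List.rec z f l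

def force {β : Type} (n : ℕ) (k : ℕ → β) : β := Nat.rec (k (nat_lit 0)) (fun m _ => k (Nat.succ m)) n

def seqL {β : Type} (l : List ℕ) (k : List ℕ → β) : β :=
  List.rec (motive := fun _ => (List ℕ → β) → β) (fun k => k []) (fun a _ ih k => force a fun a => ih fun t => k (a :: t)) l k
def seqLL {β : Type} (l : List (List ℕ)) (k : List (List ℕ) → β) : β :=
  List.rec (motive := fun _ => (List (List ℕ) → β) → β) (fun k => k []) (fun a _ ih k => seqL a fun a => ih fun t => k (a :: t)) l k
def dvd (x m : ℕ) : Bool := Nat.beq (Nat.mod m x) (nat_lit 0)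
def occ (x : ℕ) (p : List ℕ) : Bool := lrec false (fun m _ ih => bif dvd x m then true else ih) p
def cnt (x : ℕ) (p : List ℕ) : ℕ := lrec (nat_lit 0) (fun m _ ih => bif dvd x m then Nat.succ ih else ih) p
def memb (x : ℕ) (p : List ℕ) : Bool := lrec false (fun m _ ih => bif Nat.beq x m then true else ih) p
def del (x : ℕ) (p : List ℕ) : List ℕ := lrec [] (fun m t ih => bif Nat.beq x m then t else m :: ih) p
def nrm (m : ℕ) : ℕ := bif dvd (nat_lit 4) m then Nat.div m (nat_lit 4) else m
def opp (m : ℕ) : ℕ := bif dvd (nat_lit 2) m then Nat.div m (nat_lit 2) else Nat.mul (nat_lit 2) m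
def ins (m : ℕ) (l : List ℕ) : List ℕ :=
  force (opp m) fun o => bif memb o l then del o l else m :: l
def gcds (g : ℕ) (p : List ℕ) : ℕ := lrec g (fun m _ ih => Nat.gcd m ih) p
def allEq (a : ℕ) (p : List ℕ) : Bool := lrec true (fun m _ ih => bif Nat.beq a m then ih else false) p
def okLen (p : List ℕ) : Bool := match p with
  | [] => true | [_] => true | [_,_,_] => true | _ => false
/-- strip units; normalise single terms -/
def strip (g : ℕ) (p : List ℕ) : List ℕ :=
  bif Nat.beq g (nat_lit 1) then p else lrec [] (fun m _ ih => force (Nat.div m g) fun v => v :: ih) p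
def single (Fr : ℕ) (p : List ℕ) : List ℕ := match p with
  | [] => []
  | m :: t => bif allEq m t then (bif okLen t then
      (bif dvd m (Nat.mul (nat_lit 2) (Nat.pow Fr (nat_lit 4))) then (force (Nat.gcd m Fr) fun g => [g]) else p) else p) else p
def norm (Fr U4 : ℕ) (E : List (List ℕ)) : List (List ℕ) :=
  lrec2 [] (fun p _ ih => List.rec (motive := fun _ => List (List ℕ)) ih (fun _ _ _ =>
     (force (gcds U4 p) fun g => single Fr (strip g p)) :: ih) p) E
/-- candidate term of p: returns m or 0 -/
def cand (Fr : ℕ) (p : List ℕ) : ℕ :=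
  lrec (nat_lit 0) (fun m _ ih => force (Nat.gcd m Fr) fun x =>
    bif isVar x then (bif dvd x (Nat.div m x) then ih else (bif Nat.beq (cnt x p) (nat_lit 1) then m else ih)) else ih) p
def isOne (p : List ℕ) : Bool := List.rec false (fun m t _ => List.rec (Nat.beq m (nat_lit 1)) (fun _ _ _ => false) t) p

inductive Act | none | contra | solve (m : ℕ) (p : List ℕ)
def find (Fr : ℕ) (E : List (List ℕ)) : Act :=
  lrec2 Act.none (fun p _ ih => bif isOne p then Act.contra else
    Nat.rec ih (fun m _ => Act.solve (Nat.succ m) p) (cand Fr p)) E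
def mulAcc (k : ℕ) (r : List ℕ) (acc : List ℕ) : List ℕ :=
  lrec acc (fun a _ ih => force (nrm (Nat.mul k a)) fun v => seqL ih fun ih => ins v ih) r
def subst1 (x u : ℕ) (r e : List ℕ) : List ℕ :=
  lrec [] (fun n _ ih => bif dvd x n then
      (force (nrm (Nat.mul (nat_lit 2) (Nat.div n x))) fun k => seqL ih fun ih => mulAcc k r ih)
     else (force (nrm (Nat.mul n u)) fun v => seqL ih fun ih => ins v ih)) e
def leqb (p q : List ℕ) : Bool :=
  List.rec (motive := fun _ => List ℕ → Bool) (fun q => match q with | [] => true | _ => false)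
    (fun a _ ih q => match q with | [] => false | b :: t => bif Nat.beq a b then ih t else false) p q
/-- remove p, substitute in the others -/
def subst (x u : ℕ) (r p : List ℕ) (E : List (List ℕ)) : List (List ℕ) :=
  lrec2 [] (fun e _ ih => bif occ x e then (bif leqb e p then ih else subst1 x u r e :: ih) else e :: ih) E
def noOcc (x : ℕ) (E : List (List ℕ)) : Bool := lrec2 true (fun e _ ih => bif occ x e then false else ih) E
def prodAll (E : List (List ℕ)) : ℕ := lrec2 (nat_lit 1) (fun e _ ih => lrec ih (fun m _ ih2 => Nat.mul m ih2) e) E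
def layer : ℕ → ℕ → ℕ → ℕ := fun n =>
  Nat.rec (motive := fun _ => ℕ → ℕ → ℕ) (fun _ G => G)
   (fun _ ih P G => force (Nat.div P G) fun P => force (Nat.gcd P G) fun H => bif Nat.beq H (nat_lit 1) then G else ih P H) n
def firstDvd (G : ℕ) (l : List ℕ) : ℕ := lrec (nat_lit 0) (fun p _ ih => bif dvd p G then p else ih) l
def sameUp (p q : List ℕ) : Bool :=
  (match mulAcc (nat_lit 1) p q with | [] => true | _ => false) || (match mulAcc (nat_lit 2) p q with | [] => true | _ => false)
def dedupe (E : List (List ℕ)) : List (List ℕ) :=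
  lrec2 [] (fun p t ih => bif lrec2 false (fun q _ i2 => bif sameUp p q then true else i2) t then ih else p :: ih) E
/-- find unit variable occurring in exactly one term of p, linearly -/
def cand5p (p : List ℕ) : ℕ :=
  lrec (nat_lit 0) (fun x _ ih => bif Nat.beq (cnt x p) (nat_lit 1) then
     (bif lrec false (fun m _ i2 => bif dvd x m then (bif dvd x (Nat.div m x) then false else true) else i2) p then x else ih) else ih) vars
def cand5 (E : List (List ℕ)) : ℕ := lrec2 (nat_lit 0) (fun p _ ih => Nat.rec ih (fun m _ => Nat.succ m) (cand5p p)) E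
def split1 (x : ℕ) (p : List ℕ) : List ℕ :=
  lrec [] (fun m _ ih => bif dvd x m then (force (Nat.div m x) fun v => v :: ih) else ih) p
def split0 (x : ℕ) (p : List ℕ) : List ℕ :=
  lrec [] (fun m _ ih => bif dvd x m then ih else m :: ih) p
def cand7 (E : List (List ℕ)) : ℕ :=
  lrec (nat_lit 0) (fun x _ ih => bif Nat.beq (lrec2 (nat_lit 0) (fun e _ i2 => bif occ x e then Nat.succ i2 else i2) E) (nat_lit 1) then
    (bif lrec2 true (fun e _ i2 => bif occ x (split1 x e) then false else i2) E then x else ih) else ih) vars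
/-- the polynomial containing x -/
def theP (x : ℕ) (E : List (List ℕ)) : List ℕ := lrec2 [] (fun e _ ih => bif occ x e then e else ih) E
def others (x : ℕ) (E : List (List ℕ)) : List (List ℕ) := lrec2 [] (fun e _ ih => bif occ x e then ih else e :: ih) E

abbrev BB : ℕ := 340282366920938463463374607431768211456
/-- results: (positive part, negative part, bound) -/
structure Res where
  r : ℤ
  b : ℕ
def Res.zero : Res := ⟨Int.ofNat (nat_lit 0), (nat_lit 0)⟩
def leaf (nf nu : ℕ) : Res := ⟨Int.ofNat (Nat.mul (Nat.pow ((nat_lit 340282366920938463463374607431768211457)) nf) (Nat.pow (nat_lit 340282366920938463463374607431768211456) nu)), Nat.pow (nat_lit 2) nf⟩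
def radd (a b : Option Res) : Option Res := match a with
  | none => none | some ⟨a1,a2⟩ => match b with | none => none | some ⟨b1,b2⟩ => some ⟨Int.add a1 b1, Nat.add a2 b2⟩
def rsub (a b : Option Res) : Option Res := match a with
  | none => none | some ⟨a1,a2⟩ => match b with | none => none | some ⟨b1,b2⟩ => some ⟨Int.sub a1 b1, Nat.add a2 b2⟩

abbrev RT := List (List ℕ) → ℕ → ℕ → ℕ → ℕ → Option Res
def doMove (ih : RT) (E : List (List ℕ)) (Fr Un nf nu x : ℕ) : Option Res :=
  ih E (Nat.mul Fr x) (Nat.div Un x) (Nat.succ nf) (Nat.pred nu)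
def do7 (ih : RT) (o : List (List ℕ)) (Fr Un nf nu x : ℕ) (p : List ℕ) : Option Res :=
  radd (rsub (rsub (doMove ih ([x]::o) Fr Un nf nu x) (doMove ih ([x]::split1 x p::o) Fr Un nf nu x))
    (doMove ih ([x]::split0 x p::o) Fr Un nf nu x)) (doMove ih (split1 x p::split0 x p::o) Fr Un nf nu x)
def do5 (ih : RT) (E : List (List ℕ)) (Fr Un nf nu x : ℕ) : Option Res :=
  rsub (doMove ih E Fr Un nf nu x) (doMove ih ([x]::E) Fr Un nf nu x)
/-- guard: x is a variable dividing U -/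
def chkU (U x : ℕ) (k : Option Res) : Option Res := bif isVar x then (bif dvd x U then k else none) else none
def doUnits (ih : RT) (Fr Un nf nu : ℕ) (E : List (List ℕ)) : Option Res :=
  Nat.rec (Nat.rec none (fun x _ => chkU Un (Nat.succ x) (do7 ih (others (Nat.succ x) E) Fr Un nf nu (Nat.succ x) (theP (Nat.succ x) E))) (cand7 E))
    (fun x _ => chkU Un (Nat.succ x) (do5 ih E Fr Un nf nu (Nat.succ x))) (cand5 E)
def doBr (ih : RT) (E : List (List ℕ)) (Fr Un nf nu x : ℕ) : Option Res :=
  chkU Fr x (radd (ih ([x]::E) Fr Un nf nu) (ih E (Nat.div Fr x) (Nat.mul Un x) (Nat.pred nf) (Nat.succ nu)))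
def doNone (ih : RT) (E : List (List ℕ)) (Fr Un nf nu P G : ℕ) : Option Res :=
  bif Nat.beq G (nat_lit 1) then seqLL (dedupe E) (doUnits ih Fr Un nf nu)
  else force (layer (nat_lit 100) P G) fun G => force (firstDvd G vars) (doBr ih E Fr Un nf nu)
def doSolve2 (ih : RT) (Fr Un nf nu x : ℕ) (E : List (List ℕ)) : Option Res :=
  bif noOcc x E then ih E (Nat.div Fr x) Un (Nat.pred nf) nu else none
def doSolve (ih : RT) (E : List (List ℕ)) (Fr Un nf nu m : ℕ) (p : List ℕ) (x : ℕ) : Option Res :=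
  force (Nat.div m x) fun u => bif dvd u (Nat.mul (nat_lit 2) (Nat.pow Un (nat_lit 4))) then
    (seqL (split0 x p) fun r => seqLL (subst x u r p E) (doSolve2 ih Fr Un nf nu x)) else none
def doAct (ih : RT) (E : List (List ℕ)) (Fr Un nf nu : ℕ) (a : Act) : Option Res :=
  Act.rec (force (prodAll E) fun P => force (Nat.gcd Fr P) (doNone ih E Fr Un nf nu P))
    (some Res.zero) (fun m p => force (Nat.gcd m Fr) (doSolve ih E Fr Un nf nu m p)) a
def doNode (ih : RT) (Fr Un nf nu : ℕ) (E : List (List ℕ)) : Option Res :=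
  List.rec (some (leaf nf nu)) (fun _ _ _ => doAct ih E Fr Un nf nu (find Fr E)) E
def doF (ih : RT) (E : List (List ℕ)) (nf nu Fr Un : ℕ) : Option Res :=
  force nf fun nf => force nu fun nu => seqLL (norm Fr (Nat.pow Un (nat_lit 4)) E) (doNode ih Fr Un nf nu)
def step (ih : RT) : RT := fun E Fr Un nf nu => force Fr fun Fr => force Un fun Un => doF ih E nf nu Fr Un
def run (fuel : ℕ) : RT :=
  Nat.rec (motive := fun _ => RT) (fun _ _ _ _ _ => none) (fun _ ih => step ih) fuel
/-! generator -/
def nth (l : List ℕ) : ℕ → ℕ :=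
  List.rec (motive := fun _ => ℕ → ℕ) (fun _ => (nat_lit 0)) (fun a _ ih n => Nat.rec a (fun m _ => ih m) n) l
def up : List (ℕ × ℕ) := [((nat_lit 5),(nat_lit 6)),((nat_lit 4),(nat_lit 6)),((nat_lit 3),(nat_lit 6)),((nat_lit 2),(nat_lit 6)),((nat_lit 1),(nat_lit 6)),((nat_lit 0),(nat_lit 6)),((nat_lit 4),(nat_lit 5)),((nat_lit 3),(nat_lit 5)),((nat_lit 2),(nat_lit 5)),((nat_lit 1),(nat_lit 5)),((nat_lit 0),(nat_lit 5)),((nat_lit 3),(nat_lit 4)),((nat_lit 2),(nat_lit 4)),((nat_lit 1),(nat_lit 4)),((nat_lit 0),(nat_lit 4)),((nat_lit 2),(nat_lit 3)),((nat_lit 1),(nat_lit 3)),((nat_lit 0),(nat_lit 3)),((nat_lit 1),(nat_lit 2)),((nat_lit 0),(nat_lit 2)),((nat_lit 0),(nat_lit 1))]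
def yT : ℕ := (nat_lit 60817149128702871103641263737322156787879901076040472098544090330061585706271254991700709912828736066864795398485466202354688)
def fT : ℕ := (nat_lit 298797297893192366726550497087928533371980540933541480873232277021355887167951876856578257399957927244474039369953876997542912)
def lt (a b : ℕ) : Bool := Nat.ble (Nat.succ a) b
def posn (i j : ℕ) : ℕ := Nat.mul (nat_lit 10) (Nat.add (Nat.mul (nat_lit 7) i) j)
def unp (T i j : ℕ) : ℕ := Nat.land (Nat.shiftRight T (posn i j)) (nat_lit 1023)
def code (i j : ℕ) : ℕ := Nat.sub (nat_lit 48) (Nat.add (Nat.mul (nat_lit 7) j) i)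
def sP (i : ℕ) : ℕ := nth [(nat_lit 233), (nat_lit 239), (nat_lit 241), (nat_lit 251), (nat_lit 257), (nat_lit 263), (nat_lit 269)] i
def wv (w i : ℕ) : ℕ := Nat.land (Nat.shiftRight w (Nat.mul (nat_lit 3) i)) (nat_lit 7)
def sg (w i : ℕ) : ℕ := force (wv w i) fun k => bif Nat.beq k (nat_lit 7) then (nat_lit 1) else bif Nat.ble i k then sP k else sP i
def zt (w i j : ℕ) : ℕ :=
  bif Nat.beq (wv w i) (nat_lit 7) then unp yT i j else
  bif Nat.beq (wv w j) (nat_lit 7) then (nat_lit 0) else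
  force (wv w j) fun i' => force (wv w i) fun j' =>
  bif lt i' j' then
    (bif lt (code i j) (code i' j') then unp yT i j else
     bif Nat.beq (code i j) (code i' j') then (nat_lit 0) else Nat.mul (nat_lit 2) (unp yT i' j'))
  else (nat_lit 0)
/-- table of the monomials of Z -/
def zT (w : ℕ) : ℕ := up.rec (nat_lit 0) (fun a _ ih => Nat.lor (Nat.shiftLeft (zt w a.1 a.2) (posn a.1 a.2)) ih)
/-- list of representatives -/
def reps (w : ℕ) : List (ℕ × ℕ) := up.rec [] (fun a _ ih => bif Nat.beq (zt w a.1 a.2) (unp yT a.1 a.2) then a :: ih else ih)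
def rT (R : List (ℕ × ℕ)) : ℕ := R.rec (nat_lit 0) (fun a _ ih => Nat.lor (Nat.shiftLeft (unp fT a.1 a.2) (posn a.1 a.2)) ih)
def insN (m : ℕ) (l : List ℕ) : List ℕ := force m fun m => bif Nat.beq m (nat_lit 0) then l else ins m l
def lowl (k : ℕ) : List ℕ := lrec [] (fun i _ ih => bif lt i k then i :: ih else ih) [(nat_lit 0),(nat_lit 1),(nat_lit 2),(nat_lit 3),(nat_lit 4),(nat_lit 5),(nat_lit 6)]
def highl (k : ℕ) : List ℕ := lrec [] (fun i _ ih => bif lt k i then i :: ih else ih) [(nat_lit 0),(nat_lit 1),(nat_lit 2),(nat_lit 3),(nat_lit 4),(nat_lit 5),(nat_lit 6)]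
def unitT (w Z f k j s : ℕ) (acc : List ℕ) : List ℕ :=
  force (Nat.mul (sg w k) s) fun c1 => force (Nat.mul (sg w j) (opp s)) fun c2 =>
  lrec (lrec acc (fun i _ ih => insN (nrm (Nat.mul (Nat.mul (unp f i j) c1) (unp Z i k))) ih) (lowl k))
    (fun l _ ih => insN (nrm (Nat.mul (Nat.mul (unp f k l) c2) (unp Z j l))) ih) (highl j)
def eqb (w Z f : ℕ) (b : ℕ × ℕ) : List ℕ :=
  unitT w Z f b.1 b.2 (nat_lit 1) (bif Nat.beq (wv w b.1) (nat_lit 7) then [] else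
    (bif Nat.beq (wv w b.2) (nat_lit 7) then [] else unitT w Z f (wv w b.2) (wv w b.1) (nat_lit 2) []))
def eqs (w Z f : ℕ) (R : List (ℕ × ℕ)) : List (List ℕ) := R.rec [] (fun b _ ih => eqb w Z f b :: ih)
def frP (R : List (ℕ × ℕ)) : ℕ := R.rec (nat_lit 1) (fun b _ ih => Nat.mul (Nat.mul (unp yT b.1 b.2) (unp fT b.1 b.2)) ih)
def lenR (R : List (ℕ × ℕ)) : ℕ := R.rec (nat_lit 0) (fun _ _ ih => Nat.succ (Nat.succ ih))
def cntD (G : ℕ) : ℕ := lrec (nat_lit 0) (fun p _ ih => bif dvd p G then Nat.succ ih else ih) vars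
def rmul (c d : ℕ) (o : Option Res) : Option Res :=
   match o with
   | none => none
   | some ⟨r, b⟩ => some ⟨Int.mul r (Int.ofNat c), Nat.mul b d⟩
def runU (E : List (List ℕ)) (P Fr Un nf nu e : ℕ) : Option Res :=
   force (Nat.gcd Fr P) fun F' => force (Nat.gcd Un P) fun U' => 
   force (cntD F') fun nf' => force (cntD U') fun nu' => 
   force (Nat.add e (Nat.sub nf nf')) fun k =>
   rmul (Nat.mul (Nat.pow ((nat_lit 340282366920938463463374607431768211457)) k) (Nat.pow (nat_lit 340282366920938463463374607431768211456) (Nat.sub nu nu'))) (Nat.pow (nat_lit 2) k) (run (nat_lit 200) E F' U' nf' nu')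
def leafW (w Un nu e : ℕ) : Option Res :=
  force w fun w => force (zT w) fun Z => (fun R => force (rT R) fun f => 
   seqLL (eqs w Z f R) fun E => force (prodAll E) fun P => runU E P (frP R) Un (lenR R) nu e) (reps w)
def gtc (j : ℕ) (l : List ℕ) : ℕ := lrec (nat_lit 0) (fun i _ ih => bif lt j i then Nat.succ ih else ih) l
def len (l : List ℕ) : ℕ := lrec (nat_lit 0) (fun _ _ ih => Nat.succ ih) l
/-- set w_i := j (was 7) -/
def setw (w i j : ℕ) : ℕ := Nat.xor w (Nat.shiftLeft (Nat.sub (nat_lit 7) j) (Nat.mul (nat_lit 3) i))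
def total (fuel : ℕ) : List ℕ → ℕ → ℕ → ℕ → ℕ → Option Res :=
  Nat.rec (motive := fun _ => List ℕ → ℕ → ℕ → ℕ → ℕ → Option Res) (fun _ w Un nu e => leafW w Un nu e)
   (fun _ ih I w0 Un nu e => force w0 fun w => match I with
     | [] => leafW w Un nu e
     | i :: I => radd (ih I w Un nu e) (radd (ih I (setw w i i) (Nat.mul Un (sP i)) (Nat.succ nu) (Nat.add e (len I)))
         (lrec (some Res.zero) (fun j _ acc => radd (ih (del j I) (setw (setw w i j) j i) (Nat.mul Un (sP j)) (Nat.succ nu)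
            (Nat.add e (Nat.add (len I) (gtc j I)))) acc) I))) fuel
def target : ℤ := (BB:ℤ)^14 + 18*BB^13+158*BB^12+899*BB^11+3740*BB^10+11985*BB^9+29328*BB^8+52055*BB^7+62930*BB^6+48797*BB^5+22855*BB^4+6020*BB^3+812*BB^2+49*BB+1
def ok (o : Option Res) (t : ℤ) : Bool := match o with | none => false | some ⟨r, b⟩ => decide (r = t) && Nat.ble (4*b) BB
end
end SpC

namespace SpC
open Finset
/-! ### semantics of monomials and polynomials -/
section Sem
variable {F : Type*} [Field F]
/-- value of a prime -/
def pv (a : ℕ → F) (p : ℕ) : F := if p = 2 then -1 else a p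
/-- value of a monomial -/
def ev (a : ℕ → F) (m : ℕ) : F := if m = 0 then 0 else (m.primeFactorsList.map (pv a)).prod
def pe (a : ℕ → F) (l : List ℕ) : F := (l.map (ev a)).sum
def sat (a : ℕ → F) (E : List (List ℕ)) : Prop := ∀ p ∈ E, pe a p = 0

@[simp] lemma ev_zero (a : ℕ → F) : ev a 0 = 0 := by simp [ev]
@[simp] lemma ev_one (a : ℕ → F) : ev a 1 = 1 := by simp [ev]
lemma ev_mul (a : ℕ → F) (m n : ℕ) : ev a (m * n) = ev a m * ev a n := by
  unfold ev
  by_cases hm : m = 0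
  · simp [hm]
  by_cases hn : n = 0
  · simp [hn]
  simp only [hm, hn, mul_eq_zero, or_self, if_false]
  rw [((Nat.perm_primeFactorsList_mul hm hn).map _).prod_eq, List.map_append, List.prod_append]
lemma ev_prime (a : ℕ → F) {p : ℕ} (hp : p.Prime) : ev a p = pv a p := by
  simp [ev, hp.ne_zero, Nat.primeFactorsList_prime hp]
@[simp] lemma ev_two (a : ℕ → F) : ev a 2 = -1 := by
  rw [ev_prime a Nat.prime_two]; simp [pv]
lemma ev_odd (a : ℕ → F) {p : ℕ} (hp : p.Prime) (h2 : p ≠ 2) : ev a p = a p := by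
  rw [ev_prime a hp]; simp [pv, h2]
@[simp] lemma ev_four (a : ℕ → F) : ev a 4 = 1 := by
  rw [show 4 = 2 * 2 from rfl, ev_mul]; simp
lemma ev_eq_zero (a : ℕ → F) {m : ℕ} (hm : m ≠ 0) :
    ev a m = 0 ↔ ∃ p, p.Prime ∧ p ∣ m ∧ pv a p = 0 := by
  simp only [ev, hm, if_false, List.prod_eq_zero_iff, List.mem_map, Nat.mem_primeFactorsList hm, and_assoc]
lemma ev_congr {a b : ℕ → F} {m : ℕ} (h : ∀ p, p.Prime → p ∣ m → a p = b p) : ev a m = ev b m := by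
  unfold ev
  split_ifs with hm
  · rfl
  · congr 1
    apply List.map_congr_left
    intro p hp
    rw [Nat.mem_primeFactorsList hm] at hp
    simp [pv, h p hp.1 hp.2]
lemma ev_upd (a : ℕ → F) {x m : ℕ} (t : F) (h : ¬ x ∣ m) : ev (Function.update a x t) m = ev a m := by
  apply ev_congr
  intro p _ hp
  rw [Function.update_of_ne]
  rintro rfl; exact h hp
@[simp] lemma pe_nil (a : ℕ → F) : pe a [] = 0 := rfl
@[simp] lemma pe_cons (a : ℕ → F) (m l) : pe a (m :: l) = ev a m + pe a l := by simp [pe]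
@[simp] lemma sat_nil (a : ℕ → F) : sat a [] := by simp [sat]
@[simp] lemma sat_cons (a : ℕ → F) (p E) : sat a (p :: E) ↔ pe a p = 0 ∧ sat a E := by simp [sat]
end Sem

/-! ### basic list functions -/
@[simp] lemma force_eq {β : Type} (n : ℕ) (k : ℕ → β) : force n k = k n := by cases n <;> rfl
@[simp] lemma seqL_eq {β : Type} (l : List ℕ) (k : List ℕ → β) : seqL l k = k l := by
  induction l generalizing k with
  | nil => rfl
  | cons a l ih =>
    change force a (fun a => seqL l fun t => k (a :: t)) = _
    rw [force_eq, ih]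
@[simp] lemma seqLL_eq {β : Type} (l : List (List ℕ)) (k : List (List ℕ) → β) : seqLL l k = k l := by
  induction l generalizing k with
  | nil => rfl
  | cons a l ih =>
    change seqL a (fun a => seqLL l fun t => k (a :: t)) = _
    rw [seqL_eq, ih]
lemma beq_iff (x m : ℕ) : Nat.beq x m = true ↔ x = m :=
  ⟨Nat.eq_of_beq_eq_true, fun h => by subst h; exact Nat.beq_refl x⟩
@[simp] lemma dvd_iff (x m : ℕ) : dvd x m = true ↔ x ∣ m := by
  unfold dvd
  rw [show Nat.mod m x = m % x from rfl, beq_iff, Nat.dvd_iff_mod_eq_zero]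
lemma dvd_false (x m : ℕ) : dvd x m = false ↔ ¬ x ∣ m := by
  rw [← dvd_iff, Bool.not_eq_true]
@[simp] lemma lrec_nil {β : Type} (z : β) (f) : lrec z f [] = z := rfl
@[simp] lemma lrec_cons {β : Type} (z : β) (f) (a l) : lrec z f (a :: l) = f a l (lrec z f l) := rfl
@[simp] lemma lrec2_nil {β : Type} (z : β) (f) : lrec2 z f [] = z := rfl
@[simp] lemma lrec2_cons {β : Type} (z : β) (f) (a l) : lrec2 z f (a :: l) = f a l (lrec2 z f l) := rfl
lemma cdvd {β : Type*} (x m : ℕ) (s t : β) : (bif dvd x m then s else t) = if x ∣ m then s else t := by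
  by_cases h : x ∣ m
  · rw [(dvd_iff x m).2 h]; simp [h]
  · rw [(dvd_false x m).2 h]; simp [h]
lemma cbeq {β : Type*} (x m : ℕ) (s t : β) : (bif Nat.beq x m then s else t) = if x = m then s else t := by
  by_cases h : x = m
  · rw [(beq_iff x m).2 h]; simp [h]
  · have : Nat.beq x m = false := by
      rw [← Bool.not_eq_true, beq_iff]; exact h
    rw [this]; simp [h]

lemma occ_iff (x : ℕ) (p : List ℕ) : occ x p = true ↔ ∃ m ∈ p, x ∣ m := by
  induction p with
  | nil => simp [occ]
  | cons m p ih =>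
    have : occ x (m :: p) = bif dvd x m then true else occ x p := rfl
    rw [this, cdvd]
    split_ifs with h <;> simp [h, ih]
lemma occ_false (x : ℕ) (p : List ℕ) : occ x p = false ↔ ∀ m ∈ p, ¬ x ∣ m := by
  rw [← Bool.not_eq_true, occ_iff]; push Not; rfl
lemma noOcc_iff (x : ℕ) (E : List (List ℕ)) : noOcc x E = true ↔ ∀ e ∈ E, ∀ m ∈ e, ¬ x ∣ m := by
  induction E with
  | nil => simp [noOcc]
  | cons e E ih =>
    have : noOcc x (e :: E) = bif occ x e then false else noOcc x E := rfl
    rw [this, List.forall_mem_cons, ← occ_false, ← ih]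
    cases occ x e <;> simp
lemma leqb_eq (p q : List ℕ) : leqb p q = true → p = q := by
  induction p generalizing q with
  | nil => cases q <;> simp [leqb]
  | cons a p ih =>
    cases q with
    | nil => simp [leqb]
    | cons b q =>
      have : leqb (a :: p) (b :: q) = bif Nat.beq a b then leqb p q else false := rfl
      rw [this, cbeq]
      split_ifs with h
      · intro h2; rw [h, ih q h2]
      · simp
section
variable {F : Type*} [Field F]
lemma pe_upd (a : ℕ → F) {x : ℕ} {p : List ℕ} (t : F) (h : ∀ m ∈ p, ¬ x ∣ m) :
    pe (Function.update a x t) p = pe a p := by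
  unfold pe
  congr 1
  apply List.map_congr_left
  intro m hm
  exact ev_upd a t (h m hm)
lemma sat_upd (a : ℕ → F) {x : ℕ} {E : List (List ℕ)} (t : F) (h : ∀ e ∈ E, ∀ m ∈ e, ¬ x ∣ m) :
    sat (Function.update a x t) E ↔ sat a E := by
  unfold sat
  apply forall₂_congr
  intro e he
  rw [pe_upd a t (h e he)]
lemma ev_nrm (a : ℕ → F) (m : ℕ) : ev a (nrm m) = ev a m := by
  unfold nrm
  rw [cdvd]
  split_ifs with h
  · obtain ⟨k, rfl⟩ := h
    rw [show Nat.div (4 * k) 4 = k from Nat.mul_div_cancel_left k (by norm_num), ev_mul]; simp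
  · rfl
lemma ev_opp (a : ℕ → F) (m : ℕ) : ev a (opp m) = - ev a m := by
  unfold opp
  rw [cdvd]
  split_ifs with h
  · obtain ⟨k, rfl⟩ := h
    rw [show Nat.div (2 * k) 2 = k from Nat.mul_div_cancel_left k (by norm_num), ev_mul]; simp
  · rw [show Nat.mul 2 m = 2 * m from rfl, ev_mul]; simp
lemma memb_iff (x : ℕ) (l : List ℕ) : memb x l = true ↔ x ∈ l := by
  induction l with
  | nil => simp [memb]
  | cons m l ih =>
    have : memb x (m :: l) = bif Nat.beq x m then true else memb x l := rfl
    rw [this, cbeq]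
    split_ifs with h <;> simp [h, ih]
lemma del_eq (x : ℕ) (l : List ℕ) : del x l = l.erase x := by
  induction l with
  | nil => simp [del]
  | cons m l ih =>
    have : del x (m :: l) = bif Nat.beq x m then l else m :: del x l := rfl
    rw [this, cbeq]
    split_ifs with h
    · simp [h]
    · rw [List.erase_cons_tail (by simpa using fun h' => h h'.symm), ih]
lemma pe_ins (a : ℕ → F) (m : ℕ) (l : List ℕ) : pe a (ins m l) = ev a m + pe a l := by
  unfold ins
  rw [force_eq]
  cases h : memb (opp m) l with
  | false => simp
  | true =>
    rw [memb_iff] at h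
    simp only [cond_true]
    rw [del_eq]
    have := ((List.perm_cons_erase h).map (ev a)).sum_eq
    rw [List.map_cons, List.sum_cons, ev_opp] at this
    change pe a l = - ev a m + pe a (l.erase (opp m)) at this
    rw [this]; ring
lemma pe_mulAcc (a : ℕ → F) (k : ℕ) (r acc : List ℕ) :
    pe a (mulAcc k r acc) = ev a k * pe a r + pe a acc := by
  induction r with
  | nil => simp [mulAcc]
  | cons m r ih =>
    have : mulAcc k (m :: r) acc = force (nrm (Nat.mul k m)) fun v => seqL (mulAcc k r acc) fun ih => ins v ih := rfl
    rw [this, force_eq, seqL_eq, pe_ins, ev_nrm, ih, show Nat.mul k m = k * m from rfl, ev_mul, pe_cons]; ring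
lemma pe_split (a : ℕ → F) (x : ℕ) (p : List ℕ) :
    pe a p = ev a x * pe a (split1 x p) + pe a (split0 x p) := by
  induction p with
  | nil => simp [split1, split0]
  | cons m p ih =>
    have h1 : split1 x (m :: p) = bif dvd x m then (force (Nat.div m x) fun v => v :: split1 x p) else split1 x p := rfl
    have h0 : split0 x (m :: p) = bif dvd x m then split0 x p else m :: split0 x p := rfl
    rw [h1, h0, cdvd, cdvd, force_eq, pe_cons, ih]
    split_ifs with h
    · obtain ⟨k, rfl⟩ := h
      rcases Nat.eq_zero_or_pos x with rfl | hx
      · simp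
      · rw [show Nat.div (x * k) x = k from Nat.mul_div_cancel_left k hx, ev_mul, pe_cons]; ring
    · simp; ring
lemma split0_free (x : ℕ) (p : List ℕ) : ∀ m ∈ split0 x p, ¬ x ∣ m := by
  induction p with
  | nil => simp [split0]
  | cons m p ih =>
    have h0 : split0 x (m :: p) = bif dvd x m then split0 x p else m :: split0 x p := rfl
    rw [h0, cdvd]
    split_ifs with h
    · exact ih
    · simp [h]; exact ih
lemma pe_subst1 (a : ℕ → F) (x u : ℕ) (r e : List ℕ) (h : ev a x * ev a u + pe a r = 0) :
    pe a (subst1 x u r e) = ev a u * pe a e := by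
  induction e with
  | nil => simp [subst1]
  | cons n e ih =>
    have h1 : subst1 x u r (n :: e) = bif dvd x n then
      (force (nrm (Nat.mul (nat_lit 2) (Nat.div n x))) fun k => seqL (subst1 x u r e) fun ih => mulAcc k r ih)
     else (force (nrm (Nat.mul n u)) fun v => seqL (subst1 x u r e) fun ih => ins v ih) := rfl
    rw [h1, cdvd, force_eq, force_eq, seqL_eq, seqL_eq]
    split_ifs with hd
    · obtain ⟨k, rfl⟩ := hd
      rcases Nat.eq_zero_or_pos x with rfl | hx
      · rw [pe_mulAcc, ih, ev_nrm]
        simp only [Nat.zero_mul, pe_cons, ev_zero]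
        rw [show Nat.mul 2 (Nat.div 0 0) = 0 from rfl]; simp
      · rw [show Nat.div (x * k) x = k from Nat.mul_div_cancel_left k hx, pe_mulAcc, ih, ev_nrm,
          show Nat.mul 2 k = 2 * k from rfl, ev_mul, pe_cons, ev_mul, ev_two]
        linear_combination (- ev a k) * h
    · rw [pe_ins, ih, ev_nrm, show Nat.mul n u = n * u from rfl, ev_mul, pe_cons]; ring
lemma sat_subst (a : ℕ → F) (x u : ℕ) (r p : List ℕ) (E : List (List ℕ)) (h : ev a x * ev a u + pe a r = 0)
    (hp : pe a p = 0) (hu : ev a u ≠ 0) : sat a (subst x u r p E) ↔ sat a E := by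
  induction E with
  | nil => simp [subst]
  | cons e E ih =>
    have h1 : subst x u r p (e :: E) = bif occ x e then (bif leqb e p then subst x u r p E else subst1 x u r e :: subst x u r p E) else e :: subst x u r p E := rfl
    rw [h1]
    cases h2 : occ x e with
    | false => simp [ih]
    | true =>
      cases h3 : leqb e p with
      | true =>
        rw [leqb_eq _ _ h3]; simp [ih, hp]
      | false => simp [ih, pe_subst1 a x u r e h, hu]
lemma sameUp_spec (a : ℕ → F) (p q : List ℕ) (h : sameUp p q = true) (hq : pe a q = 0) : pe a p = 0 := by
  unfold sameUp at h
  rw [Bool.or_eq_true] at h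
  rcases h with h | h
  · have h1 := pe_mulAcc a 1 p q
    split at h
    · rename_i h2
      rw [h2] at h1
      simp [hq] at h1; exact h1.symm
    · simp at h
  · have h1 := pe_mulAcc a 2 p q
    split at h
    · rename_i h2
      rw [h2] at h1
      simp [hq] at h1; exact h1
    · simp at h
lemma any_spec (p : List ℕ) (E : List (List ℕ)) (h : lrec2 false (fun q _ i2 => bif sameUp p q then true else i2) E = true) :
    ∃ q ∈ E, sameUp p q = true := by
  induction E with
  | nil => simp at h
  | cons q E ih =>
    rw [lrec2_cons] at h
    cases h1 : sameUp p q with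
    | true => exact ⟨q, by simp, h1⟩
    | false =>
      rw [h1] at h
      obtain ⟨q', h2, h3⟩ := ih h
      exact ⟨q', by simp [h2], h3⟩
lemma sat_dedupe (a : ℕ → F) (E : List (List ℕ)) : sat a (dedupe E) ↔ sat a E := by
  induction E with
  | nil => simp [dedupe]
  | cons p E ih =>
    have h1 : dedupe (p :: E) = bif lrec2 false (fun q _ i2 => bif sameUp p q then true else i2) E then dedupe E else p :: dedupe E := rfl
    rw [h1]
    cases h2 : lrec2 false (fun q _ i2 => bif sameUp p q then true else i2) E with
    | false => simp [ih]
    | true =>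
      obtain ⟨q, hq, h3⟩ := any_spec p E h2
      simp only [cond_true, ih, sat_cons, iff_and_self]
      intro hs
      exact sameUp_spec a p q h3 (hs q hq)
end
end SpC

namespace SpC
open Finset
section
variable {F : Type*} [Field F]
lemma allEq_spec (m : ℕ) (t : List ℕ) (h : allEq m t = true) : t = List.replicate t.length m := by
  induction t with
  | nil => rfl
  | cons n t ih =>
    have h1 : allEq m (n :: t) = bif Nat.beq m n then allEq m t else false := rfl
    rw [h1, cbeq] at h
    split_ifs at h with h2
    rw [List.length_cons, List.replicate_succ, ← ih h, h2]
lemma pe_replicate (a : ℕ → F) (n m : ℕ) : pe a (List.replicate n m) = n * ev a m := by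
  induction n with
  | zero => simp
  | succ n ih => rw [List.replicate_succ, pe_cons, ih]; push_cast; ring
lemma okLen_spec (t : List ℕ) (h : okLen t = true) (h2 : (2 : F) ≠ 0) : ((t.length + 1 : ℕ) : F) ≠ 0 := by
  unfold okLen at h
  split at h
  · simp
  · simpa [one_add_one_eq_two] using h2
  · simp only [List.length_cons, List.length_nil]
    intro h3
    apply h2
    have : (2 : F) * 2 = 0 := by rw [← h3]; norm_num
    simpa using this
  · simp at h
lemma pe_single (a : ℕ → F) (Fr : ℕ) (p : List ℕ) (h2 : (2 : F) ≠ 0) (hF : Fr ≠ 0) :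
    pe a (single Fr p) = 0 ↔ pe a p = 0 := by
  unfold single
  cases p with
  | nil => simp
  | cons m t =>
    simp only [cdvd, force_eq]
    cases h3 : allEq m t with
    | false => simp
    | true =>
      cases h4 : okLen t with
      | false => simp
      | true =>
        simp only [cond_true]
        split_ifs with h5
        · have h6 := allEq_spec m t h3
          have h7 : m :: t = List.replicate (t.length + 1) m := by
            rw [List.replicate_succ, ← h6]
          rw [h7, pe_replicate, mul_eq_zero, or_iff_right (okLen_spec t h4 h2)]
          simp only [pe_cons, pe_nil, add_zero]
          have hm : m ≠ 0 := by
            rintro rfl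
            rw [zero_dvd_iff] at h5
            have : 2 * Fr ^ 4 = 0 := h5
            simp [hF] at this
          rw [ev_eq_zero a hm, ev_eq_zero a (Nat.gcd_ne_zero_left hm)]
          constructor
          · rintro ⟨p, hp, hd, hv⟩
            exact ⟨p, hp, hd.trans (Nat.gcd_dvd_left _ _), hv⟩
          · rintro ⟨p, hp, hd, hv⟩
            refine ⟨p, hp, Nat.dvd_gcd hd ?_, hv⟩
            have h8 : p ∣ 2 * Fr ^ 4 := hd.trans h5
            rcases (hp.dvd_mul).1 h8 with h8 | h8
            · rw [Nat.prime_dvd_prime_iff_eq hp Nat.prime_two] at h8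
              rw [h8] at hv
              simp [pv] at hv
            · exact hp.dvd_of_dvd_pow h8
        · rfl
lemma gcds_spec (g : ℕ) (p : List ℕ) : gcds g p ∣ g ∧ ∀ m ∈ p, gcds g p ∣ m := by
  induction p with
  | nil => simp [gcds]
  | cons m p ih =>
    have h1 : gcds g (m :: p) = Nat.gcd m (gcds g p) := rfl
    rw [h1]
    refine ⟨(Nat.gcd_dvd_right _ _).trans ih.1, ?_⟩
    intro n hn
    rcases List.mem_cons.1 hn with rfl | hn
    · exact Nat.gcd_dvd_left _ _
    · exact (Nat.gcd_dvd_right _ _).trans (ih.2 n hn)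
lemma pe_strip (a : ℕ → F) (g : ℕ) (p : List ℕ) (h : ∀ m ∈ p, g ∣ m) : pe a p = ev a g * pe a (strip g p) := by
  unfold strip
  rw [cbeq]
  split_ifs with h1
  · simp [h1]
  · clear h1
    induction p with
    | nil => simp
    | cons m p ih =>
      rw [lrec_cons, force_eq, pe_cons, pe_cons, mul_add, ← ih (fun n hn => h n (by simp [hn])), ← ev_mul,
        show Nat.div m g = m / g from rfl, Nat.mul_div_cancel' (h m (by simp))]
lemma sat_norm (a : ℕ → F) (Fr U4 : ℕ) (E : List (List ℕ)) (h2 : (2 : F) ≠ 0) (hF : Fr ≠ 0)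
    (hU : ∀ g, g ∣ U4 → ev a g ≠ 0) : sat a (norm Fr U4 E) ↔ sat a E := by
  induction E with
  | nil => simp [norm]
  | cons p E ih =>
    cases p with
    | nil =>
      have h1 : norm Fr U4 ([] :: E) = norm Fr U4 E := rfl
      rw [h1, ih]; simp
    | cons m p =>
      have h1 : norm Fr U4 ((m :: p) :: E) = (force (gcds U4 (m :: p)) fun g => single Fr (strip g (m :: p))) :: norm Fr U4 E := rfl
      rw [h1, sat_cons, sat_cons, ih, force_eq, pe_single a _ _ h2 hF]
      have h3 := gcds_spec U4 (m :: p)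
      rw [pe_strip a _ (m :: p) h3.2, mul_eq_zero, or_iff_right (hU _ h3.1)]
lemma sat_parts0 (x : ℕ) (E : List (List ℕ))
    (h : lrec2 (nat_lit 0) (fun e _ i2 => bif occ x e then Nat.succ i2 else i2) E = 0) :
    others x E = E := by
  induction E with
  | nil => rfl
  | cons e E ih =>
    have h1 : others x (e :: E) = bif occ x e then others x E else e :: others x E := rfl
    rw [lrec2_cons] at h
    rw [h1]
    cases h2 : occ x e with
    | true => simp [h2] at h
    | false =>
      rw [h2] at h
      simp [ih h]
lemma sat_parts (a : ℕ → F) (x : ℕ) (E : List (List ℕ))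
    (h : lrec2 (nat_lit 0) (fun e _ i2 => bif occ x e then Nat.succ i2 else i2) E = 1) :
    theP x E ∈ E ∧ (sat a E ↔ pe a (theP x E) = 0 ∧ sat a (others x E)) := by
  induction E with
  | nil => simp at h
  | cons e E ih =>
    have h1 : others x (e :: E) = bif occ x e then others x E else e :: others x E := rfl
    have h3 : theP x (e :: E) = bif occ x e then e else theP x E := rfl
    rw [lrec2_cons] at h
    rw [h1, h3]
    cases h2 : occ x e with
    | true =>
      rw [h2] at h
      simp only [cond_true]
      have := sat_parts0 x E (by simpa using h)
      rw [this]; simp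
    | false =>
      rw [h2] at h
      have := ih h
      simp only [cond_false]
      refine ⟨by simp [this.1], ?_⟩
      rw [sat_cons, sat_cons, this.2]; tauto
lemma others_free (x : ℕ) (E : List (List ℕ)) : ∀ e ∈ others x E, ∀ m ∈ e, ¬ x ∣ m := by
  induction E with
  | nil => simp [others]
  | cons e E ih =>
    have h1 : others x (e :: E) = bif occ x e then others x E else e :: others x E := rfl
    rw [h1]
    cases h2 : occ x e with
    | true => exact ih
    | false =>
      rw [occ_false] at h2
      simp only [cond_false, List.forall_mem_cons]
      exact ⟨h2, ih⟩
lemma lin_spec (x : ℕ) (E : List (List ℕ)) (h : lrec2 true (fun e _ i2 => bif occ x (split1 x e) then false else i2) E = true) :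
    ∀ e ∈ E, ∀ m ∈ split1 x e, ¬ x ∣ m := by
  induction E with
  | nil => simp
  | cons e E ih =>
    rw [lrec2_cons] at h
    cases h2 : occ x (split1 x e) with
    | true => simp [h2] at h
    | false =>
      rw [h2] at h
      rw [occ_false] at h2
      simp only [List.forall_mem_cons]
      exact ⟨h2, ih h⟩
lemma cand7_aux (E : List (List ℕ)) (l : List ℕ) (x : ℕ) (hx : x ≠ 0)
    (h : lrec (nat_lit 0) (fun x _ ih => bif Nat.beq (lrec2 (nat_lit 0) (fun e _ i2 => bif occ x e then Nat.succ i2 else i2) E) (nat_lit 1) then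
    (bif lrec2 true (fun e _ i2 => bif occ x (split1 x e) then false else i2) E then x else ih) else ih) l = x) :
    lrec2 (nat_lit 0) (fun e _ i2 => bif occ x e then Nat.succ i2 else i2) E = 1 ∧
    lrec2 true (fun e _ i2 => bif occ x (split1 x e) then false else i2) E = true := by
  induction l with
  | nil => exact absurd h.symm hx
  | cons y l ih =>
    rw [lrec_cons, cbeq] at h
    split_ifs at h with h1
    · cases h2 : lrec2 true (fun e _ i2 => bif occ y (split1 y e) then false else i2) E with
      | true =>
        rw [h2, cond_true] at h
        subst h
        exact ⟨h1, h2⟩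
      | false =>
        rw [h2, cond_false] at h
        exact ih h
    · exact ih h
end
/-! find -/
lemma isOne_spec (p : List ℕ) (h : isOne p = true) : p = [1] := by
  cases p with
  | nil => simp [isOne] at h
  | cons m t =>
    cases t with
    | nil => 
      have h1 : Nat.beq m 1 = true := h
      rw [beq_iff] at h1; rw [h1]
    | cons n t => simp [isOne] at h
lemma cand_aux (Fr : ℕ) (p l : List ℕ) (m : ℕ) (hm : m ≠ 0)
    (h : lrec (nat_lit 0) (fun m _ ih => force (Nat.gcd m Fr) fun x =>
    bif isVar x then (bif dvd x (Nat.div m x) then ih else (bif Nat.beq (cnt x p) (nat_lit 1) then m else ih)) else ih) l = m) :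
    m ∈ l ∧ isVar (Nat.gcd m Fr) = true ∧ ¬ (Nat.gcd m Fr ∣ m / Nat.gcd m Fr) ∧ cnt (Nat.gcd m Fr) p = 1 := by
  induction l with
  | nil => exact absurd h.symm hm
  | cons y l ih =>
    rw [lrec_cons, force_eq] at h
    cases h1 : isVar (Nat.gcd y Fr) with
    | false =>
      rw [h1, cond_false] at h
      have := ih h
      exact ⟨by simp [this.1], this.2⟩
    | true =>
      rw [h1, cond_true, cdvd, cbeq] at h
      split_ifs at h with h2 h3
      · have := ih h
        exact ⟨by simp [this.1], this.2⟩
      · subst h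
        exact ⟨by simp, h1, h2, h3⟩
      · have := ih h
        exact ⟨by simp [this.1], this.2⟩
lemma find_spec (Fr : ℕ) (E : List (List ℕ)) :
    (find Fr E = Act.contra → [1] ∈ E) ∧ (∀ m p, find Fr E = Act.solve m p → p ∈ E ∧ m ≠ 0 ∧ cand Fr p = m) := by
  induction E with
  | nil => simp [find]
  | cons e E ih =>
    have h1 : find Fr (e :: E) = bif isOne e then Act.contra else
      Nat.rec (find Fr E) (fun m _ => Act.solve (Nat.succ m) e) (cand Fr e) := rfl
    rw [h1]
    cases h2 : isOne e with
    | true => 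
      rw [isOne_spec e h2]; simp
    | false =>
      simp only [cond_false]
      cases h3 : cand Fr e with
      | zero =>
        refine ⟨fun h => by simp [ih.1 h], fun m p h => ?_⟩
        have := ih.2 m p h
        exact ⟨by simp [this.1], this.2⟩
      | succ k =>
        refine ⟨fun h => by simp at h, fun m p h => ?_⟩
        simp only [Act.solve.injEq] at h
        obtain ⟨rfl, rfl⟩ := h
        exact ⟨by simp, by simp, h3⟩
section
variable {F : Type*} [Field F]
lemma cnt0 (x : ℕ) (p : List ℕ) (h : cnt x p = 0) : ∀ m ∈ p, ¬ x ∣ m := by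
  induction p with
  | nil => simp
  | cons n p ih =>
    have h1 : cnt x (n :: p) = bif dvd x n then Nat.succ (cnt x p) else cnt x p := rfl
    rw [h1, cdvd] at h
    split_ifs at h with h2
    simp only [List.forall_mem_cons]
    exact ⟨h2, ih h⟩
lemma split0_self (x : ℕ) (p : List ℕ) (h : ∀ m ∈ p, ¬ x ∣ m) : split0 x p = p := by
  induction p with
  | nil => rfl
  | cons n p ih =>
    have h1 : split0 x (n :: p) = bif dvd x n then split0 x p else n :: split0 x p := rfl
    rw [h1, cdvd, if_neg (h n (by simp)), ih (fun m hm => h m (by simp [hm]))]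
lemma pe_cnt1 (a : ℕ → F) (x m : ℕ) (p : List ℕ) (h : cnt x p = 1) (hm : m ∈ p) (hx : x ∣ m) :
    pe a p = ev a m + pe a (split0 x p) := by
  induction p with
  | nil => simp at hm
  | cons n p ih =>
    have h1 : cnt x (n :: p) = bif dvd x n then Nat.succ (cnt x p) else cnt x p := rfl
    have h3 : split0 x (n :: p) = bif dvd x n then split0 x p else n :: split0 x p := rfl
    rw [h1, cdvd] at h
    rw [h3, cdvd]
    split_ifs at h ⊢ with h2
    · have h4 : cnt x p = 0 := by simpa using h
      have h5 := cnt0 x p h4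
      rw [split0_self x p h5]
      rcases List.mem_cons.1 hm with rfl | h6
      · simp
      · exact absurd hx (h5 m h6)
    · rcases List.mem_cons.1 hm with rfl | h6
      · exact absurd hx h2
      · rw [pe_cons, pe_cons, ih h h6]; ring
end
lemma vars_prime : ∀ x ∈ vars, x.Prime ∧ x ≠ 2 := by
  unfold vars
  simp only [List.forall_mem_cons]
  norm_num
lemma isVar_mem (x : ℕ) (h : isVar x = true) : x ∈ vars := by
  have h1 : ∀ y < 512, isVar y = true → y ∈ vars := by decide +kernel
  by_cases hx : Nat.ble x 511 = true
  · exact h1 x (by have := Nat.le_of_ble_eq_true hx; omega) h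
  · unfold isVar at h
    rw [Bool.not_eq_true] at hx
    rw [hx] at h; simp at h
lemma isVar_prime (x : ℕ) (h : isVar x = true) : x.Prime ∧ x ≠ 2 := vars_prime x (isVar_mem x h)
end SpC

namespace SpC
open Finset
section
variable {F : Type*} [Field F] [Fintype F]
/-- admissible points -/
def Sup (A B : Finset ℕ) (a : ℕ → F) : Prop := (∀ p ∈ B, a p ≠ 0) ∧ ∀ p, p ∉ A → p ∉ B → a p = 0
lemma Sup_finite (A B : Finset ℕ) : {a : ℕ → F | Sup A B a}.Finite := by
  classical
  let f : (ℕ → F) → ((A ∪ B : Finset ℕ) → F) := fun a p => a p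
  apply Set.Finite.of_finite_image (f := f) (Set.toFinite _)
  intro a ha b hb hab
  funext p
  by_cases hp : p ∈ A ∪ B
  · exact congrFun hab ⟨p, hp⟩
  · rw [mem_union, not_or] at hp
    rw [ha.2 p hp.1 hp.2, hb.2 p hp.1 hp.2]
noncomputable def sup (A B : Finset ℕ) : Finset (ℕ → F) := (Sup_finite A B).toFinset
lemma mem_sup {A B : Finset ℕ} {a : ℕ → F} : a ∈ sup A B ↔ Sup A B a := by simp [sup]
open Classical in
/-- number of admissible points with a property -/
noncomputable def Nc (A B : Finset ℕ) (Q : (ℕ → F) → Prop) : ℕ := #{a ∈ sup A B | Q a}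
lemma Nc_congr {A B : Finset ℕ} {Q R : (ℕ → F) → Prop} (h : ∀ a, Sup A B a → (Q a ↔ R a)) : Nc A B Q = Nc A B R := by
  classical
  unfold Nc
  congr 1
  apply filter_congr
  intro a ha
  exact h a (mem_sup.1 ha)
open Classical in
lemma sum_insA {M : Type*} [AddCommMonoid M] (A B : Finset ℕ) (x : ℕ) (hA : x ∉ A) (hB : x ∉ B) (G : (ℕ → F) → M) :
    ∑ a ∈ sup (insert x A) B, G a = ∑ b ∈ sup A B, ∑ t : F, G (Function.update b x t) := by
  rw [← Finset.sum_product']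
  symm
  refine Finset.sum_bij' (fun b _ => Function.update b.1 x b.2) (fun a _ => (Function.update a x 0, a x)) ?_ ?_ ?_ ?_ ?_
  · rintro ⟨b, t⟩ h
    rw [mem_product, mem_sup] at h
    rw [mem_sup]
    refine ⟨fun p hp => ?_, fun p hp1 hp2 => ?_⟩
    · rw [Function.update_of_ne (by rintro rfl; exact hB hp)]; exact h.1.1 p hp
    · rw [mem_insert, not_or] at hp1
      simp only [Function.update_of_ne hp1.1]
      exact h.1.2 p hp1.2 hp2
  · intro a h
    rw [mem_sup] at h
    rw [mem_product, mem_sup]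
    refine ⟨⟨fun p hp => ?_, fun p hp1 hp2 => ?_⟩, mem_univ _⟩
    · simp only; rw [Function.update_of_ne (by rintro rfl; exact hB hp)]; exact h.1 p hp
    · by_cases hx : p = x
      · simp [hx]
      · simp only; rw [Function.update_of_ne hx]; exact h.2 p (by simp [hx, hp1]) hp2
  · rintro ⟨b, t⟩ h
    rw [mem_product, mem_sup] at h
    have : b x = 0 := h.1.2 x hA hB
    simp [← this]
  · intro a h
    simp
  · rintro ⟨b, t⟩ h
    rfl
open Classical in
lemma sum_insB {M : Type*} [AddCommMonoid M] (A B : Finset ℕ) (x : ℕ) (hA : x ∉ A) (hB : x ∉ B) (G : (ℕ → F) → M) :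
    ∑ a ∈ sup A (insert x B), G a = ∑ b ∈ sup A B, ∑ t : F with t ≠ 0, G (Function.update b x t) := by
  have h1 : sup A (insert x B) = (sup (insert x A) B).filter (fun a : ℕ → F => a x ≠ 0) := by
    ext a
    rw [mem_filter, mem_sup, mem_sup]
    constructor
    · rintro ⟨h1, h2⟩
      refine ⟨⟨fun p hp => h1 p (by simp [hp]), fun p hp1 hp2 => ?_⟩, h1 x (by simp)⟩
      rw [mem_insert, not_or] at hp1
      exact h2 p hp1.2 (by simp [hp1.1, hp2])
    · rintro ⟨⟨h1, h2⟩, h3⟩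
      refine ⟨fun p hp => ?_, fun p hp1 hp2 => ?_⟩
      · rcases mem_insert.1 hp with rfl | hp
        · exact h3
        · exact h1 p hp
      · rw [mem_insert, not_or] at hp2
        exact h2 p (by simp [hp2.1, hp1]) hp2.2
  rw [h1, sum_filter, sum_insA A B x hA hB]
  apply sum_congr rfl
  intro b _
  rw [sum_filter]
  apply sum_congr rfl
  intro t _
  simp
open Classical in
lemma Nc_sum (A B : Finset ℕ) (Q : (ℕ → F) → Prop) : Nc A B Q = ∑ a ∈ sup A B, if Q a then 1 else 0 := by
  rw [Nc, card_filter]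
open Classical in
lemma Nc_insA (A B : Finset ℕ) (x : ℕ) (hA : x ∉ A) (hB : x ∉ B) (Q : (ℕ → F) → Prop) :
    Nc (insert x A) B Q = ∑ b ∈ sup A B, #{t : F | Q (Function.update b x t)} := by
  rw [Nc_sum, sum_insA A B x hA hB]; simp
open Classical in
lemma Nc_insB (A B : Finset ℕ) (x : ℕ) (hA : x ∉ A) (hB : x ∉ B) (Q : (ℕ → F) → Prop) :
    Nc A (insert x B) Q = ∑ b ∈ sup A B, #{t : F | t ≠ 0 ∧ Q (Function.update b x t)} := by
  rw [Nc_sum, sum_insB A B x hA hB]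
  apply sum_congr rfl
  intro b _
  rw [← Finset.sum_filter, filter_filter]; simp
lemma Nc_branch (A B : Finset ℕ) (x : ℕ) (hA : x ∉ A) (hB : x ∉ B) (Q : (ℕ → F) → Prop) :
    Nc (insert x A) B Q = Nc (insert x A) B (fun a => a x = 0 ∧ Q a) + Nc A (insert x B) Q := by
  classical
  rw [Nc_insA A B x hA hB, Nc_insA A B x hA hB, Nc_insB A B x hA hB, ← sum_add_distrib]
  apply sum_congr rfl
  intro b _
  rw [← card_filter_add_card_filter_not (fun t : F => t = 0), filter_filter, filter_filter]
  congr 2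
  · ext t; simp [and_comm]
  · ext t; simp [and_comm]
lemma Nc_freeA (A B : Finset ℕ) (x : ℕ) (hA : x ∉ A) (hB : x ∉ B) (Q : (ℕ → F) → Prop)
    (hQ : ∀ a t, Q (Function.update a x t) ↔ Q a) :
    Nc (insert x A) B Q = Fintype.card F * Nc A B Q := by
  classical
  rw [Nc_insA A B x hA hB, Nc_sum, mul_sum]
  apply sum_congr rfl
  intro b _
  simp only [hQ]
  split_ifs with h <;> simp [h]
lemma Nc_freeB (A B : Finset ℕ) (x : ℕ) (hA : x ∉ A) (hB : x ∉ B) (Q : (ℕ → F) → Prop)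
    (hQ : ∀ a t, Q (Function.update a x t) ↔ Q a) :
    Nc A (insert x B) Q = (Fintype.card F - 1) * Nc A B Q := by
  classical
  rw [Nc_insB A B x hA hB, Nc_sum, mul_sum]
  apply sum_congr rfl
  intro b _
  simp only [hQ]
  split_ifs with h
  · simp only [h, and_true, mul_one]
    rw [filter_ne', card_erase_of_mem (mem_univ _), card_univ]
  · simp [h]
/-- eliminating a variable that is determined -/
lemma Nc_solve (A B : Finset ℕ) (x : ℕ) (hA : x ∉ A) (hB : x ∉ B) (u r : (ℕ → F) → F) (Q : (ℕ → F) → Prop)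
    (hQ : ∀ a t, Q (Function.update a x t) ↔ Q a)
    (hu : ∀ a t, u (Function.update a x t) = u a) (hr : ∀ a t, r (Function.update a x t) = r a)
    (hu0 : ∀ a, Sup A B a → u a ≠ 0) :
    Nc (insert x A) B (fun a => a x * u a + r a = 0 ∧ Q a) = Nc A B Q := by
  classical
  rw [Nc_insA A B x hA hB, Nc_sum]
  apply sum_congr rfl
  intro b hb
  have hb' := hu0 b (mem_sup.1 hb)
  simp only [hQ, hu, hr, Function.update_self]
  split_ifs with h
  · simp only [h, and_true]
    rw [card_eq_one]
    refine ⟨- r b / u b, ?_⟩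
    ext t
    simp only [mem_filter, mem_univ, true_and, mem_singleton]
    rw [eq_div_iff hb', add_eq_zero_iff_eq_neg]
  · simp [h]
lemma Nc_do7 (A B : Finset ℕ) (x : ℕ) (hA : x ∉ A) (hB : x ∉ B) (u r : (ℕ → F) → F) (Q : (ℕ → F) → Prop)
    (hQ : ∀ a t, Q (Function.update a x t) ↔ Q a)
    (hu : ∀ a t, u (Function.update a x t) = u a) (hr : ∀ a t, r (Function.update a x t) = r a) :
    (Nc A (insert x B) (fun a => a x * u a + r a = 0 ∧ Q a) : ℤ) =
      Nc (insert x A) B (fun a => a x = 0 ∧ Q a) - Nc (insert x A) B (fun a => a x = 0 ∧ u a = 0 ∧ Q a)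
      - Nc (insert x A) B (fun a => a x = 0 ∧ r a = 0 ∧ Q a) + Nc (insert x A) B (fun a => u a = 0 ∧ r a = 0 ∧ Q a) := by
  classical
  rw [Nc_insA A B x hA hB, Nc_insA A B x hA hB, Nc_insA A B x hA hB, Nc_insA A B x hA hB, Nc_insB A B x hA hB]
  push_cast
  rw [← sum_sub_distrib, ← sum_sub_distrib, ← sum_add_distrib]
  apply sum_congr rfl
  intro b hb
  simp only [hQ, hu, hr, Function.update_self]
  by_cases h : Q b
  swap
  · simp [h]
  have hz : #{t : F | t ≠ 0} = Fintype.card F - 1 := by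
    rw [filter_ne', card_erase_of_mem (mem_univ _), card_univ]
  have hc : 0 < Fintype.card F := Fintype.card_pos
  have hs : ∀ c : F, #{t : F | t = c} = 1 := fun c => card_eq_one.2 ⟨c, by ext; simp⟩
  by_cases h1 : u b = 0 <;> by_cases h2 : r b = 0 <;> simp only [h, h1, h2, and_true, and_false, mul_zero, add_zero, zero_add]
  · simp only [hs, filter_true, card_univ, hz]
    push_cast [Nat.cast_sub hc]; ring
  · simp
  · have : ∀ t : F, (t ≠ 0 ∧ t * u b = 0) ↔ False := by
      intro t
      rw [mul_eq_zero, or_iff_left h1]; tauto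
    simp only [this, hs]; simp
  · have : ∀ t : F, (t ≠ 0 ∧ t * u b + r b = 0) ↔ t = - r b / u b := by
      intro t
      rw [eq_div_iff h1, add_eq_zero_iff_eq_neg]
      constructor
      · exact fun h => h.2
      · intro h3
        refine ⟨?_, h3⟩
        rintro rfl
        apply h2; simpa using h3
    simp only [this, hs]; simp
end
end SpC

namespace SpC
set_option linter.unusedSectionVars false
open Finset Polynomial
/-- a result record describes the number c -/
def Good (v : ℤ) (o : Option Res) (c : ℤ) : Prop :=
  ∀ s, o = some s → ∃ P : ℤ[X], P.eval v = c ∧ P.eval (BB : ℤ) = s.r ∧ ∀ k, |P.coeff k| ≤ s.b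
lemma Good_none (v c : ℤ) : Good v none c := by intro s h; simp at h
lemma Good_zero (v : ℤ) : Good v (some Res.zero) 0 := by
  intro s h
  simp only [Option.some.injEq] at h
  subst h
  exact ⟨0, by simp, by simp [Res.zero], by simp [Res.zero]⟩
lemma Good_add (v : ℤ) {o1 o2 : Option Res} {c1 c2 : ℤ} (h1 : Good v o1 c1) (h2 : Good v o2 c2) :
    Good v (radd o1 o2) (c1 + c2) := by
  intro s h
  rcases o1 with _ | ⟨a1, b1⟩
  · simp [radd] at h
  rcases o2 with _ | ⟨a2, b2⟩
  · simp [radd] at h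
  obtain ⟨P, p1, p2, p3⟩ := h1 _ rfl
  obtain ⟨Q, q1, q2, q3⟩ := h2 _ rfl
  simp only [radd, Option.some.injEq] at h
  subst h
  refine ⟨P + Q, by simp [p1, q1], ?_, fun k => ?_⟩
  · rw [eval_add, p2, q2]; rfl
  · rw [coeff_add]
    refine (abs_add_le _ _).trans ?_
    have := add_le_add (p3 k) (q3 k)
    simpa using this
lemma Good_sub (v : ℤ) {o1 o2 : Option Res} {c1 c2 : ℤ} (h1 : Good v o1 c1) (h2 : Good v o2 c2) :
    Good v (rsub o1 o2) (c1 - c2) := by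
  intro s h
  rcases o1 with _ | ⟨a1, b1⟩
  · simp [rsub] at h
  rcases o2 with _ | ⟨a2, b2⟩
  · simp [rsub] at h
  obtain ⟨P, p1, p2, p3⟩ := h1 _ rfl
  obtain ⟨Q, q1, q2, q3⟩ := h2 _ rfl
  simp only [rsub, Option.some.injEq] at h
  subst h
  refine ⟨P - Q, by simp [p1, q1], ?_, fun k => ?_⟩
  · rw [eval_sub, p2, q2]; rfl
  · rw [coeff_sub]
    refine (abs_sub _ _).trans ?_
    have := add_le_add (p3 k) (q3 k)
    simpa using this
lemma coeff_bd (k : ℕ) : ∀ (P : ℤ[X]) (b : ℕ), (∀ i, |P.coeff i| ≤ b) → ∀ i, |(P * (X + 1) ^ k).coeff i| ≤ ((b * 2 ^ k : ℕ) : ℤ) := by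
  induction k with
  | zero => intro P b h i; simpa using h i
  | succ k ih =>
    intro P b h i
    rw [pow_succ', ← mul_assoc, pow_succ', ← mul_assoc]
    apply ih
    intro i
    rw [mul_add, mul_one, coeff_add]
    refine (abs_add_le _ _).trans ?_
    have h1 : |(P * X).coeff i| ≤ (b : ℤ) := by
      cases i with
      | zero => simp
      | succ i => rw [coeff_mul_X]; exact h i
    have := add_le_add h1 (h i)
    push_cast; linarith
lemma coeff_bdX (l : ℕ) (P : ℤ[X]) (b : ℕ) (h : ∀ i, |P.coeff i| ≤ b) (i : ℕ) :
    |(P * X ^ l).coeff i| ≤ (b : ℤ) := by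
  rw [coeff_mul_X_pow']
  split_ifs
  · exact h _
  · simp
lemma Good_leaf (v : ℤ) (nf nu : ℕ) : Good v (some (leaf nf nu)) ((v + 1) ^ nf * v ^ nu) := by
  intro s h
  simp only [Option.some.injEq] at h
  subst h
  refine ⟨1 * (X + 1) ^ nf * X ^ nu, by simp, ?_, ?_⟩
  · simp only [eval_mul, eval_one, eval_pow, eval_add, eval_X, one_mul]
    change _ = ((340282366920938463463374607431768211457 ^ nf * 340282366920938463463374607431768211456 ^ nu : ℕ) : ℤ)
    push_cast [BB]; norm_num
  · apply coeff_bdX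
    have := coeff_bd nf 1 1 (by intro i; rw [coeff_one]; split_ifs <;> simp)
    rw [one_mul (2 ^ nf)] at this; exact this
lemma Good_mul (v : ℤ) {o : Option Res} {c : ℤ} (h : Good v o c) (k l : ℕ) :
    Good v (rmul (Nat.mul (Nat.pow ((nat_lit 340282366920938463463374607431768211457)) k) (Nat.pow (nat_lit 340282366920938463463374607431768211456) l)) (Nat.pow (nat_lit 2) k) o)
     ((v + 1) ^ k * v ^ l * c) := by
  intro s hs
  rcases o with _ | ⟨a1, b1⟩
  · simp [rmul] at hs
  obtain ⟨P, p1, p2, p3⟩ := h _ rfl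
  simp only [rmul, Option.some.injEq] at hs
  subst hs
  refine ⟨P * (X + 1) ^ k * X ^ l, ?_, ?_, ?_⟩
  · simp [p1]; ring
  · simp only [eval_mul, eval_one, eval_pow, eval_add, eval_X, p2]
    change _ = a1 * ((340282366920938463463374607431768211457 ^ k * 340282366920938463463374607431768211456 ^ l : ℕ) : ℤ)
    push_cast [BB]; ring
  · apply coeff_bdX
    exact coeff_bd k P b1 p3
/-- relation between encoded and real states -/
structure St (A B : Finset ℕ) (Fr Un nf nu : ℕ) : Prop where
  dis : ∀ p ∈ A, p ∉ B
  pA : ∀ p ∈ A, p.Prime ∧ p ≠ 2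
  pB : ∀ p ∈ B, p.Prime ∧ p ≠ 2
  fr : Fr = ∏ p ∈ A, p
  un : Un = ∏ p ∈ B, p
  cf : #A = nf
  cu : #B = nu
section
variable {A B : Finset ℕ} {Fr Un nf nu : ℕ}
lemma prod_mem {A : Finset ℕ} (hA : ∀ p ∈ A, p.Prime ∧ p ≠ 2) {x : ℕ} (hx : x.Prime) : x ∣ ∏ p ∈ A, p ↔ x ∈ A := by
  rw [hx.prime.dvd_finsetProd_iff]
  constructor
  · rintro ⟨p, hp, h⟩
    rw [Nat.prime_dvd_prime_iff_eq hx (hA p hp).1] at h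
    rwa [h]
  · intro h; exact ⟨x, h, dvd_rfl⟩
lemma prod_ne {A : Finset ℕ} (hA : ∀ p ∈ A, p.Prime ∧ p ≠ 2) : ∏ p ∈ A, p ≠ 0 :=
  Finset.prod_ne_zero_iff.2 fun p hp => (hA p hp).1.ne_zero
/-- split off an element of A -/
lemma St.splitA (h : St A B Fr Un nf nu) {x : ℕ} (hx : x.Prime) (hd : x ∣ Fr) :
    ∃ A', x ∉ A' ∧ x ∉ B ∧ A = insert x A' ∧ St A' B (Fr / x) Un (nf - 1) nu ∧
      St A' (insert x B) (Fr / x) (Un * x) (nf - 1) (nu + 1) := by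
  have hxA : x ∈ A := by rwa [h.fr, prod_mem h.pA hx] at hd
  have hxB := h.dis x hxA
  have h1 : x ∉ A.erase x := notMem_erase x A
  have h2 : Fr / x = ∏ p ∈ A.erase x, p := by
    rw [h.fr, ← mul_prod_erase A _ hxA, Nat.mul_div_cancel_left _ hx.pos]
  have h3 : #(A.erase x) = nf - 1 := by rw [card_erase_of_mem hxA, h.cf]
  refine ⟨A.erase x, h1, hxB, (insert_erase hxA).symm, ⟨?_, ?_, h.pB, h2, h.un, h3, h.cu⟩, ⟨?_, ?_, ?_, h2, ?_, h3, ?_⟩⟩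
  · exact fun p hp => h.dis p (mem_of_mem_erase hp)
  · exact fun p hp => h.pA p (mem_of_mem_erase hp)
  · intro p hp
    rw [mem_insert, not_or]
    exact ⟨ne_of_mem_erase hp, h.dis p (mem_of_mem_erase hp)⟩
  · exact fun p hp => h.pA p (mem_of_mem_erase hp)
  · intro p hp
    rcases mem_insert.1 hp with rfl | hp
    · exact h.pA p hxA
    · exact h.pB p hp
  · rw [prod_insert hxB, h.un, mul_comm]
  · rw [card_insert_of_notMem hxB, h.cu]
/-- move an element of B to A -/
lemma St.move (h : St A B Fr Un nf nu) {x : ℕ} (hx : x.Prime) (hd : x ∣ Un) :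
    ∃ B', x ∉ A ∧ x ∉ B' ∧ B = insert x B' ∧ St (insert x A) B' (Fr * x) (Un / x) (nf + 1) (nu - 1) := by
  have hxB : x ∈ B := by rwa [h.un, prod_mem h.pB hx] at hd
  have hxA : x ∉ A := fun h' => h.dis x h' hxB
  have h1 : x ∉ B.erase x := notMem_erase x B
  refine ⟨B.erase x, hxA, h1, (insert_erase hxB).symm, ⟨?_, ?_, ?_, ?_, ?_, ?_, ?_⟩⟩
  · intro p hp
    rcases mem_insert.1 hp with rfl | hp
    · exact h1
    · exact fun h' => h.dis p hp (mem_of_mem_erase h')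
  · intro p hp
    rcases mem_insert.1 hp with rfl | hp
    · exact h.pB p hxB
    · exact h.pA p hp
  · exact fun p hp => h.pB p (mem_of_mem_erase hp)
  · rw [prod_insert hxA, h.fr, mul_comm]
  · rw [h.un, ← mul_prod_erase B _ hxB, Nat.mul_div_cancel_left _ hx.pos]
  · rw [card_insert_of_notMem hxA, h.cf]
  · rw [card_erase_of_mem hxB, h.cu]
variable {F : Type*} [Field F]
lemma St.unit (h : St A B Fr Un nf nu) {a : ℕ → F} {A' : Finset ℕ} (ha : Sup A' B a) {g : ℕ} (hg : g ∣ 2 * Un ^ 4) : ev a g ≠ 0 := by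
  have hU : Un ≠ 0 := h.un ▸ prod_ne h.pB
  have hg0 : g ≠ 0 := by
    rintro rfl
    rw [zero_dvd_iff] at hg
    simp [hU] at hg
  rw [Ne, ev_eq_zero a hg0]
  rintro ⟨p, hp, hpg, h0⟩
  rcases hp.dvd_mul.1 (hpg.trans hg) with h1 | h1
  · rw [Nat.prime_dvd_prime_iff_eq hp Nat.prime_two] at h1
    simp [pv, h1] at h0
  · have h2 := hp.dvd_of_dvd_pow h1
    rw [h.un, prod_mem h.pB hp] at h2
    have := ha.1 p h2
    simp [pv, (h.pB p h2).2, this] at h0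
end
section
variable {F : Type*} [Field F] [Fintype F]
/-- soundness of a solver -/
def Sound (F : Type*) [Field F] [Fintype F] (f : RT) : Prop :=
  ∀ (A B : Finset ℕ) E Fr Un nf nu, St A B Fr Un nf nu →
    Good ((Fintype.card F : ℤ) - 1) (f E Fr Un nf nu) (Nc A B (fun a : ℕ → F => sat a E))
variable {A B : Finset ℕ} {Fr Un nf nu : ℕ} {ih : RT}
lemma chkU_good (v : ℤ) (U x : ℕ) (k : Option Res) (c : ℤ)
    (h : isVar x = true → x.Prime → x ≠ 2 → x ∣ U → Good v k c) : Good v (chkU U x k) c := by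
  unfold chkU
  rw [cdvd]
  cases h1 : isVar x with
  | false => exact Good_none _ _
  | true =>
    rw [cond_true]
    split_ifs with h2
    · exact h h1 (isVar_prime x h1).1 (isVar_prime x h1).2 h2
    · exact Good_none _ _
lemma leaf_sound (h : St A B Fr Un nf nu) :
    Good ((Fintype.card F : ℤ) - 1) (some (leaf nf nu)) (Nc A B (fun a : ℕ → F => sat a [])) := by
  have key : ∀ (B A : Finset ℕ), (∀ p ∈ A, p ∉ B) → Nc A B (fun a : ℕ → F => sat a []) = Fintype.card F ^ #A * (Fintype.card F - 1) ^ #B := by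
    intro B
    induction B using Finset.induction_on with
    | empty =>
      intro A
      induction A using Finset.induction_on with
      | empty =>
        intro _
        classical
        have : (sup ∅ ∅ : Finset (ℕ → F)) = {0} := by
          ext a
          rw [mem_sup, mem_singleton]
          constructor
          · intro h; funext p; exact h.2 p (by simp) (by simp)
          · rintro rfl; exact ⟨by simp, by simp⟩
        simp [Nc, this]
      | insert x A hx ih2 =>
        intro _
        rw [Nc_freeA A ∅ x hx (by simp) _ (by simp), ih2 (by simp), card_insert_of_notMem hx]; ring
    | insert x B hx ih2 =>
      intro A hA
      have hxA : x ∉ A := fun h => hA x h (by simp)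
      rw [Nc_freeB A B x hxA hx _ (by simp), ih2 A (fun p hp h => hA p hp (by simp [h])), card_insert_of_notMem hx]; ring
  rw [key B A h.dis, h.cf, h.cu]
  have := Good_leaf ((Fintype.card F : ℤ) - 1) nf nu
  push_cast [Nat.cast_sub (Fintype.card_pos (α := F))]
  simpa using this
lemma sat_var (a : ℕ → F) {x : ℕ} (hx : x.Prime) (h2 : x ≠ 2) (E : List (List ℕ)) : sat a ([x] :: E) ↔ a x = 0 ∧ sat a E := by
  simp [ev_odd a hx h2]
lemma doBr_sound (hi : Sound F ih) (h : St A B Fr Un nf nu) (E x) :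
    Good ((Fintype.card F : ℤ) - 1) (doBr ih E Fr Un nf nu x) (Nc A B (fun a : ℕ → F => sat a E)) := by
  unfold doBr
  apply chkU_good
  intro _ hx hx2 hd
  obtain ⟨A', h1, h2, rfl, h4, h5⟩ := h.splitA hx hd
  rw [Nc_branch A' B x h1 h2]
  push_cast
  refine Good_add _ ?_ (hi _ _ E _ _ _ _ h5)
  have := hi _ _ ([x] :: E) _ _ _ _ h
  simp only [sat_var _ hx hx2] at this; exact this
lemma do5_sound (hi : Sound F ih) (h : St A B Fr Un nf nu) (E) {x : ℕ} (hx : x.Prime) (hx2 : x ≠ 2) (hd : x ∣ Un) :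
    Good ((Fintype.card F : ℤ) - 1) (do5 ih E Fr Un nf nu x) (Nc A B (fun a : ℕ → F => sat a E)) := by
  obtain ⟨B', h1, h2, rfl, h4⟩ := h.move hx hd
  have := Nc_branch A B' x h1 h2 (fun a : ℕ → F => sat a E)
  have h5 : (Nc A (insert x B') (fun a : ℕ → F => sat a E) : ℤ) = Nc (insert x A) B' (fun a : ℕ → F => sat a E) -
      Nc (insert x A) B' (fun a : ℕ → F => a x = 0 ∧ sat a E) := by rw [this]; push_cast; ring
  rw [h5]
  refine Good_sub _ (hi _ _ E _ _ _ _ h4) ?_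
  have := hi _ _ ([x] :: E) _ _ _ _ h4
  simp only [sat_var _ hx hx2] at this; exact this
lemma do7_sound (hi : Sound F ih) (h : St A B Fr Un nf nu) (E o) (p : List ℕ) {x : ℕ} (hx : x.Prime) (hx2 : x ≠ 2) (hd : x ∣ Un)
    (hE : ∀ a : ℕ → F, sat a E ↔ pe a p = 0 ∧ sat a o) (ho : ∀ e ∈ o, ∀ m ∈ e, ¬ x ∣ m) (hp : ∀ m ∈ split1 x p, ¬ x ∣ m) :
    Good ((Fintype.card F : ℤ) - 1) (do7 ih o Fr Un nf nu x p) (Nc A B (fun a : ℕ → F => sat a E)) := by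
  obtain ⟨B', h1, h2, rfl, h4⟩ := h.move hx hd
  have h5 : ∀ a : ℕ → F, sat a E ↔ a x * pe a (split1 x p) + pe a (split0 x p) = 0 ∧ sat a o := by
    intro a
    rw [hE, pe_split a x p, ev_odd a hx hx2]
  rw [Nc_congr (fun a _ => h5 a), Nc_do7 A B' x h1 h2 _ _ _ (fun a t => sat_upd a t ho) (fun a t => pe_upd a t hp)
    (fun a t => pe_upd a t (split0_free x p))]
  refine Good_add _ (Good_sub _ (Good_sub _ ?_ ?_) ?_) ?_
  · have := hi _ _ ([x] :: o) _ _ _ _ h4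
    simp only [sat_var _ hx hx2] at this; exact this
  · have := hi _ _ ([x] :: split1 x p :: o) _ _ _ _ h4
    simp only [sat_var _ hx hx2, sat_cons _ (split1 x p)] at this; exact this
  · have := hi _ _ ([x] :: split0 x p :: o) _ _ _ _ h4
    simp only [sat_var _ hx hx2, sat_cons _ (split0 x p)] at this; exact this
  · have := hi _ _ (split1 x p :: split0 x p :: o) _ _ _ _ h4
    simp only [sat_cons] at this; exact this
lemma doUnits_sound (hi : Sound F ih) (h : St A B Fr Un nf nu) (E) :
    Good ((Fintype.card F : ℤ) - 1) (doUnits ih Fr Un nf nu E) (Nc A B (fun a : ℕ → F => sat a E)) := by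
  unfold doUnits
  cases h5 : cand5 E with
  | succ x =>
    apply chkU_good
    intro _ hx hx2 hd
    exact do5_sound hi h E hx hx2 hd
  | zero =>
    cases h7 : cand7 E with
    | zero => exact Good_none _ _
    | succ x =>
      apply chkU_good
      intro _ hx hx2 hd
      have h8 := cand7_aux E vars (x + 1) (by simp) h7
      exact do7_sound hi h E _ _ hx hx2 hd (fun a => (sat_parts a _ E h8.1).2) (others_free _ E)
        (lin_spec _ E h8.2 _ (sat_parts (0 : ℕ → F) _ E h8.1).1)
lemma doNone_sound (hi : Sound F ih) (h : St A B Fr Un nf nu) (E P G) :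
    Good ((Fintype.card F : ℤ) - 1) (doNone ih E Fr Un nf nu P G) (Nc A B (fun a : ℕ → F => sat a E)) := by
  unfold doNone
  rw [cbeq, seqLL_eq, force_eq, force_eq]
  split_ifs
  · rw [← Nc_congr (fun a _ => sat_dedupe a E)]
    exact doUnits_sound hi h _
  · exact doBr_sound hi h _ _
lemma doSolve_sound (hi : Sound F ih) (h : St A B Fr Un nf nu) (E m p) (hf : find Fr E = Act.solve m p) :
    Good ((Fintype.card F : ℤ) - 1) (doSolve ih E Fr Un nf nu m p (Nat.gcd m Fr)) (Nc A B (fun a : ℕ → F => sat a E)) := by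
  obtain ⟨hp, hm, hc⟩ := (find_spec Fr E).2 m p hf
  obtain ⟨hmp, hv, hxu, hcnt⟩ := cand_aux Fr p p m hm hc
  have hxm : Nat.gcd m Fr ∣ m := Nat.gcd_dvd_left _ _
  have hxF : Nat.gcd m Fr ∣ Fr := Nat.gcd_dvd_right _ _
  generalize hx0 : Nat.gcd m Fr = x at *
  obtain ⟨hx, hx2⟩ := isVar_prime x hv
  obtain ⟨A', h1, h2, rfl, h4, -⟩ := h.splitA hx hxF
  unfold doSolve
  rw [force_eq, cdvd, seqL_eq, seqLL_eq]
  split_ifs with hu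
  swap
  · exact Good_none _ _
  unfold doSolve2
  cases hno : noOcc x (subst x (Nat.div m x) (split0 x p) p E) with
  | false => exact Good_none _ _
  | true =>
    rw [noOcc_iff] at hno
    simp only [cond_true]
    have hm' : m = x * (m / x) := (Nat.mul_div_cancel' hxm).symm
    have hpe : ∀ a : ℕ → F, pe a p = ev a x * ev a (m / x) + pe a (split0 x p) := by
      intro a
      rw [pe_cnt1 a x m p hcnt hmp hxm, ← ev_mul, ← hm']
    have key : ∀ a : ℕ → F, Sup (insert x A') B a → (sat a E ↔ (a x * ev a (m / x) + pe a (split0 x p) = 0 ∧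
        sat a (subst x (m / x) (split0 x p) p E))) := by
      intro a ha
      have hu' : ev a (m / x) ≠ 0 := h.unit ha hu
      have h5 := hpe a
      rw [← ev_odd a hx hx2, ← h5]
      constructor
      · intro h6
        refine ⟨h6 p hp, ?_⟩
        rw [sat_subst a x (m / x) _ p E (by rw [← h5]; exact h6 p hp) (h6 p hp) hu']
        exact h6
      · rintro ⟨h6, h7⟩
        rw [sat_subst a x (m / x) _ p E (by rw [← h5]; exact h6) h6 hu'] at h7
        exact h7
    rw [Nc_congr key, Nc_solve A' B x h1 h2 (fun a => ev a (m / x)) _ _ (fun a t => sat_upd a t hno) (fun a t => ev_upd a t hxu)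
      (fun a t => pe_upd a t (split0_free x p)) (fun a ha => h.unit ha hu)]
    exact hi _ _ _ _ _ _ _ h4
lemma doNode_sound (hi : Sound F ih) (h : St A B Fr Un nf nu) (E) :
    Good ((Fintype.card F : ℤ) - 1) (doNode ih Fr Un nf nu E) (Nc A B (fun a : ℕ → F => sat a E)) := by
  cases E with
  | nil => exact leaf_sound h
  | cons e E =>
    change Good _ (doAct ih (e :: E) Fr Un nf nu (find Fr (e :: E))) _
    cases hf : find Fr (e :: E) with
    | none =>
      change Good _ (force (prodAll (e :: E)) fun P => force (Nat.gcd Fr P) (doNone ih (e :: E) Fr Un nf nu P)) _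
      rw [force_eq, force_eq]
      exact doNone_sound hi h _ _ _
    | contra =>
      have h1 := (find_spec Fr (e :: E)).1 hf
      have h2 : Nc A B (fun a : ℕ → F => sat a (e :: E)) = 0 := by
        classical
        unfold Nc
        rw [card_eq_zero, filter_eq_empty_iff]
        intro a _ h3
        have := h3 _ h1
        simp at this
      rw [h2]
      exact Good_zero _
    | solve m p =>
      change Good _ (force (Nat.gcd m Fr) (doSolve ih (e :: E) Fr Un nf nu m p)) _
      rw [force_eq]
      exact doSolve_sound hi h _ _ _ hf
theorem run_sound (h2 : (2 : F) ≠ 0) (fuel : ℕ) : Sound F (run fuel) := by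
  induction fuel with
  | zero => intro A B E Fr Un nf nu _; exact Good_none _ _
  | succ n ih =>
    intro A B E Fr Un nf nu h
    change Good _ (step (run n) E Fr Un nf nu) _
    unfold step doF
    simp only [force_eq, seqLL_eq]
    have hF : Fr ≠ 0 := h.fr ▸ prod_ne h.pA
    rw [← Nc_congr (fun a ha => sat_norm a Fr (Nat.pow Un 4) E h2 hF (fun g hg => h.unit ha (hg.trans (Dvd.intro_left 2 rfl))))]
    exact doNode_sound ih h _
end
end SpC

namespace SpC
set_option linter.unusedSectionVars false
open Finset Polynomial
lemma prodL_dvd (e : List ℕ) (P : ℕ) : P ∣ lrec P (fun m _ ih2 => Nat.mul m ih2) e ∧ ∀ m ∈ e, m ∣ lrec P (fun m _ ih2 => Nat.mul m ih2) e := by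
  induction e with
  | nil => simp
  | cons n e ih =>
    rw [lrec_cons]
    change P ∣ n * _ ∧ ∀ m ∈ n :: e, m ∣ n * _
    refine ⟨Dvd.dvd.mul_left ih.1 _, ?_⟩
    intro m hm
    rcases List.mem_cons.1 hm with rfl | hm
    · exact Nat.dvd_mul_right _ _
    · exact Dvd.dvd.mul_left (ih.2 m hm) _
lemma prodAll_dvd (E : List (List ℕ)) : ∀ e ∈ E, ∀ m ∈ e, m ∣ prodAll E := by
  induction E with
  | nil => simp
  | cons e E ih =>
    have h1 : prodAll (e :: E) = lrec (prodAll E) (fun m _ ih2 => Nat.mul m ih2) e := rfl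
    have h2 := prodL_dvd e (prodAll E)
    rw [h1]
    intro e' he m hm
    rcases List.mem_cons.1 he with rfl | he
    · exact h2.2 m hm
    · exact (ih e' he m hm).trans h2.1
lemma cntD_eq (A : Finset ℕ) (hA : ∀ p ∈ A, p ∈ vars) : cntD (∏ p ∈ A, p) = #A := by
  have h1 : ∀ (G : ℕ) (l : List ℕ), lrec (nat_lit 0) (fun p _ ih => bif dvd p G then Nat.succ ih else ih) l = (l.filter (fun p => p ∣ G)).length := by
    intro G l
    induction l with
    | nil => rfl
    | cons n l ih =>
      rw [lrec_cons, ih, cdvd, List.filter_cons]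
      split_ifs with h <;> simp_all
  have hn : vars.Nodup := by decide +kernel
  have h2 : A = (vars.filter (fun p => p ∣ ∏ p ∈ A, p)).toFinset := by
    ext x
    simp only [List.mem_toFinset, List.mem_filter, decide_eq_true_eq]
    constructor
    · intro h
      exact ⟨hA x h, (prod_mem (fun p hp => vars_prime p (hA p hp)) (vars_prime x (hA x h)).1).2 h⟩
    · rintro ⟨h, h'⟩
      exact (prod_mem (fun p hp => vars_prime p (hA p hp)) (vars_prime x h).1).1 h'
  unfold cntD
  rw [h1]
  conv_rhs => rw [h2]
  rw [List.toFinset_card_of_nodup (hn.filter _)]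
lemma gcd_prod (A : Finset ℕ) (P : ℕ) (hA : ∀ p ∈ A, p.Prime ∧ p ≠ 2) :
    Nat.gcd (∏ p ∈ A, p) P = ∏ p ∈ A with p ∣ P, p := by
  induction A using Finset.induction_on with
  | empty => simp
  | insert x A hx ih =>
    have hA' : ∀ p ∈ A, p.Prime ∧ p ≠ 2 := fun p hp => hA p (by simp [hp])
    have hxp := (hA x (by simp)).1
    rw [prod_insert hx, Nat.gcd_comm, Nat.Coprime.gcd_mul, Nat.gcd_comm P (∏ p ∈ A, p), ih hA', filter_insert]
    · split_ifs with h
      · rw [prod_insert (by simp [hx]), Nat.gcd_eq_right h]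
      · rw [Nat.Coprime.gcd_eq_one ((Nat.Prime.coprime_iff_not_dvd hxp).2 h).symm, one_mul]
    · rw [Nat.Prime.coprime_iff_not_dvd hxp, prod_mem hA' hxp]; exact hx
section
variable {F : Type*} [Field F] [Fintype F]
lemma Nc_dropA (A B C : Finset ℕ) (Q : (ℕ → F) → Prop) (hC : ∀ x ∈ C, x ∉ A ∧ x ∉ B ∧ ∀ a t, Q (Function.update a x t) ↔ Q a) :
    Nc (C ∪ A) B Q = Fintype.card F ^ #C * Nc A B Q := by
  induction C using Finset.induction_on with
  | empty => simp
  | insert x C hx ih =>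
    have h := hC x (by simp)
    rw [insert_union, Nc_freeA _ _ x (by simp [hx, h.1]) h.2.1 Q h.2.2, ih (fun y hy => hC y (by simp [hy])),
      card_insert_of_notMem hx]; ring
lemma Nc_dropB (A B C : Finset ℕ) (Q : (ℕ → F) → Prop) (hC : ∀ x ∈ C, x ∉ A ∧ x ∉ B ∧ ∀ a t, Q (Function.update a x t) ↔ Q a) :
    Nc A (C ∪ B) Q = (Fintype.card F - 1) ^ #C * Nc A B Q := by
  induction C using Finset.induction_on with
  | empty => simp
  | insert x C hx ih =>
    have h := hC x (by simp)
    rw [insert_union, Nc_freeB _ _ x h.1 (by simp [hx, h.2.1]) Q h.2.2, ih (fun y hy => hC y (by simp [hy])),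
      card_insert_of_notMem hx]; ring
theorem runU_sound (h2 : (2 : F) ≠ 0) {A B : Finset ℕ} {Fr Un nf nu : ℕ} (h : St A B Fr Un nf nu)
    (hA : ∀ p ∈ A, p ∈ vars) (hB : ∀ p ∈ B, p ∈ vars) (E : List (List ℕ)) (e : ℕ) :
    Good ((Fintype.card F : ℤ) - 1) (runU E (prodAll E) Fr Un nf nu e)
      ((Fintype.card F : ℤ) ^ e * Nc A B (fun a : ℕ → F => sat a E)) := by
  unfold runU
  simp only [force_eq]
  set P := prodAll E with hP
  have hfree : ∀ x, ¬ x ∣ P → ∀ (a : ℕ → F) t, sat (Function.update a x t) E ↔ sat a E := by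
    intro x hx a t
    apply sat_upd
    intro e he m hm hd
    exact hx (hd.trans (prodAll_dvd E e he m hm))
  have eA : Nat.gcd Fr P = ∏ p ∈ A with p ∣ P, p := by rw [h.fr, gcd_prod A P h.pA]
  have eB : Nat.gcd Un P = ∏ p ∈ B with p ∣ P, p := by rw [h.un, gcd_prod B P h.pB]
  have hA' : ∀ p ∈ A.filter (· ∣ P), p ∈ vars := fun p hp => hA p (mem_filter.1 hp).1
  have hB' : ∀ p ∈ B.filter (· ∣ P), p ∈ vars := fun p hp => hB p (mem_filter.1 hp).1
  rw [eA, eB, cntD_eq _ hA', cntD_eq _ hB']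
  have hst : St (A.filter (· ∣ P)) (B.filter (· ∣ P)) (∏ p ∈ A with p ∣ P, p) (∏ p ∈ B with p ∣ P, p) (#(A.filter (· ∣ P))) (#(B.filter (· ∣ P))) :=
    ⟨fun p hp hp' => h.dis p (mem_filter.1 hp).1 (mem_filter.1 hp').1, fun p hp => vars_prime p (hA' p hp),
      fun p hp => vars_prime p (hB' p hp), rfl, rfl, rfl, rfl⟩
  have hr := run_sound h2 200 _ _ E _ _ _ _ hst
  have hg := Good_mul _ hr (e + (nf - #(A.filter (· ∣ P)))) (nu - #(B.filter (· ∣ P)))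
  have e1 : Nc A B (fun a : ℕ → F => sat a E) = Fintype.card F ^ (nf - #(A.filter (· ∣ P))) * ((Fintype.card F - 1) ^ (nu - #(B.filter (· ∣ P))) *
      Nc (A.filter (· ∣ P)) (B.filter (· ∣ P)) (fun a : ℕ → F => sat a E)) := by
    have a1 : A.filter (fun p => ¬ p ∣ P) ∪ A.filter (· ∣ P) = A := by
      rw [union_comm]; exact filter_union_filter_not_eq _ _
    have b1 : B.filter (fun p => ¬ p ∣ P) ∪ B.filter (· ∣ P) = B := by
      rw [union_comm]; exact filter_union_filter_not_eq _ _
    have a2 : #(A.filter (fun p => ¬ p ∣ P)) = nf - #(A.filter (· ∣ P)) := by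
      have := card_filter_add_card_filter_not (s := A) (· ∣ P)
      rw [h.cf] at this; omega
    have b2 : #(B.filter (fun p => ¬ p ∣ P)) = nu - #(B.filter (· ∣ P)) := by
      have := card_filter_add_card_filter_not (s := B) (· ∣ P)
      rw [h.cu] at this; omega
    have := Nc_dropA (A.filter (· ∣ P)) B (A.filter (fun p => ¬ p ∣ P)) (fun a : ℕ → F => sat a E) (by
      intro x hx
      rw [mem_filter] at hx
      exact ⟨by simp [hx.2], h.dis x hx.1, hfree x hx.2⟩)
    rw [a1, a2] at this
    rw [this]
    congr 1
    have := Nc_dropB (A.filter (· ∣ P)) (B.filter (· ∣ P)) (B.filter (fun p => ¬ p ∣ P)) (fun a : ℕ → F => sat a E) (by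
      intro x hx
      rw [mem_filter] at hx
      exact ⟨by simp [hx.2], by simp [hx.2], hfree x hx.2⟩)
    rw [b1, b2] at this
    exact this
  have e2 : ((Fintype.card F : ℤ) ^ e * Nc A B (fun a : ℕ → F => sat a E)) =
     ((Fintype.card F : ℤ) - 1 + 1) ^ (e + (nf - #(A.filter (· ∣ P)))) * ((Fintype.card F : ℤ) - 1) ^ (nu - #(B.filter (· ∣ P))) *
      Nc (A.filter (· ∣ P)) (B.filter (· ∣ P)) (fun a : ℕ → F => sat a E) := by
    rw [e1]
    push_cast [Nat.cast_sub (Fintype.card_pos (α := F))]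
    ring
  rw [e2]
  exact hg
/-- from a checked evaluation to the polynomial identity -/
lemma poly_unique (D : ℤ[X]) (N : ℤ) (hN : 0 < N) (h0 : D.eval N = 0) (hb : ∀ k, |D.coeff k| < N) : D = 0 := by
  by_contra hD
  have h1 := mul_divByMonic_eq_iff_isRoot.2 (show IsRoot D N from h0)
  set Q := D /ₘ (X - C N) with hQ
  have hQ0 : Q ≠ 0 := by
    intro h; rw [h] at h1; simp at h1; exact hD h1.symm
  set n := Q.natTrailingDegree with hn
  have hc : D.coeff n = - N * Q.coeff n := by
    rw [← h1, sub_mul, coeff_sub, coeff_C_mul]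
    have : (X * Q).coeff n = 0 := by
      cases h : n with
      | zero => simp
      | succ k =>
        rw [coeff_X_mul]
        apply coeff_eq_zero_of_lt_natTrailingDegree
        omega
    rw [this]; ring
  have hq : Q.coeff n ≠ 0 := by
    have := trailingCoeff_nonzero_iff_nonzero.2 hQ0
    exact this
  have := hb n
  rw [hc, abs_mul, abs_neg, abs_of_pos hN] at this
  have h3 : 1 ≤ |Q.coeff n| := Int.one_le_abs hq
  nlinarith
end
end SpC

namespace SpC
set_option linter.unusedSectionVars false
open Finset Matrix
section
variable {F : Type*} [Field F] [Fintype F]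
abbrev Mat (F : Type*) := Matrix (Fin 7) (Fin 7) F
/-- strictly upper triangular -/
def SU (X : Mat F) : Prop := ∀ i j, j ≤ i → X i j = 0
/-- stabiliser algebra -/
def StabA (S X : Mat F) : Prop := SU X ∧ Xᵀ * S + S * X = 0
/-- number of commuting pairs in the stabiliser -/
noncomputable def phi (S : Mat F) : ℕ := Nat.card {z : Mat F × Mat F // StabA S z.1 ∧ StabA S z.2 ∧ z.1 * z.2 = z.2 * z.1}

/-- kernel of a square matrix and of its transpose have the same size -/
lemma card_ker_transpose {ι : Type*} [Fintype ι] [DecidableEq ι] (K : Matrix ι ι F) :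
    Nat.card {y : ι → F // K *ᵥ y = 0} = Nat.card {f : ι → F // f ᵥ* K = 0} := by
  have key : ∀ K : Matrix ι ι F, Nat.card {y : ι → F // K *ᵥ y = 0} = Nat.card F ^ (Fintype.card ι - K.rank) := by
    intro K
    have h1 : Nat.card {y : ι → F // K *ᵥ y = 0} = Nat.card (LinearMap.ker K.mulVecLin) := by
      apply Nat.card_congr
      exact Equiv.subtypeEquivRight (fun y => by simp)
    have h2 := LinearMap.finrank_range_add_finrank_ker K.mulVecLin
    rw [h1, Module.natCard_eq_pow_finrank (K := F)]
    congr 1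
    rw [Module.finrank_fintype_fun_eq_card] at h2
    rw [Matrix.rank]; omega
  rw [key K, ← Matrix.rank_transpose K, ← key Kᵀ]
  apply Nat.card_congr
  exact Equiv.subtypeEquivRight (fun y => by rw [mulVec_transpose])
lemma card_dual {ι : Type*} [Fintype ι] [DecidableEq ι] (T : (ι → F) → Matrix ι ι F) :
    Nat.card {z : (ι → F) × (ι → F) // T z.1 *ᵥ z.2 = 0} = Nat.card {z : (ι → F) × (ι → F) // z.2 ᵥ* T z.1 = 0} := by
  have e1 : ∀ P : (ι → F) → (ι → F) → Prop, Nat.card {z : (ι → F) × (ι → F) // P z.1 z.2} = ∑ y, Nat.card {f // P y f} := by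
    intro P
    rw [← Nat.card_sigma]
    apply Nat.card_congr
    exact ⟨fun z => ⟨z.1.1, z.1.2, z.2⟩, fun z => ⟨⟨z.1, z.2.1⟩, z.2.2⟩, fun z => rfl, fun z => rfl⟩
  rw [e1 (fun y f => T y *ᵥ f = 0), e1 (fun y f => f ᵥ* T y = 0)]
  exact Finset.sum_congr rfl fun y _ => card_ker_transpose (T y)

/-- combinatorial data of a partial involution -/
structure PI where
  D : Fin 7 → Prop
  w : Fin 7 → Fin 7
  ww : ∀ i, w (w i) = i
  hD : ∀ i, D i → D (w i)
  c : Fin 7 → Fin 7 → ℕ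
  hc : ∀ i j k l, c i j = c k l → i = k ∧ j = l
namespace PI
variable (π : PI)
/-- the scaled stabiliser -/
structure LL (Z : Mat F) : Prop where
  su : SU Z
  z : ∀ i j, π.D i → ¬ π.D j → Z i j = 0
  n : ∀ i j, π.D i → π.D j → Z (π.w j) (π.w i) = - Z i j
/-- representatives -/
def Rp (r : Fin 7 × Fin 7) : Prop := r.1 < r.2 ∧ (π.D r.1 → π.D r.2 ∧ π.w r.2 < π.w r.1 ∧ π.c r.1 r.2 < π.c (π.w r.2) (π.w r.1))
open Classical in
/-- the general element -/
noncomputable def zz (y : Fin 7 → Fin 7 → F) : Mat F := fun i j =>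
  if i < j then
    if π.D i then
      if π.D j then
        if π.w j < π.w i then
          if π.c i j < π.c (π.w j) (π.w i) then y i j else
          if π.c i j = π.c (π.w j) (π.w i) then 0 else - y (π.w j) (π.w i)
        else 0
      else 0
    else y i j
  else 0
lemma zz_rp (y : Fin 7 → Fin 7 → F) (r : Fin 7 × Fin 7) (h : π.Rp r) : π.zz y r.1 r.2 = y r.1 r.2 := by
  obtain ⟨h1, h2⟩ := h
  unfold zz
  rw [if_pos h1]
  split_ifs with h3 h4 h5 h6 <;> simp_all
lemma zz_LL (y : Fin 7 → Fin 7 → F) : π.LL (π.zz y) := by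
  refine ⟨?_, ?_, ?_⟩
  · intro i j h
    unfold zz
    rw [if_neg (not_lt.2 h)]
  · intro i j h1 h2
    unfold zz
    simp [h1, h2]
  · intro i j h1 h2
    unfold zz
    simp only [h1, h2, π.hD _ h1, π.hD _ h2, π.ww, if_true]
    by_cases a : i < j <;> by_cases b : π.w j < π.w i <;> simp only [a, b, if_true, if_false, neg_zero]
    rcases lt_trichotomy (π.c i j) (π.c (π.w j) (π.w i)) with h | h | h
    · simp [h, h.ne', not_lt.2 h.le]
    · simp [h]
    · simp [h, h.ne', not_lt.2 h.le]
lemma LL_zz (h2 : (2 : F) ≠ 0) {Z : Mat F} (h : π.LL Z) : π.zz (fun i j => Z i j) = Z := by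
  ext i j
  unfold zz
  split_ifs with h1 h2' h3 h4 h5 h6
  · rfl
  · obtain ⟨e1, e2⟩ := π.hc _ _ _ _ h6
    have := h.n i j h2' h3
    rw [← e1, ← e2] at this
    have h7 : 2 * Z i j = 0 := by linear_combination this
    exact ((mul_eq_zero.1 h7).resolve_left h2).symm
  · change - Z (π.w j) (π.w i) = Z i j
    rw [h.n i j h2' h3, neg_neg]
  · have := h.n i j h2' h3
    rw [h.su _ _ (not_lt.1 h4)] at this
    rw [← neg_neg (Z i j), ← this, neg_zero]
  · rw [h.z i j h2' h3]
  · rfl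
  · rw [h.su i j (not_lt.1 h1)]
lemma zz_congr (y y' : Fin 7 → Fin 7 → F) (h : ∀ r, π.Rp r → y r.1 r.2 = y' r.1 r.2) : π.zz y = π.zz y' := by
  ext i j
  unfold zz
  split_ifs with h1 h2 h3 h4 h5 h6
  · exact h (i, j) ⟨h1, fun _ => ⟨h3, h4, h5⟩⟩
  · rfl
  · rw [h (π.w j, π.w i) ⟨h4, fun _ => ⟨π.hD _ h2, by simpa [π.ww] using h1, by
      simp only [π.ww]; omega⟩⟩]
  · rfl
  · rfl
  · exact h (i, j) ⟨h1, fun h => absurd h h2⟩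
  · rfl
lemma zz_add (y y' : Fin 7 → Fin 7 → F) : π.zz (y + y') = π.zz y + π.zz y' := by
  ext i j
  simp only [zz, Matrix.add_apply, Pi.add_apply]
  split_ifs <;> ring
lemma zz_smul (c : F) (y : Fin 7 → Fin 7 → F) : π.zz (c • y) = c • π.zz y := by
  ext i j
  simp only [zz, Matrix.smul_apply, Pi.smul_apply, smul_eq_mul]
  split_ifs <;> ring
/-- twisted commutator -/
def tc (σ : Fin 7 → F) (Z Z' : Mat F) : Mat F := Z * diagonal σ * Z' - Z' * diagonal σ * Z
lemma tc_apply (σ : Fin 7 → F) (Z Z' : Mat F) (i j) : tc σ Z Z' i j = ∑ k, (Z i k * σ k * Z' k j - Z' i k * σ k * Z k j) := by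
  rw [tc, Matrix.sub_apply, Matrix.mul_apply, Matrix.mul_apply, ← sum_sub_distrib]
  simp only [Matrix.mul_diagonal]
lemma tc_LL (σ : Fin 7 → F) (hσ : ∀ i, π.D i → σ (π.w i) = σ i) {Z Z' : Mat F} (h : π.LL Z) (h' : π.LL Z') : π.LL (tc σ Z Z') := by
  refine ⟨?_, ?_, ?_⟩
  · intro i j hij
    rw [tc_apply]
    apply sum_eq_zero
    intro k _
    rcases le_or_gt k i with h1 | h1
    · rw [h.su i k h1, h'.su i k h1]; ring
    · rw [h.su k j (hij.trans h1.le), h'.su k j (hij.trans h1.le)]; ring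
  · intro i j h1 h2
    rw [tc_apply]
    apply sum_eq_zero
    intro k _
    by_cases hk : π.D k
    · rw [h.z k j hk h2, h'.z k j hk h2]; ring
    · rw [h.z i k h1 hk, h'.z i k h1 hk]; ring
  · intro i j h1 h2
    rw [tc_apply, tc_apply, ← Finset.sum_neg_distrib]
    let e : Fin 7 ≃ Fin 7 := ⟨π.w, π.w, π.ww, π.ww⟩
    rw [← Equiv.sum_comp e]
    apply sum_congr rfl
    intro k _
    change Z (π.w j) (π.w k) * σ (π.w k) * Z' (π.w k) (π.w i) - Z' (π.w j) (π.w k) * σ (π.w k) * Z (π.w k) (π.w i) = _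
    by_cases hk : π.D k
    · rw [h.n k j hk h2, h'.n k j hk h2, h.n i k h1 hk, h'.n i k h1 hk, hσ k hk]; ring
    · have hk' : ¬ π.D (π.w k) := fun h => hk (by have := π.hD _ h; rwa [π.ww] at this)
      rw [h.z i k h1 hk, h'.z i k h1 hk, h.z _ _ (π.hD _ h2) hk', h'.z _ _ (π.hD _ h2) hk']; ring
open Classical in
/-- the normal form matrix -/
noncomputable def MM (σ : Fin 7 → F) : Mat F := fun i j => if π.D i ∧ j = π.w i then σ i else 0
lemma stab_LL (σ : Fin 7 → F) (h0 : ∀ i, σ i ≠ 0) (hσ : ∀ i, π.D i → σ (π.w i) = σ i) (Z : Mat F) :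
    StabA (π.MM σ) (Z * diagonal σ) ↔ π.LL Z := by
  classical
  have e1 : ∀ i j, (Z * diagonal σ) i j = Z i j * σ j := fun i j => Matrix.mul_diagonal _ _ _ _
  have e2 : ∀ i j, ((Z * diagonal σ)ᵀ * π.MM σ + π.MM σ * (Z * diagonal σ)) i j =
      (if π.D j then Z (π.w j) i * σ i * σ j else 0) + (if π.D i then σ i * (Z (π.w i) j * σ j) else 0) := by
    intro i j
    rw [Matrix.add_apply, Matrix.mul_apply, Matrix.mul_apply]
    congr 1
    · simp only [Matrix.transpose_apply, e1, MM]
      rw [Finset.sum_eq_single (π.w j)]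
      · rw [π.ww]
        by_cases hj : π.D j
        · simp [hj, π.hD j hj, hσ j hj]
        · have : ¬ π.D (π.w j) := fun h => hj (by have := π.hD _ h; rwa [π.ww] at this)
          simp [hj, this]
      · intro k _ hk
        rw [if_neg, mul_zero]
        rintro ⟨_, h⟩
        apply hk; rw [h, π.ww]
      · simp
    · simp only [e1, MM]
      rw [Finset.sum_eq_single (π.w i)]
      · by_cases hj : π.D i <;> simp [hj]
      · intro k _ hk
        rw [if_neg, zero_mul]
        rintro ⟨_, h⟩
        exact hk h
      · simp
  have e3 : (Z * diagonal σ)ᵀ * π.MM σ + π.MM σ * (Z * diagonal σ) = 0 ↔ ∀ i j,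
      (if π.D j then Z (π.w j) i * σ i * σ j else 0) + (if π.D i then σ i * (Z (π.w i) j * σ j) else 0) = 0 := by
    rw [← Matrix.ext_iff]
    simp only [e2, Matrix.zero_apply]
  have e4 : SU (Z * diagonal σ) ↔ SU Z := by
    unfold SU
    simp only [e1, mul_eq_zero, h0, or_false]
  unfold StabA
  rw [e3, e4]
  constructor
  · rintro ⟨h1, h2⟩
    refine ⟨h1, ?_, ?_⟩
    · intro i j hi hj
      have := h2 (π.w i) j
      simpa [hj, π.hD i hi, h0, π.ww] using this
    · intro i j hi hj
      have := h2 (π.w i) j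
      rw [if_pos hj, if_pos (π.hD i hi), π.ww] at this
      have h3 : (Z (π.w j) (π.w i) + Z i j) * (σ (π.w i) * σ j) = 0 := by linear_combination this
      have h4 := (mul_eq_zero.1 h3).resolve_right (mul_ne_zero (h0 _) (h0 _))
      linear_combination h4
  · rintro h
    refine ⟨h.su, ?_⟩
    intro i j
    by_cases hi : π.D i <;> by_cases hj : π.D j <;> simp only [hi, hj, if_true, if_false, add_zero, zero_add]
    · have := h.n (π.w i) j (π.hD i hi) hj
      rw [π.ww] at this
      rw [this]; ring
    · rw [h.z _ _ (π.hD i hi) hj]; ring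
    · rw [h.z _ _ (π.hD j hj) hi]; ring
/-- index type of the parameters -/
abbrev Rs := {r : Fin 7 × Fin 7 // π.Rp r}
open Classical in
noncomputable def ex (y : π.Rs → F) : Fin 7 → Fin 7 → F := fun i j => if h : π.Rp (i, j) then y ⟨(i, j), h⟩ else 0
noncomputable def zr (y : π.Rs → F) : Mat F := π.zz (π.ex y)
lemma zr_apply (y : π.Rs → F) (r : π.Rs) : π.zr y r.1.1 r.1.2 = y r := by
  rw [zr, zz_rp π _ r.1 r.2, ex, dif_pos r.2]
lemma zr_restrict (h2 : (2 : F) ≠ 0) {Z : Mat F} (h : π.LL Z) : π.zr (fun r => Z r.1.1 r.1.2) = Z := by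
  conv_rhs => rw [← LL_zz π h2 h]
  apply zz_congr
  intro r hr
  rw [ex, dif_pos hr]
/-- the pairing matrix -/
noncomputable def TT (σ : Fin 7 → F) (y : π.Rs → F) : Matrix π.Rs π.Rs F :=
  fun r b => tc σ (π.zr y) (π.zr (Pi.single b 1)) r.1.1 r.1.2
noncomputable instance : Fintype π.Rs := Fintype.ofFinite _
lemma TT_mul (σ : Fin 7 → F) (y y' : π.Rs → F) (r : π.Rs) : (π.TT σ y *ᵥ y') r = tc σ (π.zr y) (π.zr y') r.1.1 r.1.2 := by
  let f : (π.Rs → F) →ₗ[F] Mat F :=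
    { toFun := fun y' => tc σ (π.zr y) (π.zr y')
      map_add' := by
        intro a b
        have : π.ex (a + b) = π.ex a + π.ex b := by
          funext i j; simp only [ex, Pi.add_apply]; split_ifs <;> simp
        simp only [zr, this, zz_add, tc, Matrix.mul_add, Matrix.add_mul]; abel
      map_smul' := by
        intro c a
        have : π.ex (c • a) = c • π.ex a := by
          funext i j; simp only [ex, Pi.smul_apply]; split_ifs <;> simp
        simp [zr, this, zz_smul, tc, smul_sub] }
  change _ = f y' r.1.1 r.1.2
  conv_rhs => rw [LinearMap.pi_apply_eq_sum_univ f y']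
  rw [Matrix.mulVec, dotProduct, Matrix.sum_apply]
  apply sum_congr rfl
  intro b _
  rw [Matrix.smul_apply, smul_eq_mul, mul_comm]
  congr 1
  change _ = tc σ (π.zr y) (π.zr _) r.1.1 r.1.2
  unfold TT
  congr 3
  funext j
  simp [Pi.single_apply, eq_comm]
lemma phi_MM (h2 : (2 : F) ≠ 0) (σ : Fin 7 → F) (h0 : ∀ i, σ i ≠ 0) (hσ : ∀ i, π.D i → σ (π.w i) = σ i) :
    phi (π.MM σ) = Nat.card {z : (π.Rs → F) × (π.Rs → F) // ∀ b, ∑ r, z.2 r * tc σ (π.zr z.1) (π.zr (Pi.single b 1)) r.1.1 r.1.2 = 0} := by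
  have h3 : Nat.card {z : (π.Rs → F) × (π.Rs → F) // ∀ b, ∑ r, z.2 r * tc σ (π.zr z.1) (π.zr (Pi.single b 1)) r.1.1 r.1.2 = 0} =
     Nat.card {z : (π.Rs → F) × (π.Rs → F) // z.2 ᵥ* π.TT σ z.1 = 0} := by
    apply Nat.card_congr
    apply Equiv.subtypeEquivRight
    intro z
    rw [funext_iff]; rfl
  classical
  rw [h3, ← card_dual]
  symm
  have hdd : diagonal σ * diagonal (fun i => (σ i)⁻¹) = (1 : Mat F) := by
    rw [diagonal_mul_diagonal, ← diagonal_one]; congr 1; funext i; simp [h0]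
  have hdd' : diagonal (fun i => (σ i)⁻¹) * diagonal σ = (1 : Mat F) := by
    rw [diagonal_mul_diagonal, ← diagonal_one]; congr 1; funext i; simp [h0]
  have hmap : ∀ z : {z : (π.Rs → F) × (π.Rs → F) // π.TT σ z.1 *ᵥ z.2 = 0},
      StabA (π.MM σ) (π.zr z.1.1 * diagonal σ) ∧ StabA (π.MM σ) (π.zr z.1.2 * diagonal σ) ∧
      (π.zr z.1.1 * diagonal σ) * (π.zr z.1.2 * diagonal σ) = (π.zr z.1.2 * diagonal σ) * (π.zr z.1.1 * diagonal σ) := by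
    rintro ⟨⟨y, y'⟩, h⟩
    refine ⟨(stab_LL π σ h0 hσ _).2 (zz_LL π _), (stab_LL π σ h0 hσ _).2 (zz_LL π _), ?_⟩
    have h4 : tc σ (π.zr y) (π.zr y') = 0 := by
      change tc σ (π.zz (π.ex y)) (π.zz (π.ex y')) = 0
      rw [← zr_restrict π h2 (tc_LL π σ hσ (zz_LL π (π.ex y)) (zz_LL π (π.ex y')))]
      have : (fun r : π.Rs => tc σ (π.zz (π.ex y)) (π.zz (π.ex y')) r.1.1 r.1.2) = 0 := by
        funext r
        have := congrFun h r
        rw [TT_mul] at this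
        exact this
      rw [this]
      have : π.ex (0 : π.Rs → F) = (0 : F) • (fun _ _ => 0) := by
        funext i j; simp [ex]
      rw [zr, this, zz_smul, zero_smul]
    rw [tc, sub_eq_zero] at h4
    simp only
    rw [← Matrix.mul_assoc, ← Matrix.mul_assoc, h4]
  apply Nat.card_eq_of_bijective (fun z => ⟨(π.zr z.1.1 * diagonal σ, π.zr z.1.2 * diagonal σ), hmap z⟩)
  · constructor
    · rintro ⟨⟨y, y'⟩, h⟩ ⟨⟨x, x'⟩, k⟩ e
      simp only [Subtype.mk.injEq, Prod.mk.injEq] at e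
      have canc : ∀ A B : Mat F, A * diagonal σ = B * diagonal σ → A = B := by
        intro A B hAB
        have := congrArg (· * diagonal (fun i => (σ i)⁻¹)) hAB
        simpa only [Matrix.mul_assoc, hdd, Matrix.mul_one] using this
      have e1 := canc _ _ e.1
      have e2 := canc _ _ e.2
      have : ∀ y x : π.Rs → F, π.zr y = π.zr x → y = x := by
        intro y x h; funext r; rw [← zr_apply π y r, h, zr_apply]
      simp [this _ _ e1, this _ _ e2]
    · rintro ⟨⟨X, X'⟩, hX, hX', hc⟩
      have e : ∀ X : Mat F, X * diagonal (fun i => (σ i)⁻¹) * diagonal σ = X := by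
        intro X; rw [Matrix.mul_assoc, hdd', Matrix.mul_one]
      have hL : π.LL (X * diagonal (fun i => (σ i)⁻¹)) := by rw [← stab_LL π σ h0 hσ, e]; exact hX
      have hL' : π.LL (X' * diagonal (fun i => (σ i)⁻¹)) := by rw [← stab_LL π σ h0 hσ, e]; exact hX'
      refine ⟨⟨(fun r => (X * diagonal (fun i => (σ i)⁻¹)) r.1.1 r.1.2, fun r => (X' * diagonal (fun i => (σ i)⁻¹)) r.1.1 r.1.2), ?_⟩, ?_⟩
      · funext r
        rw [TT_mul]
        simp only
        rw [zr_restrict π h2 hL, zr_restrict π h2 hL', tc, e, e]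
        simp only at hc
        rw [← Matrix.mul_assoc, hc, ← Matrix.mul_assoc, sub_self]; rfl
      · simp only [zr_restrict π h2 hL, zr_restrict π h2 hL', e]
end PI
end
end SpC

namespace SpC
set_option linter.unusedSectionVars false
open Finset Matrix
lemma clt {β : Type*} (x m : ℕ) (s t : β) : (bif lt x m then s else t) = if x < m then s else t := by
  unfold lt
  by_cases h : x < m
  · rw [Nat.ble_eq_true_of_le h]; simp [h]
  · have : Nat.ble (Nat.succ x) m = false := by
      rw [← Bool.not_eq_true, Nat.ble_eq]; exact h
    rw [this]; simp [h]
lemma cble {β : Type*} (x m : ℕ) (s t : β) : (bif Nat.ble x m then s else t) = if x ≤ m then s else t := by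
  by_cases h : x ≤ m
  · rw [Nat.ble_eq_true_of_le h]; simp [h]
  · have : Nat.ble x m = false := by
      rw [← Bool.not_eq_true, Nat.ble_eq]; exact h
    rw [this]; simp [h]
/-! packing -/
lemma unp_eq (T i j : ℕ) : unp T i j = (T >>> (posn i j)) % 2 ^ 10 := by
  change (T >>> (posn i j)) &&& 1023 = _
  rw [← Nat.and_two_pow_sub_one_eq_mod]
lemma unp_tb (T i j k : ℕ) : (unp T i j).testBit k = (decide (k < 10) && T.testBit (posn i j + k)) := by
  rw [unp_eq, Nat.testBit_mod_two_pow, Nat.testBit_shiftRight]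
lemma unp_lor (a b i j : ℕ) : unp (Nat.lor a b) i j = Nat.lor (unp a i j) (unp b i j) := by
  apply Nat.eq_of_testBit_eq
  intro k
  change (unp (a ||| b) i j).testBit k = (unp a i j ||| unp b i j).testBit k
  rw [Nat.testBit_or, unp_tb, unp_tb, unp_tb, Nat.testBit_or]
  cases decide (k < 10) <;> simp
lemma posn_eq (i j : ℕ) : posn i j = 10 * (7 * i + j) := rfl
lemma unp_shift (v : ℕ) (hv : v < 1024) (a b i j : ℕ) (hb : b < 7) (hj : j < 7) :
    unp (Nat.shiftLeft v (posn a b)) i j = if (i, j) = (a, b) then v else 0 := by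
  apply Nat.eq_of_testBit_eq
  intro k
  rw [unp_tb]
  change (decide (k < 10) && (v <<< (posn a b)).testBit _) = _
  rw [Nat.testBit_shiftLeft, posn_eq, posn_eq]
  have hv' : ∀ n, 10 ≤ n → v.testBit n = false := fun n hn =>
    Nat.testBit_lt_two_pow (lt_of_lt_of_le (show v < 2 ^ 10 from hv) (Nat.pow_le_pow_right (by norm_num) hn))
  split_ifs with h
  · simp only [Prod.mk.injEq] at h
    obtain ⟨rfl, rfl⟩ := h
    by_cases hk : k < 10
    · simp [hk]
    · simp [hk, hv' k (by omega)]
  · rw [Nat.zero_testBit]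
    by_cases hk : k < 10
    · by_cases h2 : 10 * (7 * i + j) + k ≥ 10 * (7 * a + b)
      · have : 10 ≤ 10 * (7 * i + j) + k - 10 * (7 * a + b) := by
          have : 7 * i + j ≠ 7 * a + b := by
            intro h3; apply h; simp only [Prod.mk.injEq]; omega
          omega
        rw [hv' _ this]; simp
      · simp [h2]
    · simp [hk]
def pack (g : ℕ × ℕ → ℕ) (l : List (ℕ × ℕ)) : ℕ := l.rec (nat_lit 0) (fun a _ ih => Nat.lor (Nat.shiftLeft (g a) (posn a.1 a.2)) ih)
lemma unp_pack (g : ℕ × ℕ → ℕ) (l : List (ℕ × ℕ)) (hl : ∀ a ∈ l, a.2 < 7 ∧ g a < 1024) (i j : ℕ) (hj : j < 7) :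
    unp (pack g l) i j = if (i, j) ∈ l then g (i, j) else 0 := by
  induction l with
  | nil =>
    apply Nat.eq_of_testBit_eq
    intro k
    rw [unp_tb]; change (_ && Nat.testBit 0 _) = Nat.testBit 0 _
    simp
  | cons a l ih =>
    change unp (Nat.lor _ (pack g l)) i j = _
    have h := hl a (by simp)
    rw [unp_lor, unp_shift _ h.2 _ _ _ _ h.1 hj, ih (fun b hb => hl b (by simp [hb]))]
    change (_ : ℕ) ||| (_ : ℕ) = _
    by_cases h1 : (i, j) = a
    · rw [if_pos h1, h1]; by_cases h2 : a ∈ l <;> simp [h2]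
    · rw [if_neg h1]; simp [h1]
/-! static facts -/
def yP (r : Fin 7 × Fin 7) : ℕ := unp yT r.1 r.2
def fP (r : Fin 7 × Fin 7) : ℕ := unp fT r.1 r.2
def upF : Finset (Fin 7 × Fin 7) := {r | r.1 < r.2}
lemma mem_upF (r : Fin 7 × Fin 7) : r ∈ upF ↔ r.1 < r.2 := by simp [upF]
lemma yP_vars : ∀ r ∈ upF, yP r ∈ vars ∧ fP r ∈ vars := by decide +kernel
lemma yP_inj : ∀ r ∈ upF, ∀ s ∈ upF, (yP r = yP s → r = s) ∧ (fP r = fP s → r = s) ∧ yP r ≠ fP s := by decide +kernel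
lemma yP_sP : ∀ r ∈ upF, ∀ k : Fin 7, yP r ≠ sP k ∧ fP r ≠ sP k := by decide +kernel
lemma sP_vars : ∀ k : Fin 7, sP k ∈ vars := by decide +kernel
lemma sP_inj : ∀ k l : Fin 7, sP k = sP l → k = l := by decide +kernel
lemma yT_lt : ∀ r : Fin 7 × Fin 7, yP r < 512 ∧ fP r < 1024 := by decide +kernel
lemma code_inj : ∀ i j k l : Fin 7, code i j = code k l → i = k ∧ j = l := by decide +kernel
lemma up_nodup : up.Nodup := by decide +kernel
lemma up_lt : ∀ a ∈ up, a.1 < a.2 ∧ a.2 < 7 := by decide +kernel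
lemma mem_up : ∀ r ∈ upF, ((r.1 : ℕ), (r.2 : ℕ)) ∈ up := by decide +kernel
lemma up_iff (i j : ℕ) : (i, j) ∈ up ↔ i < j ∧ j < 7 := by
  constructor
  · exact up_lt _
  · rintro ⟨h1, h2⟩
    exact mem_up (⟨i, by omega⟩, ⟨j, h2⟩) ((mem_upF _).2 h1)
lemma vars_odd {x : ℕ} (h : x ∈ vars) : x.Prime ∧ x ≠ 2 := vars_prime x h
lemma wv_le (w i : ℕ) : wv w i ≤ 7 := Nat.and_le_right
/-- validity of a packed involution -/
def Val (w : ℕ) : Prop := ∀ i < 7, wv w i = 7 ∨ wv w (wv w i) = i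
/-- the partial involution -/
def piw (w : ℕ) (hw : Val w) : PI where
  D i := wv w i ≠ 7
  w i := if h : wv w i < 7 then ⟨wv w i, h⟩ else i
  ww i := by
    have h1 := wv_le w i
    rcases hw i i.2 with h | h
    · simp [h]
    · by_cases h7 : wv w i < 7
      · apply Fin.ext; simp [h7, h]
      · simp [h7]
  hD i h := by
    have h1 := wv_le w i
    have h7 : wv w i < 7 := by omega
    rcases hw i i.2 with h' | h'
    · exact absurd h' h
    · have := i.2
      simp only [h7, dif_pos, h']; omega
  c i j := code i j
  hc := code_inj
section
variable {w : ℕ} (hw : Val w)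
lemma piw_w {i : Fin 7} (h : wv w i ≠ 7) : (((piw w hw).w i : Fin 7) : ℕ) = wv w i := by
  have h1 := wv_le w i
  have h7 : wv w i < 7 := by omega
  simp [piw, h7]
variable {F : Type*} [Field F] [Fintype F]
lemma ev_zt (a : ℕ → F) (i j : Fin 7) (hij : i < j) :
    ev a (zt w i j) = (piw w hw).zz (fun i j => a (yP (i, j))) i j := by
  have hy : ∀ i j : Fin 7, i < j → ev a (unp yT i j) = a (yP (i, j)) := by
    intro i j h
    have := vars_odd (yP_vars (i, j) ((mem_upF _).2 h)).1
    exact ev_odd a this.1 this.2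
  unfold zt PI.zz
  simp only [force_eq, cbeq, clt]
  rw [if_pos hij]
  by_cases hi : wv w i = 7
  · have : ¬ (piw w hw).D i := fun h => h hi
    rw [if_pos hi, if_neg this, hy i j hij]
  · have : (piw w hw).D i := hi
    rw [if_neg hi, if_pos this]
    by_cases hj : wv w j = 7
    · have : ¬ (piw w hw).D j := fun h => h hj
      rw [if_pos hj, if_neg this, ev_zero]
    · have : (piw w hw).D j := hj
      rw [if_neg hj, if_pos this]
      simp only [← piw_w hw hi, ← piw_w hw hj]
      by_cases h1 : (piw w hw).w j < (piw w hw).w i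
      · rw [if_pos h1, if_pos (by exact h1)]
        change ev a (if (piw w hw).c i j < (piw w hw).c _ _ then _ else if (piw w hw).c i j = (piw w hw).c _ _ then _ else _) = _
        split_ifs
        · exact hy i j hij
        · exact ev_zero a
        · rw [show Nat.mul 2 (unp yT ((piw w hw).w j) ((piw w hw).w i)) = 2 * unp yT ((piw w hw).w j) ((piw w hw).w i) from rfl,
            ev_mul, hy _ _ h1, ev_two]; ring
      · rw [if_neg h1, if_neg (by exact h1), ev_zero]
lemma zt_lt (i j : Fin 7) : zt w i j < 1024 := by
  have hy : ∀ i j : Fin 7, unp yT i j < 512 := fun i j => (yT_lt (i, j)).1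
  unfold zt
  simp only [force_eq, cbeq, clt]
  have := hy i j
  split_ifs with h1 h2 h3 h4 h5
  · omega
  · omega
  · omega
  · omega
  · have h6 := wv_le w i
    have h7 := wv_le w j
    have := hy ⟨wv w j, by omega⟩ ⟨wv w i, by omega⟩
    simp only at this
    change 2 * _ < 1024
    omega
  · omega
lemma rp_iff (r : Fin 7 × Fin 7) (h : r.1 < r.2) : zt w r.1 r.2 = unp yT r.1 r.2 ↔ (piw w hw).Rp r := by
  have hv := vars_odd (yP_vars r ((mem_upF _).2 h)).1
  have hpos := hv.1.pos
  have hodd := hv.1.odd_of_ne_two hv.2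
  change 0 < unp yT r.1 r.2 at hpos
  change Odd (unp yT r.1 r.2) at hodd
  obtain ⟨i, j⟩ := r
  unfold zt PI.Rp
  simp only [force_eq, cbeq, clt] at *
  by_cases hi : wv w i = 7
  · have : ¬ (piw w hw).D i := fun h => h hi
    simp [hi, this, h]
  · have : (piw w hw).D i := hi
    rw [if_neg hi]
    by_cases hj : wv w j = 7
    · have h2 : ¬ (piw w hw).D j := fun h => h hj
      simp only [hj, h2, this, h, if_true, true_imp_iff, false_and, and_false, iff_false]
      exact hpos.ne
    · have h2 : (piw w hw).D j := hj
      simp only [hj, h2, this, h, if_false, true_imp_iff, true_and]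
      simp only [← piw_w hw hi, ← piw_w hw hj]
      change (if ((piw w hw).w j) < ((piw w hw).w i) then (if (piw w hw).c i j < (piw w hw).c _ _ then _ else if (piw w hw).c i j = (piw w hw).c _ _ then _ else _) else _) = _ ↔ _
      split_ifs with h3 h4 h5
      · simp [h3, h4]
      · simp only [h4, and_false, iff_false]; exact hpos.ne
      · simp only [h4, and_false, iff_false]
        change ¬ 2 * _ = _
        intro h6
        rw [← h6] at hodd
        exact absurd (even_two_mul _) (Nat.not_even_iff_odd.2 hodd)
      · simp only [h3, false_and, iff_false]; exact hpos.ne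
lemma reps_eq : reps w = up.filter (fun a => zt w a.1 a.2 = unp yT a.1 a.2) := by
  unfold reps
  induction up with
  | nil => rfl
  | cons a l ih =>
    simp only [cbeq, List.filter_cons]
    simp only [cbeq] at ih
    by_cases h : zt w a.1 a.2 = unp yT a.1 a.2 <;> simp [h, ih]
lemma mem_reps (r : Fin 7 × Fin 7) : ((r.1 : ℕ), (r.2 : ℕ)) ∈ reps w ↔ (piw w hw).Rp r := by
  rw [reps_eq, List.mem_filter, up_iff]
  simp only [decide_eq_true_eq]
  constructor
  · rintro ⟨h1, h2⟩; exact (rp_iff hw r h1.1).1 h2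
  · intro h; exact ⟨⟨h.1, r.2.2⟩, (rp_iff hw r h.1).2 h⟩
lemma reps_lt {a : ℕ × ℕ} (h : a ∈ reps w) : a.1 < a.2 ∧ a.2 < 7 := by
  rw [reps_eq, List.mem_filter] at h; exact up_lt a h.1
lemma reps_prod {M : Type*} [CommMonoid M] (g : ℕ × ℕ → M) :
    ((reps w).map g).prod = ∏ r : (piw w hw).Rs, g ((r.1.1 : ℕ), (r.1.2 : ℕ)) := by
  have hn : (reps w).Nodup := by rw [reps_eq]; exact up_nodup.filter _
  rw [← List.prod_toFinset g hn]
  symm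
  apply Finset.prod_bij (fun (r : (piw w hw).Rs) _ => ((r.1.1 : ℕ), (r.1.2 : ℕ)))
  · intro r _; rw [List.mem_toFinset]; exact (mem_reps hw r.1).2 r.2
  · intro r _ s _ h
    simp only [Prod.mk.injEq] at h
    exact Subtype.ext (Prod.ext (Fin.ext h.1) (Fin.ext h.2))
  · intro b hb
    rw [List.mem_toFinset] at hb
    have h := reps_lt hb
    exact ⟨⟨(⟨b.1, by omega⟩, ⟨b.2, h.2⟩), (mem_reps hw _).1 hb⟩, mem_univ _, rfl⟩
  · intro r _; rfl
lemma frP_eq : frP (reps w) = ∏ r : (piw w hw).Rs, (yP r.1 * fP r.1) := by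
  have : ∀ R, frP R = (R.map (fun b => unp yT b.1 b.2 * unp fT b.1 b.2)).prod := by
    intro R
    induction R with
    | nil => rfl
    | cons b R ih => rw [List.map_cons, List.prod_cons, ← ih]; rfl
  rw [this, reps_prod hw]; rfl
lemma lenR_eq : lenR (reps w) = Fintype.card (piw w hw).Rs + Fintype.card (piw w hw).Rs := by
  have : ∀ R, lenR R = R.length + R.length := by
    intro R
    induction R with
    | nil => rfl
    | cons b R ih =>
      change lenR R + 1 + 1 = _
      rw [ih, List.length_cons]; omega
  have h2 := reps_prod hw (fun _ => 2)
  simp only [List.map_const', List.prod_replicate, prod_const, Finset.card_univ] at h2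
  rw [this, Nat.pow_right_injective le_rfl h2]
lemma ev_zT (a : ℕ → F) (i j : Fin 7) : ev a (unp (zT w) i j) = (piw w hw).zz (fun i j => a (yP (i, j))) i j := by
  have h := unp_pack (fun b => zt w b.1 b.2) up (fun b hb => ⟨(up_lt b hb).2, by
    have := up_lt b hb
    exact zt_lt ⟨b.1, by omega⟩ ⟨b.2, this.2⟩⟩) i j j.2
  change unp (zT w) i j = _ at h
  rw [h]
  by_cases hij : i < j
  · rw [if_pos ((up_iff _ _).2 ⟨hij, j.2⟩), ev_zt hw a i j hij]
  · rw [if_neg (fun h => hij ((up_iff _ _).1 h).1), ev_zero, PI.zz, if_neg hij]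
lemma ev_rT (a : ℕ → F) (i j : Fin 7) : ev a (unp (rT (reps w)) i j) = (piw w hw).ex (fun r => a (fP r.1)) i j := by
  have h := unp_pack (fun b => unp fT b.1 b.2) (reps w) (fun b hb => ⟨(reps_lt hb).2, by
    have := reps_lt hb
    exact (yT_lt (⟨b.1, by omega⟩, ⟨b.2, this.2⟩)).2⟩) i j j.2
  change unp (rT (reps w)) i j = _ at h
  rw [h, PI.ex]
  by_cases hr : (piw w hw).Rp (i, j)
  · rw [if_pos ((mem_reps hw (i, j)).2 hr), dif_pos hr]
    have := vars_odd (yP_vars (i, j) ((mem_upF _).2 hr.1)).2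
    exact ev_odd a this.1 this.2
  · rw [if_neg (fun h => hr ((mem_reps hw (i, j)).1 h)), dif_neg hr, ev_zero]
end
end SpC

namespace SpC
set_option linter.unusedSectionVars false
open Finset Matrix
section
variable {w : ℕ} (hw : Val w)
variable {F : Type*} [Field F] [Fintype F]
/-- scalars -/
noncomputable def sgm (w : ℕ) (a : ℕ → F) (i : Fin 7) : F := ev a (sg w i)
lemma pe_insN (a : ℕ → F) (m : ℕ) (l : List ℕ) : pe a (insN m l) = ev a m + pe a l := by
  unfold insN
  rw [force_eq, cbeq]
  split_ifs with h
  · rw [h]; change _ = ev a 0 + _; rw [ev_zero, zero_add]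
  · exact pe_ins a m l
lemma pe_lrec (a : ℕ → F) (g : ℕ → ℕ) (acc : List ℕ) (l : List ℕ) :
    pe a (lrec acc (fun i _ ih => insN (g i) ih) l) = (l.map (fun i => ev a (g i))).sum + pe a acc := by
  induction l with
  | nil => simp
  | cons i l ih => rw [lrec_cons, pe_insN, ih, List.map_cons, List.sum_cons]; ring
lemma sum_filt (p : ℕ → Bool) (g : ℕ → F) (h : ∀ i : Fin 7, p i = false → g i = 0) :
    ((lrec [] (fun i _ ih => bif p i then i :: ih else ih) [(nat_lit 0),(nat_lit 1),(nat_lit 2),(nat_lit 3),(nat_lit 4),(nat_lit 5),(nat_lit 6)]).map g).sum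
      = ∑ i : Fin 7, g i := by
  have h1 : ∀ l : List ℕ, (∀ i ∈ l, i < 7) → ((lrec [] (fun i _ ih => bif p i then i :: ih else ih) l).map g).sum = (l.map g).sum := by
    intro l hl
    induction l with
    | nil => rfl
    | cons i l ih =>
      have ih := ih (fun i hi => hl i (by simp [hi]))
      rw [lrec_cons]
      cases hp : p i with
      | true => simp only [cond_true, List.map_cons, List.sum_cons, ih]
      | false =>
        have : g i = 0 := h ⟨i, hl i (by simp)⟩ hp
        simp only [cond_false, List.map_cons, List.sum_cons, ih, this, zero_add]
  rw [h1 _ (by decide), Fin.sum_univ_seven]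
  simp only [List.map_cons, List.sum_cons, List.map_nil, List.sum_nil]
  change _ = g 0 + g 1 + g 2 + g 3 + g 4 + g 5 + g 6
  ring
/-- bilinear unit -/
def UU (fh : Fin 7 → Fin 7 → F) (σ : Fin 7 → F) (Z : Mat F) (k j : Fin 7) : F := ∑ i, fh i j * σ k * Z i k - ∑ l, fh k l * σ j * Z j l
lemma pe_unitT (a : ℕ → F) (T f : ℕ) (fh : Fin 7 → Fin 7 → F) (Z : Mat F) (hf : ∀ i j : Fin 7, ev a (unp f i j) = fh i j)
    (hT : ∀ i j : Fin 7, ev a (unp T i j) = Z i j) (hZ : SU Z) (k j : Fin 7) (s : ℕ) (acc : List ℕ) :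
    pe a (unitT w T f k j s acc) = ev a s * UU fh (sgm w a) Z k j + pe a acc := by
  unfold unitT
  simp only [force_eq]
  rw [pe_lrec, pe_lrec]
  unfold lowl highl
  have hm : ∀ m n, ev a (Nat.mul m n) = ev a m * ev a n := ev_mul a
  have lt_f : ∀ x y, lt x y = false → y ≤ x := by
    intro x y h
    by_contra h2
    have : lt x y = true := Nat.ble_eq_true_of_le (by omega)
    rw [h] at this; cases this
  rw [sum_filt, sum_filt]
  · simp only [ev_nrm, hm, ev_opp, hf, hT, UU]
    rw [mul_sub, mul_sum, mul_sum, ← add_assoc, sub_eq_add_neg, ← sum_neg_distrib, add_comm (∑ x, _) (∑ x, _)]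
    congr 2
    · apply sum_congr rfl; intro i _; simp only [sgm]; ring
    · apply sum_congr rfl; intro i _; simp only [sgm]; ring
  · intro i h
    rw [ev_nrm, hm, hT, hZ i k (lt_f _ _ h), mul_zero]
  · intro i h
    rw [ev_nrm, hm, hT, hZ j i (lt_f _ _ h), mul_zero]
lemma tc_single (σ : Fin 7 → F) (Z : Mat F) (fh : Fin 7 → Fin 7 → F) (k j : Fin 7) :
    ∑ i, ∑ l, fh i l * PI.tc σ Z (Matrix.single k j 1) i l = UU fh σ Z k j := by
  have h : ∀ i l, PI.tc σ Z (Matrix.single k j 1) i l = (if l = j then Z i k * σ k else 0) - (if i = k then σ j * Z j l else 0) := by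
    intro i l
    rw [PI.tc_apply, sum_sub_distrib]
    congr 1
    · rw [sum_eq_single k]
      · by_cases h : l = j
        · simp [h]
        · simp [h, Ne.symm h]
      · intro x _ hx; simp [hx.symm]
      · simp
    · rw [sum_eq_single j]
      · by_cases h : i = k
        · simp [h]
        · simp [h, Ne.symm h]
      · intro x _ hx; simp [hx.symm]
      · simp
  simp only [h, mul_sub, sum_sub_distrib, UU]
  congr 1
  · apply sum_congr rfl; intro i _
    simp; ring
  · rw [sum_eq_single k]
    · apply sum_congr rfl; intro l _; simp; ring
    · intro x _ hx; simp [hx]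
    · simp
open Classical in
lemma zr_single (π : PI) (h2 : (2 : F) ≠ 0) (b : π.Rs) : π.zr (Pi.single b (1 : F)) =
    Matrix.single b.1.1 b.1.2 1 - if π.D b.1.1 then Matrix.single (π.w b.1.2) (π.w b.1.1) 1 else 0 := by
  obtain ⟨⟨k, j⟩, hlt, hb⟩ := b
  simp only at *
  have wi : ∀ x y, π.w x = y ↔ x = π.w y := by
    intro x y; constructor
    · rintro rfl; rw [π.ww]
    · rintro rfl; rw [π.ww]
  have hL : π.LL (Matrix.single k j (1 : F) - if π.D k then Matrix.single (π.w j) (π.w k) 1 else 0) := by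
    by_cases hk : π.D k
    · rw [if_pos hk]
      obtain ⟨hj, hw, hc⟩ := hb hk
      refine ⟨?_, ?_, ?_⟩
      · intro i l hil
        rw [Matrix.sub_apply, Matrix.single_apply, Matrix.single_apply, if_neg, if_neg, sub_zero]
        · rintro ⟨rfl, rfl⟩; exact absurd hw (not_lt.2 hil)
        · rintro ⟨rfl, rfl⟩; exact absurd hlt (not_lt.2 hil)
      · intro i l hi hl
        rw [Matrix.sub_apply, Matrix.single_apply, Matrix.single_apply, if_neg, if_neg, sub_zero]
        · rintro ⟨rfl, rfl⟩; exact hl (π.hD _ hk)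
        · rintro ⟨rfl, rfl⟩; exact hl hj
      · intro i l hi hl
        simp only [Matrix.sub_apply, Matrix.single_apply, neg_sub]
        congr 1
        · congr 1; rw [eq_iff_iff]
          constructor
          · rintro ⟨h1, h2⟩; exact ⟨by rw [h2, π.ww], by rw [h1, π.ww]⟩
          · rintro ⟨rfl, rfl⟩; simp [π.ww]
        · congr 1; rw [eq_iff_iff]
          constructor
          · rintro ⟨h1, h2⟩; exact ⟨by rw [← π.ww k, h2, π.ww], by rw [← π.ww j, h1, π.ww]⟩
          · rintro ⟨rfl, rfl⟩; simp
    · rw [if_neg hk, sub_zero]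
      refine ⟨?_, ?_, ?_⟩
      · intro i l hil
        rw [Matrix.single_apply, if_neg]
        rintro ⟨rfl, rfl⟩; exact absurd hlt (not_lt.2 hil)
      · intro i l hi hl
        rw [Matrix.single_apply, if_neg]
        rintro ⟨rfl, rfl⟩; exact hk hi
      · intro i l hi hl
        rw [Matrix.single_apply, if_neg, Matrix.single_apply, if_neg, neg_zero]
        · rintro ⟨rfl, rfl⟩; exact hk hi
        · rintro ⟨h1, h2⟩; exact hk (h1 ▸ π.hD _ hl)
  rw [← PI.zr_restrict π h2 hL]
  congr 1
  funext r
  obtain ⟨⟨i, l⟩, hil, hr⟩ := r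
  simp only at *
  rw [Pi.single_apply, Matrix.sub_apply]
  have : (if π.D k then Matrix.single (π.w j) (π.w k) (1 : F) else 0) i l = 0 := by
    split_ifs with hk
    · rw [Matrix.single_apply, if_neg]
      rintro ⟨rfl, rfl⟩
      obtain ⟨hj, hw, hc⟩ := hb hk
      have h3 : π.c (π.w j) (π.w k) < π.c (π.w (π.w k)) (π.w (π.w j)) := (hr (π.hD _ hj)).2.2
      rw [π.ww, π.ww] at h3
      exact absurd h3 (not_lt.2 (le_of_lt hc))
    · rfl
  rw [this, sub_zero, Matrix.single_apply]
  congr 1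
  rw [eq_iff_iff]
  constructor
  · intro h; have := congrArg Subtype.val h; simp only [Prod.mk.injEq] at this; exact ⟨this.1.symm, this.2.symm⟩
  · rintro ⟨rfl, rfl⟩; rfl
lemma sum_ex (π : PI) (f : π.Rs → F) (X : Mat F) : ∑ r, f r * X r.1.1 r.1.2 = ∑ i, ∑ l, π.ex f i l * X i l := by
  classical
  have h1 : ∑ i, ∑ l, π.ex f i l * X i l = ∑ r : Fin 7 × Fin 7, π.ex f r.1 r.2 * X r.1 r.2 := by
    rw [Fintype.sum_prod_type]
  rw [h1, ← Finset.sum_filter_of_ne (p := π.Rp)]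
  · rw [Finset.sum_subtype (p := π.Rp)]
    · apply sum_congr rfl
      intro r _
      rw [PI.ex, dif_pos r.2]
    · intro x; simp
  · intro r _ h
    by_contra hr
    apply h
    rw [PI.ex, dif_neg hr, zero_mul]
lemma pe_eqb (h2 : (2 : F) ≠ 0) (a : ℕ → F) (b : (piw w hw).Rs) :
    pe a (eqb w (zT w) (rT (reps w)) ((b.1.1 : ℕ), (b.1.2 : ℕ))) =
     ∑ r : (piw w hw).Rs, a (fP r.1) * PI.tc (sgm w a) ((piw w hw).zr (fun r => a (yP r.1))) ((piw w hw).zr (Pi.single b 1)) r.1.1 r.1.2 := by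
  classical
  rw [sum_ex (piw w hw) (fun r => a (fP r.1))]
  have hz : (piw w hw).zr (fun r => a (yP r.1)) = (piw w hw).zz (fun i j => a (yP (i, j))) := by
    apply PI.zz_congr
    intro r hr
    rw [PI.ex, dif_pos hr]
  rw [zr_single (piw w hw) h2 b, hz]
  set Z := (piw w hw).zz (fun i j => a (yP (i, j))) with hZ
  set fh := (piw w hw).ex (fun r => a (fP r.1)) with hfh
  have hSU : SU Z := (PI.zz_LL _ _).su
  have hu := pe_unitT (w := w) a (zT w) (rT (reps w)) fh Z (ev_rT hw a) (ev_zT hw a) hSU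
  have hsub : ∀ A B : Mat F, PI.tc (sgm w a) Z (A - B) = PI.tc (sgm w a) Z A - PI.tc (sgm w a) Z B := by
    intro A B; simp only [PI.tc, Matrix.mul_sub, Matrix.sub_mul]; abel
  rw [hsub]
  simp only [Matrix.sub_apply, mul_sub, sum_sub_distrib]
  rw [tc_single]
  obtain ⟨⟨k, j⟩, hlt, hb⟩ := b
  simp only at *
  unfold eqb
  simp only [cbeq]
  rw [hu k j]
  rw [show ev a (nat_lit 1) = 1 from ev_one a, one_mul, sub_eq_add_neg]
  congr 1
  by_cases hk : wv w k = 7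
  · have : ¬ (piw w hw).D k := fun h => h hk
    rw [if_pos hk, if_neg this]
    simp [pe, PI.tc]
  · have hk' : (piw w hw).D k := hk
    have hj : wv w j ≠ 7 := (hb hk').1
    rw [if_neg hk, if_neg hj, if_pos hk', tc_single, ← piw_w hw hk, ← piw_w hw hj, hu]
    rw [show ev a (nat_lit 2) = -1 from ev_two a]
    simp [pe]
lemma sat_eqs (h2 : (2 : F) ≠ 0) (a : ℕ → F) : sat a (eqs w (zT w) (rT (reps w)) (reps w)) ↔
    ∀ b, ∑ r : (piw w hw).Rs, a (fP r.1) * PI.tc (sgm w a) ((piw w hw).zr (fun r => a (yP r.1))) ((piw w hw).zr (Pi.single b 1)) r.1.1 r.1.2 = 0 := by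
  have h1 : ∀ T f R, eqs w T f R = R.map (eqb w T f) := by
    intro T f R
    induction R with
    | nil => rfl
    | cons b R ih => rw [List.map_cons, ← ih]; rfl
  unfold sat
  rw [h1]
  simp only [List.mem_map, forall_exists_index, and_imp, forall_apply_eq_imp_iff₂]
  constructor
  · intro h b
    rw [← pe_eqb hw h2]
    exact h _ ((mem_reps hw b.1).2 b.2)
  · intro h b hb
    have h3 := reps_lt hb
    have := h ⟨(⟨b.1, by omega⟩, ⟨b.2, h3.2⟩), (mem_reps hw _).1 hb⟩
    rw [← pe_eqb hw h2] at this
    exact this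
open Classical in
lemma sum_ext {M : Type*} [AddCommMonoid M] {ι : Type*} [Fintype ι] [DecidableEq ι] (g : ι → ℕ) (hg : Function.Injective g) (B : Finset ℕ)
    (hB : ∀ i, g i ∉ B) (G : (ℕ → F) → M) :
    ∑ a ∈ sup (univ.image g) B, G a = ∑ s ∈ sup ∅ B, ∑ h : ι → F, G (Function.extend g h s) := by
  rw [← Finset.sum_product']
  symm
  have hne : ∀ p, p ∉ univ.image g → ¬ ∃ i, g i = p := by
    intro p hp h; apply hp; simpa using h
  refine Finset.sum_bij' (fun b _ => Function.extend g b.2 b.1) (fun a _ => (fun p => if p ∈ univ.image g then 0 else a p, a ∘ g)) ?_ ?_ ?_ ?_ ?_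
  · rintro ⟨s, h⟩ hs
    rw [mem_product, mem_sup] at hs
    rw [mem_sup]
    refine ⟨fun p hp => ?_, fun p hp1 hp2 => ?_⟩
    · rw [Function.extend_apply' _ _ _ (by rintro ⟨i, rfl⟩; exact hB i hp)]; exact hs.1.1 p hp
    · simp only
      rw [Function.extend_apply' _ _ _ (hne p hp1)]
      exact hs.1.2 p (by simp) hp2
  · intro a h
    rw [mem_sup] at h
    rw [mem_product, mem_sup]
    refine ⟨⟨fun p hp => ?_, fun p hp1 hp2 => ?_⟩, mem_univ _⟩
    · simp only; rw [if_neg]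
      · exact h.1 p hp
      · intro h2; obtain ⟨i, _, rfl⟩ := mem_image.1 h2; exact hB i hp
    · simp only; split_ifs with h3
      · rfl
      · exact h.2 p h3 hp2
  · rintro ⟨s, h⟩ hs
    rw [mem_product, mem_sup] at hs
    ext p
    · simp only
      split_ifs with h3
      · obtain ⟨i, _, rfl⟩ := mem_image.1 h3
        exact (hs.1.2 _ (by simp) (hB i)).symm
      · rw [Function.extend_apply' _ _ _ (hne p h3)]
    · simp [hg.extend_apply]
  · intro a h
    funext p
    by_cases hp : p ∈ univ.image g
    · obtain ⟨i, _, rfl⟩ := mem_image.1 hp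
      simp [hg.extend_apply]
    · rw [Function.extend_apply' _ _ _ (hne p hp)]; simp only [hp, if_false]
  · rintro ⟨b, t⟩ h
    rfl
/-- normal form attached to the code w and the scalars a -/
noncomputable def Mw (w : ℕ) (hw : Val w) (a : ℕ → F) : Mat F := (piw w hw).MM (sgm w a)
/-- the scalar primes in use -/
def scal (w : ℕ) (B : Finset ℕ) : Prop := (∀ p ∈ B, ∃ k : Fin 7, p = sP k) ∧ ∀ i : Fin 7, wv w i ≠ 7 → sg w i ∈ B
lemma sgm_symm (a : ℕ → F) (i : Fin 7) (hi : (piw w hw).D i) : sgm w a ((piw w hw).w i) = sgm w a i := by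
  have hi' : wv w i ≠ 7 := hi
  unfold sgm
  congr 1
  rw [piw_w hw hi']
  have h3 : wv w (wv w i) = i := (hw i i.2).resolve_left hi'
  have h4 : (i : ℕ) < 7 := i.2
  unfold sg
  simp only [force_eq, cbeq, cble, h3]
  rw [if_neg (by omega), if_neg hi']
  split_ifs
  · congr 1; omega
  · rfl
  · rfl
  · omega
lemma leafW_sound (h2 : (2 : F) ≠ 0) {B : Finset ℕ} (hB : scal w B) {Un nu : ℕ} (hU : Un = ∏ p ∈ B, p) (hn : #B = nu) (e : ℕ) :
    Good ((Fintype.card F : ℤ) - 1) (leafW w Un nu e)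
      ((Fintype.card F : ℤ) ^ e * ∑ s ∈ sup ∅ B, (phi (Mw w hw s : Mat F) : ℤ)) := by
  classical
  unfold leafW
  simp only [force_eq, seqLL_eq]
  let g : (piw w hw).Rs ⊕ (piw w hw).Rs → ℕ := Sum.elim (fun r => yP r.1) (fun r => fP r.1)
  have hup : ∀ r : (piw w hw).Rs, r.1 ∈ upF := fun r => (mem_upF _).2 r.2.1
  have hg : Function.Injective g := by
    rintro (r | r) (s | s) h
    · exact congrArg _ (Subtype.ext ((yP_inj _ (hup r) _ (hup s)).1 h))
    · exact absurd h (yP_inj _ (hup r) _ (hup s)).2.2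
    · exact absurd h.symm (yP_inj _ (hup s) _ (hup r)).2.2
    · exact congrArg _ (Subtype.ext ((yP_inj _ (hup r) _ (hup s)).2.1 h))
  have hgs : ∀ i k, g i ≠ sP (k : Fin 7) := by
    rintro (r | r) k
    · exact (yP_sP _ (hup r) k).1
    · exact (yP_sP _ (hup r) k).2
  have hgB : ∀ i, g i ∉ B := by
    intro i hi
    obtain ⟨k, hk⟩ := hB.1 _ hi
    exact hgs i k hk
  have hgv : ∀ i, g i ∈ vars := by
    rintro (r | r)
    · exact (yP_vars _ (hup r)).1
    · exact (yP_vars _ (hup r)).2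
  have hAv : ∀ p ∈ univ.image g, p ∈ vars := by
    intro p hp; obtain ⟨i, _, rfl⟩ := mem_image.1 hp; exact hgv i
  have hBv : ∀ p ∈ B, p ∈ vars := by
    intro p hp; obtain ⟨k, rfl⟩ := hB.1 p hp; exact sP_vars k
  have hSt : St (univ.image g) B (frP (reps w)) Un (lenR (reps w)) nu := by
    refine ⟨?_, fun p hp => vars_odd (hAv p hp), fun p hp => vars_odd (hBv p hp), ?_, hU, ?_, hn⟩
    · intro p hp; obtain ⟨i, _, rfl⟩ := mem_image.1 hp; exact hgB i
    · rw [frP_eq hw, prod_image hg.injOn, Fintype.prod_sum_type, prod_mul_distrib]; rfl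
    · rw [card_image_of_injective _ hg, lenR_eq hw, Finset.card_univ, Fintype.card_sum]
  have key := runU_sound h2 hSt hAv hBv (eqs w (zT w) (rT (reps w)) (reps w)) e
  convert key using 2
  rw [← Nat.cast_sum]
  congr 1
  unfold Nc
  rw [card_filter, sum_ext g hg B hgB]
  apply sum_congr rfl
  intro s hs
  rw [mem_sup] at hs
  have hsg : ∀ i : Fin 7, sg w i = 1 ∨ (wv w i ≠ 7 ∧ ∃ k : Fin 7, sg w i = sP k) := by
    intro i
    by_cases hi : wv w i = 7
    · left; unfold sg; simp only [force_eq, cbeq, hi, if_true]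
    · right; exact ⟨hi, hB.1 _ (hB.2 i hi)⟩
  have hσe : ∀ h, sgm w (Function.extend g h s) = sgm w s := by
    intro h
    funext i
    unfold sgm
    rcases hsg i with h1 | ⟨_, k, h1⟩
    · rw [h1, ev_one, ev_one]
    · have := vars_odd (sP_vars k)
      rw [h1, ev_odd _ this.1 this.2, ev_odd _ this.1 this.2, Function.extend_apply']
      rintro ⟨i, hi⟩; exact hgs i k hi
  have hσ0 : ∀ i, sgm w s i ≠ 0 := by
    intro i
    unfold sgm
    by_cases hi : wv w i = 7
    · have : sg w i = 1 := by unfold sg; simp only [force_eq, cbeq, hi, if_true]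
      rw [this, ev_one]; exact one_ne_zero
    · have hm := hB.2 i hi
      have := vars_odd (hBv _ hm)
      rw [ev_odd _ this.1 this.2]
      exact hs.1 _ hm
  rw [Mw, PI.phi_MM (piw w hw) h2 (sgm w s) hσ0 (sgm_symm hw s), ← card_filter]
  rw [Nat.card_eq_fintype_card, Fintype.card_subtype]
  symm
  apply Finset.card_bij (fun h _ => (Equiv.sumArrowEquivProdArrow _ _ _) h)
  · intro h hh
    rw [mem_filter] at hh ⊢
    refine ⟨mem_univ _, ?_⟩
    have := (sat_eqs hw h2 _).1 hh.2
    rw [hσe] at this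
    have e1 : ∀ r : (piw w hw).Rs, Function.extend g h s (yP r.1) = h (Sum.inl r) := fun r => hg.extend_apply h s (Sum.inl r)
    have e2 : ∀ r : (piw w hw).Rs, Function.extend g h s (fP r.1) = h (Sum.inr r) := fun r => hg.extend_apply h s (Sum.inr r)
    simp only [e1, e2] at this
    exact this
  · intro h _ h' _ hh; exact (Equiv.injective _ hh)
  · intro z hz
    rw [mem_filter] at hz
    refine ⟨(Equiv.sumArrowEquivProdArrow _ _ _).symm z, ?_, Equiv.apply_symm_apply _ _⟩
    rw [mem_filter]
    refine ⟨mem_univ _, ?_⟩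
    rw [sat_eqs hw h2, hσe]
    set h := (Equiv.sumArrowEquivProdArrow (piw w hw).Rs (piw w hw).Rs F).symm z
    have e1 : ∀ r : (piw w hw).Rs, Function.extend g h s (yP r.1) = h (Sum.inl r) := fun r => hg.extend_apply h s (Sum.inl r)
    have e2 : ∀ r : (piw w hw).Rs, Function.extend g h s (fP r.1) = h (Sum.inr r) := fun r => hg.extend_apply h s (Sum.inr r)
    simp only [e1, e2]
    exact hz.2
end
end SpC

namespace SpC
set_option linter.unusedSectionVars false
open Finset Matrix
section
variable {F : Type*} [Field F] [Fintype F]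
/-- upper triangular -/
def UT (g : Mat F) : Prop := ∀ i j, j < i → g i j = 0
lemma UT.mul_SU {g X : Mat F} (hg : UT g) (hX : SU X) : SU (g * X) := by
  intro i j h
  rw [Matrix.mul_apply]
  apply sum_eq_zero
  intro k _
  rcases lt_or_ge k i with h1 | h1
  · rw [hg i k h1, zero_mul]
  · rw [hX k j (h.trans h1), mul_zero]
lemma SU.mul_UT {g X : Mat F} (hg : UT g) (hX : SU X) : SU (X * g) := by
  intro i j h
  rw [Matrix.mul_apply]
  apply sum_eq_zero
  intro k _
  rcases le_or_gt k i with h1 | h1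
  · rw [hX i k h1, zero_mul]
  · rw [hg k j (h.trans_lt h1), mul_zero]
lemma UT.mul {g h : Mat F} (hg : UT g) (hh : UT h) : UT (g * h) := by
  intro i j hij
  rw [Matrix.mul_apply]
  apply sum_eq_zero
  intro k _
  rcases lt_or_ge k i with h1 | h1
  · rw [hg i k h1, zero_mul]
  · rw [hh k j (hij.trans_le h1), mul_zero]
/-- unipotent upper triangular -/
def Uni (g : Mat F) : Prop := UT g ∧ ∀ i, g i i = 1
lemma Uni.det {g : Mat F} (h : Uni g) : g.det = 1 := by
  rw [Matrix.det_of_isUpperTriangular (fun i j hij => h.1 i j hij)]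
  simp [h.2]
lemma Uni.inv {g : Mat F} (h : Uni g) : UT g⁻¹ ∧ g * g⁻¹ = 1 ∧ g⁻¹ * g = 1 := by
  have hu : IsUnit g.det := by rw [h.det]; exact isUnit_one
  let _ := Matrix.invertibleOfIsUnitDet g hu
  refine ⟨?_, Matrix.mul_nonsing_inv g hu, Matrix.nonsing_inv_mul g hu⟩
  have := Matrix.blockTriangular_inv_of_blockTriangular (M := g) (b := id) (fun i j hij => h.1 i j hij)
  intro i j hij
  exact this hij
lemma stab_conj {g g' S X : Mat F} (h : UT g) (h' : UT g') (e : g * g' = 1) (e' : g' * g = 1) :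
    StabA (gᵀ * S * g) X ↔ StabA S (g * X * g') := by
  unfold StabA
  have et : g'ᵀ * gᵀ = 1 := by rw [← transpose_mul, e, transpose_one]
  have et' : gᵀ * g'ᵀ = 1 := by rw [← transpose_mul, e', transpose_one]
  have key : gᵀ * ((g * X * g')ᵀ * S + S * (g * X * g')) * g = Xᵀ * (gᵀ * S * g) + gᵀ * S * g * X := by
    simp only [transpose_mul, Matrix.mul_add, Matrix.add_mul]
    congr 1
    · simp only [← Matrix.mul_assoc]; rw [et', Matrix.one_mul]
    · simp only [Matrix.mul_assoc]; rw [e', Matrix.mul_one]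
  constructor
  · rintro ⟨h1, h2⟩
    refine ⟨SU.mul_UT h' (UT.mul_SU h h1), ?_⟩
    rw [← key] at h2
    have := congrArg (fun M => g'ᵀ * M * g') h2
    simp only [Matrix.mul_zero, Matrix.zero_mul] at this
    rw [← this]
    simp only [← Matrix.mul_assoc, et, Matrix.one_mul]
    simp only [Matrix.mul_assoc, e, Matrix.mul_one]
  · rintro ⟨h1, h2⟩
    refine ⟨?_, by rw [← key, h2, Matrix.mul_zero, Matrix.zero_mul]⟩
    have := SU.mul_UT h (UT.mul_SU h' h1)
    rwa [← Matrix.mul_assoc, ← Matrix.mul_assoc, e', Matrix.one_mul, Matrix.mul_assoc, e', Matrix.mul_one] at this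
lemma phi_conj {g : Mat F} (hg : Uni g) (S : Mat F) : phi (gᵀ * S * g) = phi S := by
  obtain ⟨h', e, e'⟩ := hg.inv
  set g' := g⁻¹
  have cm : ∀ X Y : Mat F, (g * X * g') * (g * Y * g') = g * (X * Y) * g' := by
    intro X Y
    calc (g * X * g') * (g * Y * g') = g * X * (g' * g) * Y * g' := by simp only [Matrix.mul_assoc]
      _ = _ := by rw [e', Matrix.mul_one]; simp only [Matrix.mul_assoc]
  have cm' : ∀ X Y : Mat F, (g' * X * g) * (g' * Y * g) = g' * (X * Y) * g := by
    intro X Y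
    calc (g' * X * g) * (g' * Y * g) = g' * X * (g * g') * Y * g := by simp only [Matrix.mul_assoc]
      _ = _ := by rw [e, Matrix.mul_one]; simp only [Matrix.mul_assoc]
  have i1 : ∀ X : Mat F, g' * (g * X * g') * g = X := by
    intro X
    calc g' * (g * X * g') * g = (g' * g) * X * (g' * g) := by simp only [Matrix.mul_assoc]
      _ = _ := by rw [e', Matrix.mul_one, Matrix.one_mul]
  have i2 : ∀ X : Mat F, g * (g' * X * g) * g' = X := by
    intro X
    calc g * (g' * X * g) * g' = (g * g') * X * (g * g') := by simp only [Matrix.mul_assoc]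
      _ = _ := by rw [e, Matrix.mul_one, Matrix.one_mul]
  unfold phi
  apply Nat.card_congr
  refine ⟨fun z => ⟨(g * z.1.1 * g', g * z.1.2 * g'), (stab_conj hg.1 h' e e').1 z.2.1, (stab_conj hg.1 h' e e').1 z.2.2.1, by
      simp only [cm, z.2.2.2]⟩,
    fun z => ⟨(g' * z.1.1 * g, g' * z.1.2 * g), ?_, ?_, by simp only [cm', z.2.2.2]⟩, ?_, ?_⟩
  · rw [stab_conj hg.1 h' e e', i2]; exact z.2.1
  · rw [stab_conj hg.1 h' e e', i2]; exact z.2.2.1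
  · intro z; simp only [i1]
  · intro z; simp only [i2]
open Classical in
/-- symmetric matrices supported on I -/
noncomputable def SI (I : Finset (Fin 7)) : Finset (Mat F) := {S | (∀ a b, S a b = S b a) ∧ ∀ a b, a ∉ I → S a b = 0}
lemma mem_SI {I : Finset (Fin 7)} {S : Mat F} : S ∈ SI I ↔ (∀ a b, S a b = S b a) ∧ ∀ a b, a ∉ I → S a b = 0 := by
  simp [SI]
open Classical in
/-- vectors supported on I -/
noncomputable def VI (I : Finset (Fin 7)) : Finset (Fin 7 → F) := Fintype.piFinset (fun k => if k ∈ I then univ else {0})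
lemma mem_VI {I : Finset (Fin 7)} {t : Fin 7 → F} : t ∈ VI I ↔ ∀ k, k ∉ I → t k = 0 := by
  rw [VI, Fintype.mem_piFinset]
  apply forall_congr'
  intro k
  by_cases h : k ∈ I <;> simp [h]
lemma card_VI (I : Finset (Fin 7)) : #(VI I : Finset (Fin 7 → F)) = Fintype.card F ^ #I := by
  rw [VI, Fintype.card_piFinset]
  simp only [apply_ite Finset.card, Finset.card_univ, card_singleton]
  rw [Finset.prod_ite]; simp
/-- quadratic block -/
def blk (i j : Fin 7) (c : F) : Mat F := fun a b => if i = j then (if a = i ∧ b = i then c else 0) else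
  (if (a = i ∧ b = j) ∨ (a = j ∧ b = i) then c else 0)
/-- rank one form -/
def qii (i : Fin 7) (c : F) (t : Fin 7 → F) (S : Mat F) : Mat F := fun a b =>
  c * ((Pi.single i 1 : Fin 7 → F) + t) a * ((Pi.single i 1 : Fin 7 → F) + t) b + S a b
/-- rank two form -/
def qij (i j : Fin 7) (c : F) (u v : Fin 7 → F) (S : Mat F) : Mat F := fun a b =>
  c * (((Pi.single i 1 : Fin 7 → F) + u) a * ((Pi.single j 1 : Fin 7 → F) + v) b + ((Pi.single j 1 : Fin 7 → F) + v) a * ((Pi.single i 1 : Fin 7 → F) + u) b) + S a b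
section
variable {i : Fin 7} {I : Finset (Fin 7)} (hi : ∀ k ∈ I, i < k) {M0 : Mat F}
  (hM : ∀ a ∈ insert i I, ∀ b, M0 a b = 0 ∧ M0 b a = 0)
include hi hM
lemma phi_ii (c : F) {t : Fin 7 → F} (ht : t ∈ VI I) {S : Mat F} (hS : S ∈ SI I) :
    phi (M0 + qii i c t S) = phi (M0 + blk i i c + S) := by
  rw [mem_VI] at ht
  rw [mem_SI] at hS
  have hiI : i ∉ I := fun h => lt_irrefl _ (hi i h)
  let g : Mat F := 1 + vecMulVec (Pi.single i 1) t
  have hg : Uni g := by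
    refine ⟨fun a b hab => ?_, fun a => ?_⟩
    · change (1 : Mat F) a b + (Pi.single i 1 : Fin 7 → F) a * t b = 0
      rw [Matrix.one_apply_ne hab.ne', zero_add]
      by_cases ha : a = i
      · subst ha
        rw [ht b (fun h => absurd (hi b h) (not_lt.2 hab.le)), mul_zero]
      · rw [Pi.single_eq_of_ne ha, zero_mul]
    · change (1 : Mat F) a a + (Pi.single i 1 : Fin 7 → F) a * t a = 1
      rw [Matrix.one_apply_eq]
      by_cases ha : a = i
      · rw [ha, ht i hiI, mul_zero, add_zero]
      · rw [Pi.single_eq_of_ne ha, zero_mul, add_zero]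
  rw [← phi_conj hg (M0 + blk i i c + S)]
  congr 1
  have fixr : ∀ N : Mat F, (∀ a, N a i = 0) → N * g = N := by
    intro N h
    rw [Matrix.mul_add, Matrix.mul_one, Matrix.mul_vecMulVec, Matrix.mulVec_single_one]
    ext a b; simp [vecMulVec_apply, h]
  have fixl : ∀ N : Mat F, (∀ a, N i a = 0) → gᵀ * N = N := by
    intro N h
    have := fixr Nᵀ h
    rw [← transpose_transpose (gᵀ * N), transpose_mul, transpose_transpose, this, transpose_transpose]
  have hgi : g.row i = Pi.single i 1 + t := by
    funext b
    change (1 : Mat F) i b + (Pi.single i 1 : Fin 7 → F) i * t b = (Pi.single i 1 : Fin 7 → F) b + t b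
    rw [Pi.single_eq_same, one_mul, Matrix.one_apply, Pi.single_apply]; simp only [eq_comm]
  clear_value g
  rw [Matrix.mul_add, Matrix.add_mul, Matrix.mul_add, Matrix.add_mul, fixl M0 (fun a => (hM i (by simp) a).1),
    fixr M0 (fun a => (hM i (by simp) a).2), fixl S (fun a => hS.2 i a hiI), fixr S (fun a => by rw [hS.1]; exact hS.2 i a hiI), add_assoc]
  congr 1
  ext a b
  rw [Matrix.add_apply]
  refine congrArg (· + S a b) ?_
  have hb : blk i i c = c • vecMulVec (Pi.single i 1) (Pi.single i (1 : F)) := by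
    ext a b
    simp only [blk, Matrix.smul_apply, vecMulVec_apply, Pi.single_apply, if_true, smul_eq_mul]
    by_cases ha : a = i <;> by_cases hb : b = i <;> simp [ha, hb]
  rw [hb, Matrix.mul_smul, Matrix.smul_mul, Matrix.mul_vecMulVec, Matrix.vecMulVec_mul, Matrix.mulVec_transpose,
    Matrix.single_one_vecMul, Matrix.smul_apply, vecMulVec_apply, smul_eq_mul, hgi, mul_assoc]
lemma phi_ij (c : F) {j : Fin 7} (hj : j ∈ I) {u v : Fin 7 → F} (hu : u ∈ VI I) (hv : v ∈ VI {k ∈ I | j < k}) {S : Mat F} (hS : S ∈ SI (I.erase j)) :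
    phi (M0 + qij i j c u v S) = phi (M0 + blk i j c + S) := by
  rw [mem_VI] at hu hv
  rw [mem_SI] at hS
  have hiI : i ∉ I := fun h => lt_irrefl _ (hi i h)
  have hij : i ≠ j := fun h => hiI (h ▸ hj)
  let g : Mat F := 1 + vecMulVec (Pi.single i 1) u + vecMulVec (Pi.single j 1) v
  have gap : ∀ a b, g a b = (1 : Mat F) a b + (Pi.single i 1 : Fin 7 → F) a * u b + (Pi.single j 1 : Fin 7 → F) a * v b := fun a b => rfl
  have hg : Uni g := by
    refine ⟨fun a b hab => ?_, fun a => ?_⟩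
    · rw [gap, Matrix.one_apply_ne hab.ne', zero_add]
      by_cases ha : a = i
      · subst ha
        rw [hu b (fun h => absurd (hi b h) (not_lt.2 hab.le)), mul_zero, Pi.single_eq_of_ne hij]; simp
      · rw [Pi.single_eq_of_ne ha, zero_mul, zero_add]
        by_cases ha : a = j
        · subst ha
          rw [hv b (fun h => absurd (mem_filter.1 h).2 (not_lt.2 hab.le)), mul_zero]
        · rw [Pi.single_eq_of_ne ha, zero_mul]
    · rw [gap, Matrix.one_apply_eq]
      by_cases ha : a = i
      · rw [ha, hu i hiI, mul_zero, add_zero, Pi.single_eq_of_ne hij]; simp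
      · rw [Pi.single_eq_of_ne ha, zero_mul, add_zero]
        by_cases ha : a = j
        · rw [ha, hv j (by simp), mul_zero, add_zero]
        · rw [Pi.single_eq_of_ne ha, zero_mul, add_zero]
  rw [← phi_conj hg (M0 + blk i j c + S)]
  congr 1
  have fixr : ∀ N : Mat F, (∀ a, N a i = 0) → (∀ a, N a j = 0) → N * g = N := by
    intro N h h'
    rw [Matrix.mul_add, Matrix.mul_add, Matrix.mul_one, Matrix.mul_vecMulVec, Matrix.mulVec_single_one, Matrix.mul_vecMulVec, Matrix.mulVec_single_one]
    ext a b; simp [vecMulVec_apply, h, h']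
  have fixl : ∀ N : Mat F, (∀ a, N i a = 0) → (∀ a, N j a = 0) → gᵀ * N = N := by
    intro N h h'
    have := fixr Nᵀ h h'
    rw [← transpose_transpose (gᵀ * N), transpose_mul, transpose_transpose, this, transpose_transpose]
  have hiE : i ∉ I.erase j := fun h => hiI (mem_of_mem_erase h)
  have hgi : g.row i = Pi.single i 1 + u := by
    funext b
    rw [row_apply, gap, Pi.single_eq_same, one_mul, Pi.single_eq_of_ne hij, Matrix.one_apply, Pi.add_apply, Pi.single_apply]; simp [eq_comm]
  have hgj : g.row j = Pi.single j 1 + v := by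
    funext b
    rw [row_apply, gap, Pi.single_eq_same, one_mul, Pi.single_eq_of_ne hij.symm, Matrix.one_apply, Pi.add_apply, Pi.single_apply]; simp [eq_comm]
  clear_value g
  rw [Matrix.mul_add, Matrix.add_mul, Matrix.mul_add, Matrix.add_mul, fixl M0 (fun a => (hM i (by simp) a).1) (fun a => (hM j (by simp [hj]) a).1),
    fixr M0 (fun a => (hM i (by simp) a).2) (fun a => (hM j (by simp [hj]) a).2),
    fixl S (fun a => hS.2 i a hiE) (fun a => hS.2 j a (by simp)),
    fixr S (fun a => by rw [hS.1]; exact hS.2 i a hiE) (fun a => by rw [hS.1]; exact hS.2 j a (by simp)), add_assoc]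
  congr 1
  ext a b
  rw [Matrix.add_apply]
  refine congrArg (· + S a b) ?_
  have hb : blk i j c = c • (vecMulVec (Pi.single i 1) (Pi.single j (1 : F)) + vecMulVec (Pi.single j 1) (Pi.single i (1 : F))) := by
    ext a b
    simp only [blk, Matrix.smul_apply, Matrix.add_apply, vecMulVec_apply, Pi.single_apply, hij, if_false, smul_eq_mul]
    by_cases ha : a = i
    · subst ha
      by_cases hb : b = j <;> simp [hb, hij]
    · by_cases hb : a = j <;> by_cases hb' : b = i <;> simp [hb, hb', ha, hij, hij.symm]
  rw [hb, Matrix.mul_smul, Matrix.smul_mul, Matrix.mul_add, Matrix.add_mul, Matrix.mul_vecMulVec, Matrix.vecMulVec_mul, Matrix.mulVec_transpose,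
    Matrix.mul_vecMulVec, Matrix.vecMulVec_mul, Matrix.mulVec_transpose,
    Matrix.single_one_vecMul, Matrix.single_one_vecMul, Matrix.smul_apply, Matrix.add_apply, vecMulVec_apply, vecMulVec_apply, smul_eq_mul, hgi, hgj]
end
end
end SpC

namespace SpC
set_option linter.unusedSectionVars false
open Finset Matrix
section
variable {F : Type*} [Field F] [Fintype F]
variable {i : Fin 7} {I : Finset (Fin 7)} (hi : ∀ k ∈ I, i < k)
include hi
open Classical in
lemma sum_ii (G : Mat F → ℤ) : ∑ S ∈ SI (insert i I) with S i i ≠ 0, G S =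
    ∑ z ∈ ((univ.filter (fun c : F => c ≠ 0)) ×ˢ VI I ×ˢ SI I), G (qii i z.1 z.2.1 z.2.2) := by
  have hiI : i ∉ I := fun h => lt_irrefl _ (hi i h)
  symm
  refine sum_bij' (fun z _ => qii i z.1 z.2.1 z.2.2)
    (fun S _ => (S i i, fun k => if k = i then 0 else S i k / S i i, Matrix.of fun a b => S a b - S i a * S i b / S i i)) ?_ ?_ ?_ ?_ (fun _ _ => rfl)
  · rintro ⟨c, t, S⟩ h
    simp only [mem_product, mem_filter, mem_univ, true_and, mem_VI, mem_SI] at h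
    obtain ⟨h1, h2, h3, h4⟩ := h
    rw [mem_filter, mem_SI]
    refine ⟨⟨fun a b => ?_, fun a b hab => ?_⟩, ?_⟩
    · simp only [qii]; rw [h3 a b]; ring
    · rw [mem_insert, not_or] at hab
      simp [qii, Pi.single_eq_of_ne hab.1, h2 a hab.2, h4 a b hab.2]
    · simpa [qii, h2 i hiI, h4 i _ hiI] using h1
  · intro S h
    rw [mem_filter, mem_SI] at h
    obtain ⟨⟨h1, h2⟩, h3⟩ := h
    simp only [mem_product, mem_filter, mem_univ, true_and, mem_VI, mem_SI, Matrix.of_apply]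
    refine ⟨h3, fun k hk => ?_, fun a b => ?_, fun a b ha => ?_⟩
    · split_ifs with h
      · rfl
      · rw [h1, h2 k i (by simp [h, hk]), zero_div]
    · rw [h1 a b]; ring
    · by_cases h : a = i
      · subst h; field_simp; ring
      · rw [h1 i a, h2 a i (by simp [h, ha]), h2 a b (by simp [h, ha])]; ring
  · rintro ⟨c, t, S⟩ h
    simp only [mem_product, mem_filter, mem_univ, true_and, mem_VI, mem_SI] at h
    obtain ⟨h1, h2, h3, h4⟩ := h
    have e1 : qii i c t S i i = c := by simp [qii, h2 i hiI, h4 i _ hiI]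
    have e2 : ∀ k, qii i c t S i k = c * ((Pi.single i 1 : Fin 7 → F) + t) k := fun k => by simp [qii, h2 i hiI, h4 i _ hiI]
    simp only [e1, Prod.mk.injEq, true_and]
    refine ⟨?_, ?_⟩
    · funext k
      split_ifs with h
      · rw [h, h2 i hiI]
      · rw [e2]; simp [h, h1]
    · ext a b
      rw [Matrix.of_apply, e2, e2]
      simp only [qii]
      field_simp; ring
  · intro S h
    rw [mem_filter, mem_SI] at h
    obtain ⟨⟨h1, h2⟩, h3⟩ := h
    have : ((Pi.single i 1 : Fin 7 → F) + (fun k => if k = i then 0 else S i k / S i i)) = fun k => S i k / S i i := by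
      funext k
      by_cases h : k = i
      · subst h; simp [h3]
      · simp [h]
    ext a b
    simp only [qii, this, Matrix.of_apply]
    field_simp; ring
open Classical in
lemma sum_ij (h2F : (2 : F) ≠ 0) {j : Fin 7} (hj : j ∈ I) (G : Mat F → ℤ) : ∑ S ∈ SI (insert i I) with S i j ≠ 0 ∧ ∀ k < j, S i k = 0, G S =
    ∑ z ∈ ((univ.filter (fun c : F => c ≠ 0)) ×ˢ VI I ×ˢ VI {k ∈ I | j < k} ×ˢ SI (I.erase j)), G (qij i j z.1 z.2.1 z.2.2.1 z.2.2.2) := by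
  have hiI : i ∉ I := fun h => lt_irrefl _ (hi i h)
  have hij : i < j := hi j hj
  have hiE : i ∉ I.erase j := fun h => hiI (mem_of_mem_erase h)
  have hjE : j ∉ I.erase j := by simp
  symm
  refine sum_bij' (fun z _ => qij i j z.1 z.2.1 z.2.2.1 z.2.2.2)
    (fun S _ => (S i j, fun k => if k = i then 0 else (S j k - S j j / (2 * S i j) * S i k) / S i j, fun k => if k = j then 0 else S i k / S i j,
      Matrix.of fun a b => S a b - S i j * (((S j a - S j j / (2 * S i j) * S i a) / S i j) * (S i b / S i j) + (S i a / S i j) * ((S j b - S j j / (2 * S i j) * S i b) / S i j)))) ?_ ?_ ?_ ?_ (fun _ _ => rfl)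
  · rintro ⟨c, u, v, S⟩ h
    simp only [mem_product, mem_filter, mem_univ, true_and, mem_VI, mem_SI] at h
    obtain ⟨h1, hu, hv, h3, h4⟩ := h
    rw [mem_filter, mem_SI]
    have hvi : v i = 0 := hv i (fun h => hiI h.1)
    refine ⟨⟨fun a b => ?_, fun a b hab => ?_⟩, ?_, ?_⟩
    · simp only [qij]; rw [h3 a b]; ring
    · rw [mem_insert, not_or] at hab
      have haj : a ≠ j := fun h => hab.2 (h ▸ hj)
      simp [qij, Pi.single_eq_of_ne hab.1, Pi.single_eq_of_ne haj, hu a hab.2, hv a (fun h => hab.2 h.1), h4 a b (fun h => hab.2 (mem_of_mem_erase h))]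
    · simpa [qij, hu i hiI, hvi, hv j, h4 i _ hiE, Pi.single_eq_of_ne hij.ne] using h1
    · intro k hk
      simp [qij, hvi, hu i hiI, Pi.single_eq_of_ne hij.ne, hv k (fun h => absurd h.2 (not_lt.2 hk.le)), h4 i _ hiE, Pi.single_eq_of_ne hk.ne]
  · intro S h
    rw [mem_filter, mem_SI] at h
    obtain ⟨⟨h1, h2⟩, h3, h5⟩ := h
    have hii := h5 i hij
    simp only [mem_product, mem_filter, mem_univ, true_and, mem_VI, mem_SI, Matrix.of_apply]
    refine ⟨h3, fun k hk => ?_, fun k hk => ?_, fun a b => ?_, fun a b ha => ?_⟩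
    · split_ifs with h
      · rfl
      · rw [h1 j k, h1 i k, h2 k _ (by simp [h, hk]), h2 k _ (by simp [h, hk])]; simp
    · split_ifs with h
      · rfl
      · have : S i k = 0 := by
          rcases lt_or_gt_of_ne h with h' | h'
          · exact h5 k h'
          · rw [h1]; apply h2; rw [mem_insert, not_or]; exact ⟨fun h'' => by subst h''; exact absurd hij (not_lt.2 h'.le), fun h'' => hk ⟨h'', h'⟩⟩
        rw [this, zero_div]
    · rw [h1 a b]; ring
    · by_cases h : a = i
      · subst h; rw [hii, h1 j a]; field_simp; ring
      · by_cases h' : a = j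
        · subst h'; field_simp; ring
        · have : a ∉ insert i I := by simp only [mem_insert, not_or]; exact ⟨h, fun h'' => ha (mem_erase.2 ⟨h', h''⟩)⟩
          rw [h1 j a, h1 i a, h2 a _ this, h2 a _ this, h2 a _ this]; ring
  · rintro ⟨c, u, v, S⟩ h
    simp only [mem_product, mem_filter, mem_univ, true_and, mem_VI, mem_SI] at h
    obtain ⟨h1, hu, hv, h3, h4⟩ := h
    have hvi : v i = 0 := hv i (fun h => hiI h.1)
    have hvj : v j = 0 := hv j (fun h => lt_irrefl _ h.2)
    have e1 : qij i j c u v S i j = c := by simp [qij, hu i hiI, hvi, hvj, h4 i _ hiE, Pi.single_eq_of_ne hij.ne]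
    have e2 : ∀ k, qij i j c u v S i k = c * ((Pi.single j 1 : Fin 7 → F) + v) k := fun k => by
      simp [qij, hu i hiI, hvi, h4 i _ hiE, Pi.single_eq_of_ne hij.ne]
    have e3 : ∀ k, qij i j c u v S j k = c * (u j * ((Pi.single j 1 : Fin 7 → F) + v) k + ((Pi.single i 1 : Fin 7 → F) + u) k) := fun k => by
      simp [qij, hvj, h4 j _ hjE, Pi.single_eq_of_ne hij.ne']
    have e4 : qij i j c u v S j j = 2 * c * u j := by rw [e3]; simp [hvj, Pi.single_eq_of_ne hij.ne']; ring
    have e5 : ∀ k, (qij i j c u v S j k - qij i j c u v S j j / (2 * c) * qij i j c u v S i k) / c = ((Pi.single i 1 : Fin 7 → F) + u) k := by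
      intro k
      rw [e4, e3, e2]; field_simp; ring
    simp only [e1, e5, Prod.mk.injEq, true_and]
    refine ⟨?_, ?_, ?_⟩
    · funext k
      split_ifs with h
      · rw [h, hu i hiI]
      · simp [h]
    · funext k
      split_ifs with h
      · rw [h, hvj]
      · rw [e2]; simp [h, h1]
    · ext a b
      rw [Matrix.of_apply, e2, e2]
      simp only [qij]
      field_simp; ring
  · intro S h
    rw [mem_filter, mem_SI] at h
    obtain ⟨⟨h1, h2⟩, h3, h5⟩ := h
    have hii := h5 i hij
    have ex : ((Pi.single i 1 : Fin 7 → F) + (fun k => if k = i then 0 else (S j k - S j j / (2 * S i j) * S i k) / S i j)) = fun k => (S j k - S j j / (2 * S i j) * S i k) / S i j := by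
      funext k
      by_cases h : k = i
      · subst h; simp [hii, h1 j k, h3]
      · simp [h]
    have ey : ((Pi.single j 1 : Fin 7 → F) + (fun k => if k = j then 0 else S i k / S i j)) = fun k => S i k / S i j := by
      funext k
      by_cases h : k = j
      · subst h; simp [h3]
      · simp [h]
    ext a b
    simp only [qij, ex, ey, Matrix.of_apply]
    ring
open Classical in
lemma sum_part (G : Mat F → ℤ) : ∑ S ∈ SI (insert i I), G S = ∑ S ∈ SI I, G S + (∑ S ∈ SI (insert i I) with S i i ≠ 0, G S +
    ∑ j ∈ I, ∑ S ∈ SI (insert i I) with S i j ≠ 0 ∧ ∀ k < j, S i k = 0, G S) := by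
  have hiI : i ∉ I := fun h => lt_irrefl _ (hi i h)
  have hm : ∀ S ∈ SI (F := F) (insert i I), (univ.filter (fun k => S i k ≠ 0)).min ∈ insert (⊤ : WithTop (Fin 7)) (Finset.image (WithTop.some : Fin 7 → WithTop (Fin 7)) (insert i I)) := by
    intro S hS
    rw [mem_SI] at hS
    cases h : (univ.filter (fun k => S i k ≠ 0)).min with
    | top => simp
    | coe k =>
      have := mem_of_min h
      rw [mem_filter] at this
      apply mem_insert_of_mem
      apply mem_image_of_mem
      by_contra hk
      exact this.2 (by rw [hS.1]; exact hS.2 k i hk)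
  have hc : ∀ (S : Mat F) (j : Fin 7), (univ.filter (fun k => S i k ≠ 0)).min = (j : WithTop (Fin 7)) ↔ S i j ≠ 0 ∧ ∀ k < j, S i k = 0 := by
    intro S j
    constructor
    · intro h
      refine ⟨(mem_filter.1 (mem_of_min h)).2, fun k hk => ?_⟩
      by_contra h'
      have := min_le_of_eq (s := univ.filter (fun k => S i k ≠ 0)) (b := k) (by simp [h']) h
      exact absurd hk (not_lt.2 this)
    · rintro ⟨h1, h2⟩
      apply le_antisymm
      · exact Finset.min_le (by simp [h1])
      · apply Finset.le_min
        intro k hk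
        rw [mem_filter] at hk
        rw [WithTop.coe_le_coe]
        by_contra h'
        exact hk.2 (h2 k (not_le.1 h'))
  rw [← sum_fiberwise_of_maps_to hm, sum_insert (by simp), sum_image (by intro a _ b _ h; exact WithTop.coe_injective h), sum_insert hiI]
  congr 1
  · apply sum_congr _ (fun _ _ => rfl)
    ext S
    rw [mem_filter, mem_SI, mem_SI, Finset.min_eq_top, filter_eq_empty_iff]
    simp only [mem_univ, forall_true_left, not_not, mem_insert, not_or]
    constructor
    · rintro ⟨⟨h1, h2⟩, h3⟩
      refine ⟨h1, fun a b ha => ?_⟩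
      by_cases h : a = i
      · rw [h]; exact @h3 b
      · exact h2 a b ⟨h, ha⟩
    · rintro ⟨h1, h2⟩
      exact ⟨⟨h1, fun a b h => h2 a b h.2⟩, fun {k} => h2 i k hiI⟩
  congr 1
  · apply sum_congr _ (fun _ _ => rfl)
    ext S
    rw [mem_filter, mem_filter, hc]
    apply and_congr_right
    intro hS
    rw [mem_SI] at hS
    refine ⟨fun h => h.1, fun h => ⟨h, fun k hk => ?_⟩⟩
    rw [hS.1]; apply hS.2
    rw [mem_insert, not_or]
    exact ⟨hk.ne, fun h => absurd (hi k h) (not_lt.2 hk.le)⟩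
  · apply sum_congr rfl
    intro j _
    apply sum_congr _ (fun _ _ => rfl)
    ext S
    rw [mem_filter, mem_filter, hc]
open Classical in
lemma recur (h2F : (2 : F) ≠ 0) {M0 : Mat F} (hM : ∀ a ∈ insert i I, ∀ b, M0 a b = 0 ∧ M0 b a = 0) :
    ∑ S ∈ SI (insert i I), (phi (M0 + S) : ℤ) = ∑ S ∈ SI I, (phi (M0 + S) : ℤ) +
     ((Fintype.card F : ℤ) ^ #I * (∑ c : F with c ≠ 0, ∑ S ∈ SI I, (phi (M0 + blk i i c + S) : ℤ)) +
     ∑ j ∈ I, (Fintype.card F : ℤ) ^ (#I + #{k ∈ I | j < k}) * (∑ c : F with c ≠ 0, ∑ S ∈ SI (I.erase j), (phi (M0 + blk i j c + S) : ℤ))) := by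
  rw [sum_part hi, sum_ii hi]
  congr 1
  congr 1
  · rw [sum_product, mul_sum]
    apply sum_congr rfl
    intro c _
    rw [sum_product]
    have : ∀ t ∈ VI (F := F) I, ∑ S ∈ SI I, (phi (M0 + qii i c t S) : ℤ) = ∑ S ∈ SI I, (phi (M0 + blk i i c + S) : ℤ) := by
      intro t ht
      apply sum_congr rfl
      intro S hS
      rw [phi_ii hi hM c ht hS]
    simp only
    rw [sum_congr rfl this, sum_const, card_VI]; simp
  · apply sum_congr rfl
    intro j hj
    rw [sum_ij hi h2F hj, sum_product, mul_sum]
    apply sum_congr rfl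
    intro c _
    rw [sum_product]
    have : ∀ u ∈ VI (F := F) I, ∑ z ∈ VI {k ∈ I | j < k} ×ˢ SI (I.erase j), (phi (M0 + qij i j c u z.1 z.2) : ℤ) =
        (Fintype.card F : ℤ) ^ #{k ∈ I | j < k} * ∑ S ∈ SI (I.erase j), (phi (M0 + blk i j c + S) : ℤ) := by
      intro u hu
      rw [sum_product]
      have : ∀ v ∈ VI (F := F) {k ∈ I | j < k}, ∑ S ∈ SI (I.erase j), (phi (M0 + qij i j c u v S) : ℤ) = ∑ S ∈ SI (I.erase j), (phi (M0 + blk i j c + S) : ℤ) := by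
        intro v hv
        apply sum_congr rfl
        intro S hS
        rw [phi_ij hi hM c hj hu hv hS]
      simp only
      rw [sum_congr rfl this, sum_const, card_VI]; simp
    simp only
    rw [sum_congr rfl this, sum_const, card_VI, pow_add]; simp; ring
end
end SpC

namespace SpC
set_option linter.unusedSectionVars false
open Finset Matrix
lemma wv_tb (w k b : ℕ) : (wv w k).testBit b = (decide (b < 3) && w.testBit (3 * k + b)) := by
  have : wv w k = (w >>> (3 * k)) % 2 ^ 3 := by
    rw [← Nat.and_two_pow_sub_one_eq_mod]; rfl
  rw [this, Nat.testBit_mod_two_pow, Nat.testBit_shiftRight]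
lemma wv_setw {w i j k : ℕ} (h7 : wv w i = 7) (hj : j ≤ 7) : wv (setw w i j) k = if k = i then j else wv w k := by
  apply Nat.eq_of_testBit_eq
  intro b
  have e : (setw w i j).testBit (3 * k + b) = (w.testBit (3 * k + b) ^^ (decide (3 * k + b ≥ 3 * i) && (7 - j).testBit (3 * k + b - 3 * i))) := by
    change (w ^^^ ((7 - j) <<< (3 * i))).testBit _ = _
    rw [Nat.testBit_xor, Nat.testBit_shiftLeft]
  rw [wv_tb, e]
  by_cases hk : k = i
  · subst hk
    rw [if_pos rfl]
    have h1 := wv_tb w k b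
    rw [h7] at h1
    by_cases hb : b < 3
    · have h2 : (7 : ℕ).testBit b = true := by interval_cases b <;> rfl
      rw [h2] at h1
      simp only [hb, decide_true, Bool.true_and] at h1 ⊢
      rw [← h1, Nat.add_sub_cancel_left]
      interval_cases b <;> interval_cases j <;> simp <;> rfl
    · simp only [hb, decide_false, Bool.false_and]
      symm
      apply Nat.testBit_lt_two_pow
      calc j < 2 ^ 3 := by omega
        _ ≤ 2 ^ b := Nat.pow_le_pow_right (by norm_num) (by omega)
  · rw [if_neg hk, wv_tb]
    by_cases hb : b < 3
    · have : (decide (3 * k + b ≥ 3 * i) && (7 - j).testBit (3 * k + b - 3 * i)) = false := by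
        by_cases h : 3 * k + b ≥ 3 * i
        · rw [Nat.testBit_lt_two_pow, Bool.and_false]
          calc 7 - j < 2 ^ 3 := by omega
            _ ≤ 2 ^ (3 * k + b - 3 * i) := Nat.pow_le_pow_right (by norm_num) (by omega)
        · simp [h]
      rw [this, Bool.xor_false]
    · simp [hb]
section
variable {F : Type*} [Field F] [Fintype F]
lemma sg_eq (w i : ℕ) : sg w i = if wv w i = 7 then 1 else if i ≤ wv w i then sP (wv w i) else sP i := by
  unfold sg; rw [force_eq, cbeq, cble]
lemma Mw_apply {w : ℕ} (hw : Val w) (a : ℕ → F) (x y : Fin 7) : Mw w hw a x y = if wv w x = y then ev a (sg w x) else 0 := by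
  classical
  unfold Mw PI.MM sgm
  by_cases h : wv w x = 7
  · rw [if_neg (fun h' => h'.1 h), if_neg]
    have := y.2; omega
  · congr 1
    have h2 := piw_w hw h
    apply propext
    constructor
    · rintro ⟨_, h'⟩; rw [h', h2]
    · intro h'; exact ⟨h, Fin.ext (by rw [h2, h'])⟩
section
variable {w w' : ℕ} {i j : Fin 7} (hij : i ≤ j) (h7i : wv w i = 7) (h7j : wv w j = 7)
  (H : ∀ k, wv w' k = if k = i then (j : ℕ) else if k = j then (i : ℕ) else wv w k)
include h7i h7j H
lemma upd_val (hw : Val w) : Val w' := by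
  intro k hk
  have hi := i.2
  have hj := j.2
  rw [H k]
  by_cases h1 : k = i
  · right; rw [if_pos h1, H j]
    by_cases h2 : (j : ℕ) = i
    · rw [if_pos h2]; omega
    · rw [if_neg h2, if_pos rfl, h1]
  · rw [if_neg h1]
    by_cases h2 : k = j
    · right; rw [if_pos h2, H i, if_pos rfl, h2]
    · rw [if_neg h2]
      rcases hw k hk with h | h
      · left; exact h
      · by_cases h3 : wv w k = 7
        · left; exact h3
        · right
          rw [H, if_neg, if_neg, h]
          · intro h4; rw [h4, h7j] at h; omega
          · intro h4; rw [h4, h7i] at h; omega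
include hij
lemma upd_sg (k : ℕ) : sg w' k = if k = i ∨ k = j then sP j else sg w k := by
  have hi := i.2
  have hj := j.2
  have hij' : (i : ℕ) ≤ j := hij
  rw [sg_eq, sg_eq, H k]
  by_cases h1 : k = i
  · rw [if_pos h1, if_pos (Or.inl h1), if_neg (by omega), if_pos (by omega)]
  · rw [if_neg h1]
    by_cases h2 : k = j
    · rw [if_pos h2, if_pos (Or.inr h2), if_neg (by omega), if_neg (by omega), h2]
    · rw [if_neg h2, if_neg (show ¬ (k = (i : ℕ) ∨ k = j) by omega)]
lemma upd_scal {B : Finset ℕ} (hB : scal w B) : scal w' (insert (sP j) B) := by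
  refine ⟨?_, ?_⟩
  · intro p hp
    rcases mem_insert.1 hp with h | h
    · exact ⟨j, h⟩
    · exact hB.1 p h
  · intro k hk
    rw [upd_sg hij h7i h7j H]
    split_ifs with h
    · simp
    · apply mem_insert_of_mem; apply hB.2
      rw [H] at hk
      rw [not_or] at h
      rwa [if_neg h.1, if_neg h.2] at hk
lemma upd_Mw (hw : Val w) (hw' : Val w') {B : Finset ℕ} (hB : scal w B) (hjB : sP j ∉ B) (b : ℕ → F) (c : F) :
    Mw w' hw' (Function.update b (sP j) c) = Mw w hw b + blk i j c := by
  have hi := i.2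
  have hj := j.2
  have evp : ∀ (a : ℕ → F) (k : Fin 7), ev a (sP k) = a (sP k) := fun a k => ev_odd a (vars_odd (sP_vars k)).1 (vars_odd (sP_vars k)).2
  ext x y
  have hx := x.2
  have hy := y.2
  rw [Matrix.add_apply, Mw_apply, Mw_apply, upd_sg hij h7i h7j H, H]
  simp only [blk]
  by_cases h1 : x = i
  · subst h1
    rw [if_pos rfl, h7i, if_pos (Or.inl rfl), evp, Function.update_self, if_neg (by omega : ¬ 7 = (y : ℕ)), zero_add]
    simp only [Fin.ext_iff]
    grind
  · have h1' : ¬ (x : ℕ) = i := fun h => h1 (Fin.ext h)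
    rw [if_neg h1']
    by_cases h2 : x = j
    · subst h2
      rw [if_pos rfl, h7j, if_pos (Or.inr rfl), evp, Function.update_self, if_neg (by omega : ¬ 7 = (y : ℕ)), zero_add]
      simp only [Fin.ext_iff]
      grind
    · have h2' : ¬ (x : ℕ) = j := fun h => h2 (Fin.ext h)
      rw [if_neg h2', if_neg (show ¬ ((x : ℕ) = i ∨ (x : ℕ) = j) by omega)]
      have : (if i = j then if x = i ∧ y = i then c else 0 else if x = i ∧ y = j ∨ x = j ∧ y = i then c else 0) = 0 := by simp [h1, h2]
      rw [this, add_zero]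
      by_cases h3 : wv w x = y
      · rw [if_pos h3, if_pos h3]
        have h4 := hB.2 x (by omega)
        obtain ⟨k, hk⟩ := hB.1 _ h4
        rw [hk, evp, evp, Function.update_of_ne]
        rintro h; apply hjB; rw [← h, ← hk]; exact h4
      · rw [if_neg h3, if_neg h3]
open Classical in
lemma upd_sum (hw : Val w) (hw' : Val w') {B : Finset ℕ} (hB : scal w B) (hjB : sP j ∉ B) (J : Finset (Fin 7)) :
    ∑ s ∈ sup ∅ (insert (sP j) B), ∑ S ∈ SI J, (phi (Mw w' hw' s + S : Mat F) : ℤ) =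
    ∑ s ∈ sup ∅ B, ∑ c : F with c ≠ 0, ∑ S ∈ SI J, (phi (Mw w hw s + blk i j c + S : Mat F) : ℤ) := by
  rw [sum_insB ∅ B (sP j) (by simp) hjB]
  simp only [upd_Mw hij h7i h7j H hw hw' hB hjB]
end
/-- finset of a list -/
def fs (l : List ℕ) : Finset (Fin 7) := univ.filter (fun k => (k : ℕ) ∈ l)
lemma mem_fs {l : List ℕ} {k : Fin 7} : k ∈ fs l ↔ (k : ℕ) ∈ l := by simp [fs]
lemma fs_cons (i : Fin 7) (l : List ℕ) : fs ((i : ℕ) :: l) = insert i (fs l) := by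
  ext k; simp [mem_fs, Fin.ext_iff]
lemma SI_empty : SI (∅ : Finset (Fin 7)) = {(0 : Mat F)} := by
  ext S
  rw [mem_SI, mem_singleton]
  constructor
  · rintro ⟨_, h⟩; ext a b; exact h a b (by simp)
  · rintro rfl; simp
lemma card_fs {l : List ℕ} (hl : l.Nodup) (h7 : ∀ k ∈ l, k < 7) : #(fs l) = len l := by
  induction l with
  | nil => rfl
  | cons i l ih =>
    have := ih (List.nodup_cons.1 hl).2 (fun k hk => h7 k (by simp [hk]))
    change _ = Nat.succ (len l)
    rw [fs_cons ⟨i, h7 i (by simp)⟩, card_insert_of_notMem, this]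
    rw [mem_fs]; exact (List.nodup_cons.1 hl).1
lemma card_gtc {l : List ℕ} (hl : l.Nodup) (h7 : ∀ k ∈ l, k < 7) (j : Fin 7) : #{k ∈ fs l | j < k} = gtc j l := by
  induction l with
  | nil => rfl
  | cons i l ih =>
    have := ih (List.nodup_cons.1 hl).2 (fun k hk => h7 k (by simp [hk]))
    change _ = bif lt j i then Nat.succ (gtc j l) else gtc j l
    rw [fs_cons ⟨i, h7 i (by simp)⟩, clt, filter_insert]
    by_cases h : (j : ℕ) < i
    · rw [if_pos h, if_pos (by exact h), card_insert_of_notMem, this]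
      rw [mem_filter, mem_fs]; exact fun h => (List.nodup_cons.1 hl).1 h.1
    · rw [if_neg h, if_neg (by exact h), this]
lemma total_succ (n : ℕ) (i : ℕ) (I : List ℕ) (w Un nu e : ℕ) : total (n + 1) (i :: I) w Un nu e =
   radd (total n I w Un nu e) (radd (total n I (setw w i i) (Nat.mul Un (sP i)) (Nat.succ nu) (Nat.add e (len I)))
         (lrec (some Res.zero) (fun j _ acc => radd (total n (del j I) (setw (setw w i j) j i) (Nat.mul Un (sP j)) (Nat.succ nu)
            (Nat.add e (Nat.add (len I) (gtc j I)))) acc) I)) := by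
  delta total; dsimp only; rw [force_eq]
lemma total_nil (n : ℕ) (w Un nu e : ℕ) : total n [] w Un nu e = leafW w Un nu e := by
  cases n with
  | zero => rfl
  | succ n => delta total; dsimp only; rw [force_eq]
theorem total_sound (h2 : (2 : F) ≠ 0) : ∀ (n : ℕ) (l : List ℕ) (w Un nu e : ℕ) (B : Finset ℕ) (hw : Val w), l.length ≤ n → l.Pairwise (· < ·) →
    (∀ k ∈ l, k < 7 ∧ wv w k = 7 ∧ sP k ∉ B) → scal w B → Un = ∏ p ∈ B, p → #B = nu →
    Good ((Fintype.card F : ℤ) - 1) (total n l w Un nu e)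
     ((Fintype.card F : ℤ) ^ e * ∑ s ∈ sup ∅ B, ∑ S ∈ SI (fs l), (phi (Mw w hw s + S : Mat F) : ℤ)) := by
  classical
  intro n
  induction n with
  | zero =>
    intro l w Un nu e B hw hl _ _ hB hU hn
    have : l = [] := List.length_eq_zero_iff.1 (by omega)
    subst this
    rw [total_nil]
    have hf : fs [] = ∅ := rfl
    simp only [hf, SI_empty, sum_singleton, add_zero]
    exact leafW_sound hw h2 hB hU hn e
  | succ n ih =>
    intro l w Un nu e B hw hl hs hk hB hU hn
    cases l with
    | nil =>
      rw [total_nil]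
      have hf : fs [] = ∅ := rfl
      simp only [hf, SI_empty, sum_singleton, add_zero]
      exact leafW_sound hw h2 hB hU hn e
    | cons i I =>
      rw [total_succ]
      obtain ⟨i7, hwi, hiB⟩ := hk i (by simp)
      obtain ⟨i, rfl⟩ : ∃ i' : Fin 7, i = i' := ⟨⟨i, i7⟩, rfl⟩
      have hs' := List.pairwise_cons.1 hs
      have hk' : ∀ k ∈ I, k < 7 ∧ wv w k = 7 ∧ sP k ∉ B := fun k h => hk k (by simp [h])
      have hnd : I.Nodup := hs'.2.imp (fun h => h.ne)
      have hlI : I.length ≤ n := by simpa using hl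
      have hi : ∀ k ∈ fs I, i < k := fun k h => hs'.1 k (mem_fs.1 h)
      have hM : ∀ s : ℕ → F, ∀ a ∈ insert i (fs I), ∀ b, Mw w hw s a b = 0 ∧ Mw w hw s b a = 0 := by
        intro s a ha b
        have ha7 : wv w a = 7 := by
          rcases mem_insert.1 ha with h | h
          · rw [h]; exact hwi
          · exact (hk' a (mem_fs.1 h)).2.1
        rw [Mw_apply, Mw_apply, if_neg (by have := b.2; omega), if_neg]
        · exact ⟨rfl, rfl⟩
        · intro h
          have := a.2
          rcases hw b b.2 with h' | h'
          · omega
          · rw [h, ha7] at h'; have := b.2; omega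
      rw [fs_cons]
      simp only [recur hi h2 (hM _), sum_add_distrib, mul_add]
      refine Good_add _ (ih I w Un nu e B hw hlI hs'.2 hk' hB hU hn) (Good_add _ ?_ ?_)
      · have H : ∀ k, wv (setw w i i) k = if k = i then (i : ℕ) else if k = i then (i : ℕ) else wv w k := by
          intro k; rw [wv_setw hwi (by have := i.2; omega)]; split_ifs <;> rfl
        have hw' := upd_val hwi hwi H hw
        have := ih I (setw w i i) (Nat.mul Un (sP i)) (Nat.succ nu) (Nat.add e (len I)) (insert (sP i) B) hw' hlI hs'.2 ?_
          (upd_scal le_rfl hwi hwi H hB) ?_ ?_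
        · rw [upd_sum le_rfl hwi hwi H hw hw' hB hiB] at this
          rw [← mul_sum, ← mul_assoc, ← pow_add, card_fs hnd (fun k h => (hk' k h).1)]
          exact this
        · intro k hkI
          obtain ⟨a1, a2, a3⟩ := hk' k hkI
          have hne : ¬ k = i := (hs'.1 k hkI).ne'
          refine ⟨a1, ?_, ?_⟩
          · rw [H, if_neg hne, if_neg hne, a2]
          · rw [mem_insert, not_or]
            exact ⟨fun h => hne (congrArg Fin.val (sP_inj ⟨k, a1⟩ i h)), a3⟩
        · rw [prod_insert hiB, hU]; exact Nat.mul_comm _ _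
        · rw [card_insert_of_notMem hiB, hn]
      · rw [sum_comm, mul_sum]
        have key : ∀ J : List ℕ, J.Nodup → (∀ j ∈ J, j ∈ I) → Good ((Fintype.card F : ℤ) - 1) (lrec (some Res.zero) (fun j _ acc => radd (total n (del j I) (setw (setw w i j) j i) (Nat.mul Un (sP j)) (Nat.succ nu)
            (Nat.add e (Nat.add (len I) (gtc j I)))) acc) J) (∑ j ∈ fs J, (Fintype.card F : ℤ) ^ e * ∑ s ∈ sup ∅ B, (Fintype.card F : ℤ) ^ (#(fs I) + #{k ∈ fs I | j < k}) *
              ∑ c : F with c ≠ 0, ∑ S ∈ SI ((fs I).erase j), (phi (Mw w hw s + blk i j c + S) : ℤ)) := by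
          intro J hJ hJI
          induction J with
          | nil => exact Good_zero _
          | cons j J ihJ =>
            have hjI := hJI j (by simp)
            obtain ⟨j7, hwj, hjB⟩ := hk' j hjI
            obtain ⟨j, rfl⟩ : ∃ j' : Fin 7, j = j' := ⟨⟨j, j7⟩, rfl⟩
            rw [lrec_cons, fs_cons, sum_insert (by rw [mem_fs]; exact (List.nodup_cons.1 hJ).1)]
            refine Good_add _ ?_ (ihJ (List.nodup_cons.1 hJ).2 (fun k hk => hJI k (by simp [hk])))
            have hij : i < j := hs'.1 j hjI
            have hij' : ¬ (j : ℕ) = i := fun h => hij.ne' (Fin.ext h)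
            have H : ∀ k, wv (setw (setw w i j) j i) k = if k = i then (j : ℕ) else if k = j then (i : ℕ) else wv w k := by
              intro k
              have a7 : wv (setw w i j) j = 7 := by rw [wv_setw hwi (by have := j.2; omega), if_neg hij', hwj]
              rw [wv_setw a7 (by have := i.2; omega), wv_setw hwi (by have := j.2; omega)]
              by_cases h1 : k = j
              · rw [if_pos h1, if_neg (by omega), if_pos h1]
              · rw [if_neg h1, if_neg h1]
            have hw' := upd_val hwi hwj H hw
            have hfe : fs (del j I) = (fs I).erase j := by
              ext k
              rw [mem_erase, mem_fs, mem_fs, del_eq, List.Nodup.mem_erase_iff hnd, Ne, Ne, Fin.ext_iff]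
            have := ih (del j I) (setw (setw w i j) j i) (Nat.mul Un (sP j)) (Nat.succ nu) (Nat.add e (Nat.add (len I) (gtc j I))) (insert (sP j) B) hw' ?_ ?_ ?_
              (upd_scal hij.le hwi hwj H hB) ?_ ?_
            · rw [upd_sum hij.le hwi hwj H hw hw' hB hjB, hfe] at this
              rw [← mul_sum, ← mul_assoc, ← pow_add, card_fs hnd (fun k h => (hk' k h).1), card_gtc hnd (fun k h => (hk' k h).1)]
              exact this
            · rw [del_eq]; exact (List.length_erase_le).trans hlI
            · rw [del_eq]; exact hs'.2.sublist List.erase_sublist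
            · intro k hkI
              rw [del_eq, List.Nodup.mem_erase_iff hnd] at hkI
              obtain ⟨a1, a2, a3⟩ := hk' k hkI.2
              have hne : ¬ k = i := (hs'.1 k hkI.2).ne'
              refine ⟨a1, ?_, ?_⟩
              · rw [H, if_neg hne, if_neg hkI.1, a2]
              · rw [mem_insert, not_or]
                exact ⟨fun h => hkI.1 (congrArg Fin.val (sP_inj ⟨k, a1⟩ j h)), a3⟩
            · rw [prod_insert hjB, hU]; exact Nat.mul_comm _ _
            · rw [card_insert_of_notMem hjB, hn]
        exact key I hnd (fun _ h => h)
end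
end SpC

namespace SpC
set_option linter.unusedSectionVars false
open Finset Matrix
section
variable {F : Type*} [Field F] [Fintype F]
/-- the coefficients -/
def cfs (i : ℕ) : ℤ := [1, 49, 812, 6020, 22855, 48797, 62930, 52055, 29328, 11985, 3740, 899, 158, 18, 1].getD i 0
open Polynomial in
/-- the target polynomial -/
noncomputable def tp : ℤ[X] := ∑ i ∈ range 15, C (cfs i) * X ^ i
lemma tp_coeff (i : ℕ) : |tp.coeff i| ≤ ((62930 : ℕ) : ℤ) := by
  have : tp.coeff i = if i < 15 then cfs i else 0 := by
    rw [tp, Polynomial.finsetSum_coeff]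
    simp only [Polynomial.coeff_C_mul_X_pow]
    rw [Finset.sum_ite_eq]; simp
  rw [this]
  split_ifs with h
  · interval_cases i <;> simp [cfs]
  · simp
lemma tp_eval (x : ℤ) : tp.eval x = x ^ 14 + 18 * x ^ 13 + 158 * x ^ 12 + 899 * x ^ 11 + 3740 * x ^ 10 + 11985 * x ^ 9 + 29328 * x ^ 8 + 52055 * x ^ 7 + 62930 * x ^ 6 + 48797 * x ^ 5 + 22855 * x ^ 4 + 6020 * x ^ 3 + 812 * x ^ 2 + 49 * x + 1 := by
  simp [tp, Finset.sum_range_succ, cfs]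
  ring
lemma tp_BB : tp.eval (BB : ℤ) = target := by
  rw [tp_eval]; rfl
lemma sup_ee : (sup ∅ ∅ : Finset (ℕ → F)) = {0} := by
  ext a
  rw [mem_sup, mem_singleton]
  simp only [Sup]
  constructor
  · rintro ⟨_, h⟩; funext p; exact h p (by simp) (by simp)
  · rintro rfl; simp
lemma Val0 : Val 2097151 := by
  intro k hk; left; interval_cases k <;> rfl
theorem main_sum (chk : ok (total 7 [0,1,2,3,4,5,6] 2097151 1 0 0) (target * (BB+1)^21) = true) (h2 : (2 : F) ≠ 0) :
    ∑ S ∈ SI univ, (phi (S : Mat F) : ℤ) = (Fintype.card F : ℤ) ^ 21 * tp.eval ((Fintype.card F : ℤ) - 1) := by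
  have hw7 : ∀ k, k < 7 → wv 2097151 k = 7 := by intro k hk; interval_cases k <;> rfl
  have G := total_sound (F := F) h2 7 [0,1,2,3,4,5,6] 2097151 1 0 0 ∅ Val0 (by simp) (by decide) (by
    intro k hk
    have : k < 7 := by simp at hk; omega
    exact ⟨this, hw7 k this, by simp⟩) ⟨by simp, fun i hi => absurd (hw7 i i.2) hi⟩ (by simp) (by simp)
  have hfs : fs [0,1,2,3,4,5,6] = univ := by
    ext k; rw [mem_fs]; simp; omega
  have hM : ∀ s, (Mw 2097151 Val0 s : Mat F) = 0 := by
    intro s; ext x y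
    rw [Mw_apply, hw7 x x.2, if_neg (by have := y.2; omega)]; rfl
  rw [hfs, sup_ee] at G
  simp only [hM, zero_add, sum_singleton, pow_zero, one_mul] at G
  generalize total 7 [0,1,2,3,4,5,6] 2097151 1 0 0 = o at chk G
  rcases o with _ | ⟨r, b⟩
  · simp [ok] at chk
  simp only [ok, Bool.and_eq_true, decide_eq_true_eq, Nat.ble_eq] at chk
  obtain ⟨c1, c2⟩ := chk
  obtain ⟨P, p1, p2, p3⟩ := G _ rfl
  have hD : P - tp * (Polynomial.X + 1) ^ 21 = 0 := by
    apply poly_unique _ (BB : ℤ) (by norm_num)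
    · rw [Polynomial.eval_sub, p2, Polynomial.eval_mul, tp_BB]
      simp only [Polynomial.eval_pow, Polynomial.eval_add, Polynomial.eval_X, Polynomial.eval_one]
      exact sub_eq_zero.2 c1
    · intro k
      rw [Polynomial.coeff_sub]
      refine (abs_sub _ _).trans_lt ?_
      have h1 := p3 k
      have h3 := coeff_bd 21 tp 62930 tp_coeff k
      have h4 : ((4 * b : ℕ) : ℤ) ≤ (BB : ℤ) := by exact_mod_cast c2
      push_cast at h3 h4
      have h5 : |P.coeff k| ≤ (b : ℤ) := h1
      norm_num at h3 h4 ⊢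
      omega
  rw [← p1, sub_eq_zero.1 hD]
  simp
  ring
end
end SpC

namespace SpC
set_option linter.unusedSectionVars false
open Finset Matrix
section
variable {F : Type*} [Field F] [Fintype F]
/-- stabiliser group -/
def StabG (S A : Mat F) : Prop := Uni A ∧ Aᵀ * S * A = S
lemma Uni.inv_uni {g : Mat F} (h : Uni g) : Uni g⁻¹ := by
  obtain ⟨h1, h2, h3⟩ := h.inv
  refine ⟨h1, fun i => ?_⟩
  have := congrFun (congrFun h2 i) i
  rw [Matrix.mul_apply, Finset.sum_eq_single i] at this
  · simpa [h.2] using this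
  · intro k _ hk
    rcases lt_or_gt_of_ne hk with h5 | h5
    · rw [h.1 i k h5, zero_mul]
    · rw [h1 k i h5, mul_zero]
  · simp
lemma SU.uni {X : Mat F} (h : SU X) : Uni (1 - X) := by
  refine ⟨fun i j hij => ?_, fun i => ?_⟩
  · simp [h i j hij.le, Matrix.one_apply_ne hij.ne']
  · simp [h i i le_rfl]
lemma Uni.su {g : Mat F} (h : Uni g) : SU (1 - g) := by
  intro i j hij
  rcases hij.lt_or_eq with h1 | h1
  · simp [h.1 i j h1, Matrix.one_apply_ne h1.ne']
  · subst h1; simp [h.2]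
/-- Cayley map -/
noncomputable def cay (X : Mat F) : Mat F := (2 : F) • (1 - X)⁻¹ - 1
/-- inverse Cayley map -/
noncomputable def yac (A : Mat F) : Mat F := 1 - ((2 : F)⁻¹ • (A + 1))⁻¹
lemma half_uni (h2 : (2 : F) ≠ 0) {A : Mat F} (h : Uni A) : Uni ((2 : F)⁻¹ • (A + 1)) := by
  refine ⟨fun i j hij => ?_, fun i => ?_⟩
  · simp [h.1 i j hij, Matrix.one_apply_ne hij.ne']
  · simp only [Matrix.smul_apply, Matrix.add_apply, h.2, Matrix.one_apply_eq, smul_eq_mul]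
    rw [one_add_one_eq_two, inv_mul_cancel₀ h2]
lemma cay_uni {X : Mat F} (h : SU X) : Uni (cay X) := by
  have := h.uni.inv_uni
  refine ⟨fun i j hij => ?_, fun i => ?_⟩
  · simp [cay, this.1 i j hij, Matrix.one_apply_ne hij.ne']
  · simp only [cay, Matrix.smul_apply, Matrix.sub_apply, this.2, Matrix.one_apply_eq, smul_eq_mul]
    ring
lemma yac_su (h2 : (2 : F) ≠ 0) {A : Mat F} (h : Uni A) : SU (yac A) := (half_uni h2 h).inv_uni.su
lemma inv_inv' {g : Mat F} (h : Uni g) : g⁻¹⁻¹ = g := by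
  apply Matrix.nonsing_inv_nonsing_inv
  rw [h.det]; exact isUnit_one
lemma cay_yac (h2 : (2 : F) ≠ 0) {A : Mat F} (h : Uni A) : cay (yac A) = A := by
  rw [cay, yac, sub_sub_cancel, inv_inv' (half_uni h2 h), smul_smul, mul_inv_cancel₀ h2, one_smul, add_sub_cancel_right]
lemma yac_cay (h2 : (2 : F) ≠ 0) {X : Mat F} (h : SU X) : yac (cay X) = X := by
  rw [cay, yac, sub_add_cancel, smul_smul, inv_mul_cancel₀ h2, one_smul, inv_inv' h.uni, sub_sub_cancel]
lemma cay_stab (h2 : (2 : F) ≠ 0) {S X : Mat F} (h : SU X) : (cay X)ᵀ * S * cay X = S ↔ Xᵀ * S + S * X = 0 := by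
  obtain ⟨-, e1, e2⟩ := h.uni.inv
  have e0 : X = 1 - (1 - X) := by rw [sub_sub_cancel]
  rw [cay]
  generalize 1 - X = g at *
  subst e0
  generalize g⁻¹ = k at *
  have t1 : gᵀ * kᵀ = 1 := by rw [← transpose_mul, e2, transpose_one]
  have t2 : kᵀ * gᵀ = 1 := by rw [← transpose_mul, e1, transpose_one]
  have key : gᵀ * (((2 : F) • k - 1)ᵀ * S * ((2 : F) • k - 1) - S) * g = (2 : F) • ((1 - g)ᵀ * S + S * (1 - g)) := by
    have h1 : gᵀ * ((2 : F) • k - 1)ᵀ = (2 : F) • 1 - gᵀ := by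
      rw [transpose_sub, transpose_smul, transpose_one, Matrix.mul_sub, Matrix.mul_smul, t1, Matrix.mul_one]
    have h3 : ((2 : F) • k - 1) * g = (2 : F) • 1 - g := by
      rw [Matrix.sub_mul, Matrix.smul_mul, e2, Matrix.one_mul]
    calc _ = (gᵀ * ((2 : F) • k - 1)ᵀ) * S * (((2 : F) • k - 1) * g) - gᵀ * S * g := by
          simp only [Matrix.mul_sub, Matrix.sub_mul, Matrix.mul_assoc]
      _ = _ := by
          rw [h1, h3]
          simp only [two_smul, transpose_sub, transpose_one]
          noncomm_ring
  constructor
  · intro h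
    rw [h, sub_self, Matrix.mul_zero, Matrix.zero_mul] at key
    exact (smul_eq_zero.1 key.symm).resolve_left h2
  · intro h
    rw [h, smul_zero] at key
    have := congrArg (fun M => kᵀ * M * k) key
    simp only [Matrix.mul_zero, Matrix.zero_mul] at this
    rw [← Matrix.mul_assoc, ← Matrix.mul_assoc, t2, Matrix.one_mul, Matrix.mul_assoc, e1, Matrix.mul_one] at this
    exact sub_eq_zero.1 this
lemma comm_inv {g h : Mat F} (e : g * h = h * g) : g⁻¹ * h⁻¹ = h⁻¹ * g⁻¹ := by
  rw [← Matrix.mul_inv_rev, ← Matrix.mul_inv_rev, e]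
lemma cay_comm {X Y : Mat F} (e : X * Y = Y * X) : cay X * cay Y = cay Y * cay X := by
  have : (1 - X) * (1 - Y) = (1 - Y) * (1 - X) := by
    simp only [Matrix.mul_sub, Matrix.sub_mul, e, Matrix.mul_one, Matrix.one_mul]; abel
  have := comm_inv this
  have h1 : Commute ((2 : F) • (1 - X)⁻¹) ((2 : F) • (1 - Y)⁻¹) := (Commute.smul_left this _).smul_right _
  exact ((h1.sub_left (Commute.one_left _)).sub_right (Commute.one_right _)).eq
lemma yac_comm {X Y : Mat F} (e : X * Y = Y * X) : yac X * yac Y = yac Y * yac X := by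
  have : ((2 : F)⁻¹ • (X + 1)) * ((2 : F)⁻¹ • (Y + 1)) = ((2 : F)⁻¹ • (Y + 1)) * ((2 : F)⁻¹ • (X + 1)) := by
    have h1 : Commute (X + 1) (Y + 1) := (Commute.add_left e (Commute.one_left _)).add_right (Commute.one_right _)
    exact ((h1.smul_left _).smul_right _).eq
  have := comm_inv this
  unfold yac
  simp only [Matrix.mul_sub, Matrix.sub_mul, Matrix.mul_one, Matrix.one_mul, this]; abel
lemma phi_eq (h2 : (2 : F) ≠ 0) (S : Mat F) :
    phi S = Nat.card {z : Mat F × Mat F // StabG S z.1 ∧ StabG S z.2 ∧ z.1 * z.2 = z.2 * z.1} := by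
  have a1 : ∀ {X : Mat F}, StabA S X → StabG S (cay X) := fun h => ⟨cay_uni h.1, (cay_stab h2 h.1).2 h.2⟩
  have a2 : ∀ {A : Mat F}, StabG S A → StabA S (yac A) := fun {A} h => ⟨yac_su h2 h.1, (cay_stab h2 (yac_su h2 h.1)).1 (by
    rw [cay_yac h2 h.1]; exact h.2)⟩
  apply Nat.card_congr
  refine ⟨fun z => ⟨(cay z.1.1, cay z.1.2), a1 z.2.1, a1 z.2.2.1, cay_comm z.2.2.2⟩,
    fun z => ⟨(yac z.1.1, yac z.1.2), a2 z.2.1, a2 z.2.2.1, yac_comm z.2.2.2⟩, fun z => ?_, fun z => ?_⟩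
  · apply Subtype.ext; apply Prod.ext
    · exact yac_cay h2 z.2.1.1
    · exact yac_cay h2 z.2.2.1.1
  · apply Subtype.ext; apply Prod.ext
    · exact cay_yac h2 z.2.1.1
    · exact cay_yac h2 z.2.2.1.1
end
end SpC

namespace SpC
set_option linter.unusedSectionVars false
open Finset Matrix
section
variable {F : Type*} [Field F] [Fintype F]
/-- symmetric matrices -/
def Sy (F : Type*) [Field F] : Submodule F (Mat F) where
  carrier := {B | Bᵀ = B}
  zero_mem' := by simp
  add_mem' := by intro a b ha hb; simp only [Set.mem_ofPred_eq] at *; rw [transpose_add, ha, hb]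
  smul_mem' := by intro c a ha; simp only [Set.mem_ofPred_eq] at *; rw [transpose_smul, ha]
lemma mem_Sy {B : Mat F} : B ∈ Sy F ↔ Bᵀ = B := Iff.rfl
/-- congruence action -/
def cg (A : Mat F) : Sy F →ₗ[F] Sy F where
  toFun B := ⟨A * B * Aᵀ, by rw [mem_Sy, transpose_mul, transpose_mul, transpose_transpose, mem_Sy.1 B.2, Matrix.mul_assoc]⟩
  map_add' x y := by ext1; simp [Matrix.mul_add, Matrix.add_mul]
  map_smul' c x := by ext1; simp
lemma cg_coe (A : Mat F) (B : Sy F) : (cg A B : Mat F) = A * B * Aᵀ := rfl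
/-- trace form -/
noncomputable def tf (F : Type*) [Field F] : LinearMap.BilinForm F (Sy F) :=
  LinearMap.mk₂ F (fun S B => trace (S.1 * B.1)) (by intros; simp [Matrix.add_mul]) (by intros; simp) (by intros; simp [Matrix.mul_add]) (by intros; simp)
lemma tf_apply (S B : Sy F) : tf F S B = trace (S.1 * B.1) := rfl
lemma tf_symm (S B : Sy F) : tf F S B = tf F B S := by rw [tf_apply, tf_apply, trace_mul_comm]
lemma tf_zero (h2 : (2 : F) ≠ 0) (S : Sy F) (h : ∀ B, tf F S B = 0) : S = 0 := by
  ext i j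
  have h1 := h ⟨Matrix.single i j 1 + Matrix.single j i 1, by
    rw [mem_Sy, transpose_add, transpose_single, transpose_single, add_comm]⟩
  rw [tf_apply] at h1
  simp only [Matrix.mul_add, trace_add, trace_mul_single, MulOpposite.op_one, one_smul] at h1
  have h3 : S.1 i j = S.1 j i := congrFun (congrFun (mem_Sy.1 S.2) j) i
  rw [h3, ← two_mul] at h1
  simpa [h3] using (mul_eq_zero.1 h1).resolve_left h2
/-- the difference map -/
def dm (A A' : Mat F) : Sy F × Sy F →ₗ[F] Sy F :=
  (LinearMap.id - cg A').coprod (cg A - LinearMap.id)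
lemma tf_cg (A : Mat F) (S B : Sy F) : tf F (cg A B) S = tf F B (cg Aᵀ S) := by
  rw [tf_apply, tf_apply, cg_coe, cg_coe, transpose_transpose, Matrix.mul_assoc, Matrix.mul_assoc, trace_mul_comm]
  congr 1
  simp only [Matrix.mul_assoc]
lemma orth_dm (h2 : (2 : F) ≠ 0) (A A' : Mat F) (S : Sy F) :
    S ∈ (tf F).orthogonal (LinearMap.range (dm A A')) ↔ Aᵀ * S.1 * A = S.1 ∧ A'ᵀ * S.1 * A' = S.1 := by
  have e : ∀ A : Mat F, Aᵀ * S.1 * A = S.1 ↔ cg Aᵀ S = S := by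
    intro A; rw [Subtype.ext_iff, cg_coe, transpose_transpose]
  rw [e, e, LinearMap.BilinForm.mem_orthogonal_iff]
  simp only [LinearMap.mem_range, forall_exists_index, forall_apply_eq_imp_iff]
  constructor
  · intro h
    constructor
    · rw [← sub_eq_zero]
      apply tf_zero h2
      intro B
      have := h (0, B)
      simp only [dm, LinearMap.coprod_apply, map_zero, zero_add, LinearMap.sub_apply, LinearMap.id_apply, map_sub, tf_cg] at this
      rw [tf_symm, map_sub]; exact this
    · rw [← sub_eq_zero]
      apply tf_zero h2
      intro B
      have := h (B, 0)
      simp only [dm, LinearMap.coprod_apply, map_zero, add_zero, LinearMap.sub_apply, LinearMap.id_apply, map_sub, tf_cg] at this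
      rw [tf_symm, map_sub, ← neg_sub, this, neg_zero]
  · rintro ⟨h1, h3⟩ ⟨B, B'⟩
    simp only [dm, LinearMap.coprod_apply, map_add, LinearMap.add_apply, LinearMap.sub_apply, LinearMap.id_apply, map_sub, tf_cg, h1, h3, sub_self, add_zero]
lemma card_dm (h2 : (2 : F) ≠ 0) (A A' : Mat F) :
    Nat.card {z : Sy F × Sy F // z.1 + cg A z.2 = z.2 + cg A' z.1} =
      Nat.card (Sy F) * Nat.card {S : Sy F // Aᵀ * S.1 * A = S.1 ∧ A'ᵀ * S.1 * A' = S.1} := by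
  have nd : (tf F).Nondegenerate := by
    refine ⟨fun S h => tf_zero h2 S h, fun S h => tf_zero h2 S (fun B => by rw [tf_symm]; exact h B)⟩
  have h1 : Nat.card {z : Sy F × Sy F // z.1 + cg A z.2 = z.2 + cg A' z.1} = Nat.card (LinearMap.ker (dm A A')) := by
    apply Nat.card_congr
    refine Equiv.subtypeEquivRight (fun z => ?_)
    rw [LinearMap.mem_ker]
    simp only [dm, LinearMap.coprod_apply, LinearMap.sub_apply, LinearMap.id_apply]
    rw [← sub_eq_zero]
    constructor <;> (intro h; rw [← h]; abel)
  have h3 : Nat.card {S : Sy F // Aᵀ * S.1 * A = S.1 ∧ A'ᵀ * S.1 * A' = S.1} = Nat.card ((tf F).orthogonal (LinearMap.range (dm A A'))) := by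
    apply Nat.card_congr
    exact Equiv.subtypeEquivRight (fun S => (orth_dm h2 A A' S).symm)
  have r := LinearMap.finrank_range_add_finrank_ker (dm A A')
  have le := Submodule.finrank_le (LinearMap.range (dm A A'))
  rw [Module.finrank_prod] at r
  have o : Module.finrank F ((tf F).orthogonal (LinearMap.range (dm A A'))) = Module.finrank F (Sy F) - Module.finrank F (LinearMap.range (dm A A')) :=
    LinearMap.BilinForm.finrank_orthogonal nd (LinearMap.range (dm A A'))
  rw [h1, h3, Module.natCard_eq_pow_finrank (K := F), Module.natCard_eq_pow_finrank (K := F) (V := Sy F), Module.natCard_eq_pow_finrank (K := F) (V := (tf F).orthogonal _),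
    o, ← pow_add]
  congr 1; omega
end
end SpC

namespace SpC
set_option linter.unusedSectionVars false
open Finset Matrix
section
variable {F : Type*} [Field F] [Fintype F]
/-- unitriangular matrices -/
abbrev UA (F : Type*) [Field F] := {A : Mat F // Uni A}
/-- commuting pairs of unitriangular matrices -/
abbrev CP (F : Type*) [Field F] := {z : Mat F × Mat F // Uni z.1 ∧ Uni z.2 ∧ z.1 * z.2 = z.2 * z.1}
theorem pairs_count (h2 : (2 : F) ≠ 0) :
    Nat.card {z : (UA F × Sy F) × (UA F × Sy F) // z.1.1.1 * z.2.1.1 = z.2.1.1 * z.1.1.1 ∧ z.1.2 + cg z.1.1.1 z.2.2 = z.2.2 + cg z.2.1.1 z.1.2} =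
      Nat.card (Sy F) * ∑ S ∈ SI univ, phi (S : Mat F) := by
  classical
  let _ : Fintype (CP F) := Fintype.ofFinite _
  let _ : Fintype (Sy F) := Fintype.ofFinite _
  have e1 : Nat.card {z : (UA F × Sy F) × (UA F × Sy F) // z.1.1.1 * z.2.1.1 = z.2.1.1 * z.1.1.1 ∧ z.1.2 + cg z.1.1.1 z.2.2 = z.2.2 + cg z.2.1.1 z.1.2}
      = Nat.card (Σ c : CP F, {z : Sy F × Sy F // z.1 + cg c.1.1 z.2 = z.2 + cg c.1.2 z.1}) := by
    apply Nat.card_congr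
    exact ⟨fun z => ⟨⟨(z.1.1.1.1, z.1.2.1.1), z.1.1.1.2, z.1.2.1.2, z.2.1⟩, ⟨(z.1.1.2, z.1.2.2), z.2.2⟩⟩,
      fun z => ⟨((⟨z.1.1.1, z.1.2.1⟩, z.2.1.1), (⟨z.1.1.2, z.1.2.2.1⟩, z.2.1.2)), z.1.2.2.2, z.2.2⟩, fun z => rfl, fun z => rfl⟩
  have e2 : Nat.card (Σ c : CP F, {S : Sy F // c.1.1ᵀ * S.1 * c.1.1 = S.1 ∧ c.1.2ᵀ * S.1 * c.1.2 = S.1})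
      = Nat.card (Σ S : Sy F, {z : Mat F × Mat F // StabG S.1 z.1 ∧ StabG S.1 z.2 ∧ z.1 * z.2 = z.2 * z.1}) := by
    apply Nat.card_congr
    exact ⟨fun z => ⟨z.2.1, ⟨z.1.1, ⟨z.1.2.1, z.2.2.1⟩, ⟨z.1.2.2.1, z.2.2.2⟩, z.1.2.2.2⟩⟩,
      fun z => ⟨⟨z.2.1, z.2.2.1.1, z.2.2.2.1.1, z.2.2.2.2⟩, ⟨z.1, z.2.2.1.2, z.2.2.2.1.2⟩⟩, fun z => rfl, fun z => rfl⟩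
  rw [e1, Nat.card_sigma]
  simp only [card_dm h2]
  rw [← Finset.mul_sum, ← Nat.card_sigma, e2, Nat.card_sigma]
  simp only [← phi_eq h2]
  congr 1
  refine Finset.sum_bij (fun S _ => S.1) ?_ ?_ ?_ ?_
  · intro S _
    rw [mem_SI]
    exact ⟨fun a b => congrFun (congrFun (mem_Sy.1 S.2) b) a, fun a b h => absurd (mem_univ a) h⟩
  · intro S _ T _ h; exact Subtype.ext h
  · intro S hS
    rw [mem_SI] at hS
    exact ⟨⟨S, by rw [mem_Sy]; ext a b; exact hS.1 b a⟩, mem_univ _, rfl⟩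
  · intro S _; rfl
lemma card_UA : Nat.card (UA F) = Fintype.card F ^ 21 := by
  have : Nat.card (UA F) = Nat.card ({p : Fin 7 × Fin 7 // p.1 < p.2} → F) := by
    apply Nat.card_congr
    refine ⟨fun A p => A.1 p.1.1 p.1.2, fun f => ⟨fun i j => if h : i < j then f ⟨(i, j), h⟩ else if i = j then 1 else 0, ?_, ?_⟩, ?_, ?_⟩
    · intro i j h
      simp [h.not_gt, h.ne']
    · intro i; simp
    · intro A
      apply Subtype.ext
      ext i j
      by_cases h : i < j
      · simp [h]
      · by_cases h' : i = j
        · subst h'; simp [A.2.2]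
        · simp [h, h', A.2.1 i j (lt_of_le_of_ne (not_lt.1 h) (Ne.symm h'))]
    · intro f
      funext p
      simp [p.2]
  rw [this, Nat.card_eq_fintype_card, Fintype.card_fun]
  congr 1
lemma card_Sy : ∃ n, Nat.card (Sy F) = Fintype.card F ^ n :=
  ⟨_, by rw [Module.natCard_eq_pow_finrank (K := F), Nat.card_eq_fintype_card]⟩
end
end SpC

namespace SpC
set_option linter.unusedSectionVars false
open Finset Matrix
section
variable {F : Type*} [Field F] [Fintype F]
lemma Uni.mul {g h : Mat F} (hg : Uni g) (hh : Uni h) : Uni (g * h) := by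
  refine ⟨hg.1.mul hh.1, fun i => ?_⟩
  rw [Matrix.mul_apply, Finset.sum_eq_single i, hg.2, hh.2, one_mul]
  · intro k _ hk
    rcases lt_or_gt_of_ne hk with h5 | h5
    · rw [hg.1 i k h5, zero_mul]
    · rw [hh.1 k i h5, mul_zero]
  · simp
lemma Uni.one : Uni (1 : Mat F) := ⟨fun i j h => Matrix.one_apply_ne h.ne', fun i => Matrix.one_apply_eq i⟩
/-- block matrix -/
noncomputable def Mk (A B : Mat F) : Matrix (Fin 7 ⊕ Fin 7) (Fin 7 ⊕ Fin 7) F := fromBlocks A (B * A⁻¹ᵀ) 0 A⁻¹ᵀ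
lemma Uni.invT {A : Mat F} (h : Uni A) : A⁻¹ᵀ * Aᵀ = 1 ∧ Aᵀ * A⁻¹ᵀ = 1 := by
  obtain ⟨-, e1, e2⟩ := h.inv
  rw [← transpose_mul, ← transpose_mul, e1, e2, transpose_one]; exact ⟨rfl, rfl⟩
lemma Mk_mul {A A' : Mat F} (h : Uni A) (B B' : Mat F) : Mk A B * Mk A' B' = Mk (A * A') (B + A * B' * Aᵀ) := by
  rw [Mk, Mk, Mk, fromBlocks_multiply, Matrix.mul_inv_rev, transpose_mul]
  congr 1
  · simp
  · rw [Matrix.add_mul, add_comm, Matrix.mul_assoc B, Matrix.mul_assoc (A * B') Aᵀ, ← Matrix.mul_assoc Aᵀ, h.invT.2, Matrix.one_mul, Matrix.mul_assoc A]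
  · simp
  · simp
lemma Mk_one : Mk (1 : Mat F) 0 = 1 := by
  simp [Mk]
lemma Mk_inj {A A' B B' : Mat F} (h : Uni A) (e : Mk A B = Mk A' B') : A = A' ∧ B = B' := by
  rw [Mk, Mk, fromBlocks_inj] at e
  obtain ⟨rfl, e2, -, -⟩ := e
  refine ⟨rfl, ?_⟩
  have := congrArg (· * Aᵀ) e2
  simpa only [Matrix.mul_assoc, h.invT.1, Matrix.mul_one] using this
lemma Mk_mem {A B : Mat F} (h : Uni A) (hB : Bᵀ = B) : Mk A B ∈ symplecticGroup (Fin 7) F := by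
  rw [Mk, SymplecticGroup.fromBlocks_mem_iff]
  refine ⟨by simp, ?_, ?_⟩
  · rw [transpose_mul, hB]; simp only [transpose_transpose, Matrix.mul_assoc]
  · simp [h.invT.2]
variable (F) in
/-- the maximal unipotent subgroup -/
def Umax : Subgroup (symplecticGroup (Fin 7) F) where
  carrier := {g | ∃ A B : Mat F, Uni A ∧ Bᵀ = B ∧ g.1 = Mk A B}
  one_mem' := ⟨1, 0, Uni.one, by simp, Mk_one.symm⟩
  mul_mem' := by
    rintro g g' ⟨A, B, hA, hB, e⟩ ⟨A', B', hA', hB', e'⟩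
    refine ⟨A * A', B + A * B' * Aᵀ, hA.mul hA', ?_, ?_⟩
    · simp only [transpose_add, transpose_mul, transpose_transpose, hB, hB', Matrix.mul_assoc]
    · rw [Submonoid.coe_mul, e, e', Mk_mul hA]
  inv_mem' := by
    rintro g ⟨A, B, hA, hB, e⟩
    obtain ⟨-, e1, e2⟩ := hA.inv
    have hs : (-(A⁻¹ * B * A⁻¹ᵀ))ᵀ = -(A⁻¹ * B * A⁻¹ᵀ) := by
      simp only [transpose_neg, transpose_mul, transpose_transpose, hB, Matrix.mul_assoc]
    refine ⟨A⁻¹, -(A⁻¹ * B * A⁻¹ᵀ), hA.inv_uni, hs, ?_⟩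
    have : g * ⟨Mk A⁻¹ (-(A⁻¹ * B * A⁻¹ᵀ)), Mk_mem hA.inv_uni hs⟩ = 1 := by
      apply Subtype.ext
      rw [Submonoid.coe_mul, e, Mk_mul hA, e1]
      rw [Submonoid.coe_one, ← Mk_one]
      congr 1
      rw [Matrix.mul_neg, Matrix.neg_mul, Matrix.mul_assoc, Matrix.mul_assoc A⁻¹, Matrix.mul_assoc (A⁻¹), Matrix.mul_assoc B, hA.invT.1, Matrix.mul_one, ← Matrix.mul_assoc, e1, Matrix.one_mul, add_neg_cancel]
    rw [inv_eq_of_mul_eq_one_right this]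
lemma mem_Umax {g : symplecticGroup (Fin 7) F} : g ∈ Umax F ↔ ∃ A B : Mat F, Uni A ∧ Bᵀ = B ∧ g.1 = Mk A B := Iff.rfl
lemma mem_Umax_of {g : symplecticGroup (Fin 7) F} (h0 : ∀ i j, g.1 (Sum.inr i) (Sum.inl j) = 0) (h1 : Uni (g.1.toBlocks₁₁)) : g ∈ Umax F := by
  have hz : g.1.toBlocks₂₁ = 0 := by ext i j; exact h0 i j
  have hg := g.2
  have hb := fromBlocks_toBlocks g.1
  rw [hz] at hb
  rw [← hb, SymplecticGroup.fromBlocks_mem_iff] at hg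
  set A := g.1.toBlocks₁₁
  set C := g.1.toBlocks₁₂
  set D := g.1.toBlocks₂₂
  obtain ⟨-, g2, g3⟩ := hg
  simp only [transpose_zero, Matrix.zero_mul, sub_zero] at g3
  have hD : D = A⁻¹ᵀ := by
    calc D = (A⁻¹ᵀ * Aᵀ) * D := by rw [h1.invT.1, Matrix.one_mul]
      _ = _ := by rw [Matrix.mul_assoc, g3, Matrix.mul_one]
  have d1 : D * Aᵀ = 1 := by rw [hD, h1.invT.1]
  have d2 : A * Dᵀ = 1 := by rw [hD, transpose_transpose, h1.inv.2.1]
  refine ⟨A, C * Aᵀ, h1, ?_, ?_⟩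
  · rw [transpose_mul, transpose_transpose]
    have := congrArg (fun M => A * M * Aᵀ) g2
    simp only [Matrix.mul_assoc, d1, Matrix.mul_one] at this
    rwa [← Matrix.mul_assoc A Dᵀ, d2, Matrix.one_mul] at this
  · rw [Mk, Matrix.mul_assoc, h1.invT.2, Matrix.mul_one, ← hD, hb]
/-- coordinates on the unipotent subgroup -/
noncomputable def Umaxe : UA F × Sy F ≃ Umax F := Equiv.ofBijective
  (fun z => ⟨⟨Mk z.1.1 z.2.1, Mk_mem z.1.2 z.2.2⟩, z.1.1, z.2.1, z.1.2, z.2.2, rfl⟩) (by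
    constructor
    · intro z w h
      have := Mk_inj z.1.2 (congrArg (fun g : Umax F => g.1.1) h)
      exact Prod.ext (Subtype.ext this.1) (Subtype.ext this.2)
    · rintro ⟨g, A, B, hA, hB, e⟩
      exact ⟨(⟨A, hA⟩, ⟨B, hB⟩), Subtype.ext (Subtype.ext e.symm)⟩)
lemma Umaxe_coe (z : UA F × Sy F) : (Umaxe z).1.1 = Mk z.1.1 z.2.1 := rfl
lemma Umaxe_comm (z w : UA F × Sy F) : Commute (Umaxe z) (Umaxe w) ↔ z.1.1 * w.1.1 = w.1.1 * z.1.1 ∧ z.2 + cg z.1.1 w.2 = w.2 + cg w.1.1 z.2 := by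
  have : Commute (Umaxe z) (Umaxe w) ↔ (Umaxe z).1.1 * (Umaxe w).1.1 = (Umaxe w).1.1 * (Umaxe z).1.1 := by
    constructor
    · intro h; exact congrArg (fun g : Umax F => g.1.1) h
    · intro h; exact Subtype.ext (Subtype.ext h)
  rw [this, Umaxe_coe, Umaxe_coe, Mk_mul z.1.2, Mk_mul w.1.2, Subtype.ext_iff]
  simp only [Submodule.coe_add, cg_coe]
  constructor
  · intro h; exact Mk_inj (z.1.2.mul w.1.2) h
  · rintro ⟨h1, h2⟩; rw [h1, h2]
lemma card_Umax : Nat.card (Umax F) = Nat.card (UA F) * Nat.card (Sy F) := by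
  rw [← Nat.card_prod]; exact Nat.card_congr Umaxe.symm
theorem k_Umax (h2 : (2 : F) ≠ 0) : Nat.card (ConjClasses (Umax F)) * Fintype.card F ^ 21 = ∑ S ∈ SI univ, phi (S : Mat F) := by
  have h := card_comm_eq_card_conjClasses_mul_card (Umax F)
  have e : Nat.card {p : Umax F × Umax F // Commute p.1 p.2} = Nat.card {z : (UA F × Sy F) × (UA F × Sy F) // z.1.1.1 * z.2.1.1 = z.2.1.1 * z.1.1.1 ∧ z.1.2 + cg z.1.1.1 z.2.2 = z.2.2 + cg z.2.1.1 z.1.2} := by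
    symm
    apply Nat.card_congr
    exact Equiv.subtypeEquiv (Equiv.prodCongr Umaxe Umaxe) (fun z => (Umaxe_comm z.1 z.2).symm)
  rw [e, pairs_count h2, card_Umax, card_UA] at h
  have hp : 0 < Nat.card (Sy F) := Nat.card_pos
  apply Nat.eq_of_mul_eq_mul_left hp
  rw [h]; ring
end
end SpC

namespace SpC
set_option linter.unusedSectionVars false
open Finset Matrix
section
variable {F : Type*} [Field F] [Fintype F]
lemma Umax_entries {g : symplecticGroup (Fin 7) F} (h : g ∈ Umax F) : (∀ i j, g.1 (Sum.inr i) (Sum.inl j) = 0) ∧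
    (∀ i j, j < i → g.1 (Sum.inl i) (Sum.inl j) = 0) ∧ ∀ i, g.1 (Sum.inl i) (Sum.inl i) = 1 := by
  obtain ⟨A, B, hA, hB, e⟩ := h
  rw [e]
  exact ⟨fun i j => rfl, fun i j h => hA.1 i j h, fun i => hA.2 i⟩
/-- normaliser elements are block triangular -/
lemma norm_tri {x : symplecticGroup (Fin 7) F} (hx : ∀ u ∈ Umax F, x⁻¹ * u * x ∈ Umax F) (k : Fin 7) :
    (∀ i, x.1 (Sum.inr i) (Sum.inl k) = 0) ∧ (∀ i, k < i → x.1 (Sum.inl i) (Sum.inl k) = 0) := by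
  induction k using WellFoundedLT.induction with
  | ind k ih =>
  have key : ∀ u ∈ Umax F, (u.1 * x.1) (Sum.inl k) (Sum.inl k) = x.1 (Sum.inl k) (Sum.inl k) := by
    intro u hu
    obtain ⟨h1, h2, h3⟩ := Umax_entries (hx u hu)
    have e : u.1 * x.1 = x.1 * (x⁻¹ * u * x).1 := by
      rw [← Submonoid.coe_mul, ← Submonoid.coe_mul]
      congr 1; group
    rw [e, Matrix.mul_apply, Fintype.sum_sum_type]
    simp only [h1, mul_zero, sum_const_zero, add_zero]
    rw [Finset.sum_eq_single k, h3, mul_one]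
    · intro i _ hi
      rcases lt_or_gt_of_ne hi with h5 | h5
      · rw [(ih i h5).2 k h5, zero_mul]
      · rw [h2 i k h5, mul_zero]
    · simp
  constructor
  · intro j
    set B : Mat F := fun a b => if (a = k ∧ b = j) ∨ (a = j ∧ b = k) then 1 else 0 with hB
    have hBs : Bᵀ = B := by
      ext a b; rw [transpose_apply]; exact if_congr (by tauto) rfl rfl
    have := key ⟨Mk 1 B, Mk_mem Uni.one hBs⟩ ⟨1, B, Uni.one, hBs, rfl⟩
    simp only [Mk] at this
    rw [← fromBlocks_toBlocks x.1, fromBlocks_multiply] at this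
    simp only [fromBlocks_apply₁₁, Matrix.add_apply, Matrix.one_mul, inv_one, transpose_one, Matrix.mul_one, add_eq_left] at this
    rw [Matrix.mul_apply, Finset.sum_eq_single j] at this
    · simpa [hB, toBlocks₂₁] using this
    · intro b _ hb
      have : ¬ ((k = k ∧ b = j) ∨ (k = j ∧ b = k)) := by
        rintro (h | h)
        · exact hb h.2
        · exact hb (h.2.trans h.1)
      simp only [hB, if_neg this, zero_mul]
    · simp
  · intro j hkj
    set A : Mat F := 1 + Matrix.single k j 1 with hA
    have hAu : Uni A := by
      refine ⟨fun a b hab => ?_, fun a => ?_⟩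
      · rw [hA, Matrix.add_apply, Matrix.one_apply_ne hab.ne', Matrix.single_apply_of_ne, zero_add]
        rintro ⟨rfl, rfl⟩; exact absurd hab hkj.not_gt
      · rw [hA, Matrix.add_apply, Matrix.one_apply_eq, Matrix.single_apply_of_ne, add_zero]
        rintro ⟨rfl, rfl⟩; exact absurd hkj (lt_irrefl _)
    have := key ⟨Mk A 0, Mk_mem hAu (by simp)⟩ ⟨A, 0, hAu, by simp, rfl⟩
    simp only [Mk] at this
    rw [← fromBlocks_toBlocks x.1, fromBlocks_multiply] at this
    simp only [fromBlocks_apply₁₁, Matrix.zero_mul, add_zero] at this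
    rw [hA, Matrix.add_mul, Matrix.add_apply, Matrix.one_mul, add_eq_left, Matrix.single_mul_apply_same, one_mul] at this
    exact this
lemma tri_pow {x : symplecticGroup (Fin 7) F} (h0 : ∀ i j, x.1 (Sum.inr i) (Sum.inl j) = 0) (h1 : ∀ i j, j < i → x.1 (Sum.inl i) (Sum.inl j) = 0) (k : Fin 7) (N : ℕ) :
    (∀ i, (x ^ N).1 (Sum.inr i) (Sum.inl k) = 0) ∧ (∀ i, k < i → (x ^ N).1 (Sum.inl i) (Sum.inl k) = 0) ∧
      (x ^ N).1 (Sum.inl k) (Sum.inl k) = (x.1 (Sum.inl k) (Sum.inl k)) ^ N := by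
  induction N with
  | zero =>
    refine ⟨fun i => ?_, fun i h => ?_, ?_⟩
    · rw [pow_zero, Submonoid.coe_one, Matrix.one_apply_ne (by simp)]
    · rw [pow_zero, Submonoid.coe_one, Matrix.one_apply_ne (by simpa using h.ne')]
    · rw [pow_zero, Submonoid.coe_one, Matrix.one_apply_eq, pow_zero]
  | succ N ih =>
    obtain ⟨a, b, c⟩ := ih
    rw [pow_succ', Submonoid.coe_mul]
    refine ⟨fun i => ?_, fun i h => ?_, ?_⟩
    · rw [Matrix.mul_apply, Fintype.sum_sum_type]
      simp [a, h0]
    · rw [Matrix.mul_apply, Fintype.sum_sum_type]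
      simp only [a, mul_zero, sum_const_zero, add_zero]
      apply sum_eq_zero
      intro l _
      rcases le_or_gt l k with h3 | h3
      · rw [h1 i l (h3.trans_lt h), zero_mul]
      · rw [b l h3, mul_zero]
    · rw [Matrix.mul_apply, Fintype.sum_sum_type]
      simp only [a, mul_zero, sum_const_zero, add_zero]
      rw [Finset.sum_eq_single k, c, pow_succ']
      · intro l _ hl
        rcases lt_or_gt_of_ne hl with h5 | h5
        · rw [h1 k l h5, zero_mul]
        · rw [b l h5, mul_zero]
      · simp
lemma norm_mem {p m : ℕ} [Fact p.Prime] [CharP F p] {x : symplecticGroup (Fin 7) F} (hx : ∀ u ∈ Umax F, x⁻¹ * u * x ∈ Umax F) (hN : x ^ (p ^ m) = 1) : x ∈ Umax F := by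
  have t := norm_tri hx
  refine mem_Umax_of (fun i j => (t j).1 i) ⟨fun i j h => (t j).2 i h, fun i => ?_⟩
  have h := (tri_pow (fun i j => (t j).1 i) (fun i j h => (t j).2 i h) i (p ^ m)).2.2
  rw [hN, Submonoid.coe_one, Matrix.one_apply_eq] at h
  have h3 : (x.1 (Sum.inl i) (Sum.inl i) - 1) ^ (p ^ m) = 0 := by
    rw [sub_pow_char_pow, ← h, one_pow, sub_self]
  exact sub_eq_zero.1 (eq_zero_of_pow_eq_zero h3)
theorem sylow_Umax {p n : ℕ} [Fact p.Prime] [CharP F p] (hq : Fintype.card F = p ^ n) (P : Sylow p (symplecticGroup (Fin 7) F)) :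
    Nonempty (P ≃* Umax F) := by
  have hU : IsPGroup p (Umax F) := by
    obtain ⟨m, hm⟩ := card_Sy (F := F)
    apply IsPGroup.of_card (n := n * 21 + n * m)
    rw [card_Umax, card_UA, hm, hq, ← pow_mul, ← pow_mul, ← pow_add]
  obtain ⟨Q, hQ⟩ := hU.exists_le_sylow
  have hn : Group.IsNilpotent Q := IsPGroup.isNilpotent Q.2
  have nc := normalizerCondition_iff_only_full_group_self_normalizing.1 (Group.normalizerCondition_of_isNilpotent (G := Q))
  have ht : (Umax F).subgroupOf Q = ⊤ := by
    apply nc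
    refine le_antisymm ?_ Subgroup.le_normalizer
    intro x hx
    rw [Subgroup.mem_subgroupOf]
    obtain ⟨m, hm⟩ := Q.2 x
    apply norm_mem (p := p) (m := m)
    · intro u hu
      have := (Subgroup.mem_normalizer_iff''.1 hx ⟨u, hQ hu⟩).1 hu
      exact this
    · exact congrArg Subtype.val hm
  have : (Q : Subgroup (symplecticGroup (Fin 7) F)) = Umax F := le_antisymm (Subgroup.subgroupOf_eq_top.1 ht) hQ
  exact ⟨(Sylow.equiv P Q).trans (MulEquiv.subgroupCongr this)⟩
end
end SpC

namespace SpC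
set_option maxRecDepth 100000 in
theorem chk : ok (total 7 [0,1,2,3,4,5,6] 2097151 1 0 0) (target * (BB+1)^21) = true := by decide +kernel
end SpC



/-- The number of conjugacy classes of a Sylow `p`-subgroup of `Sp_14(F_q)`,
for `p` an odd prime and `q` a power of `p`, written in `v = q - 1`. -/
theorem card_conjClasses_sylow_sp14 (p q : ℕ) (hp : p.Prime) (hodd : Odd p)
    (hq : ∃ n : ℕ, 0 < n ∧ q = p ^ n)
    (F : Type*) [Field F] [Fintype F] (hF : Fintype.card F = q)
    (P : Sylow p (Matrix.symplecticGroup (Fin 7) F)) (v : ℕ) (hv : v = q - 1) :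
    Nat.card (ConjClasses (P : Subgroup (Matrix.symplecticGroup (Fin 7) F))) =
      v ^ 14 + 18 * v ^ 13 + 158 * v ^ 12 + 899 * v ^ 11 + 3740 * v ^ 10 + 11985 * v ^ 9 + 29328 * v ^ 8 + 52055 * v ^ 7 + 62930 * v ^ 6 + 48797 * v ^ 5 + 22855 * v ^ 4 + 6020 * v ^ 3 + 812 * v ^ 2 + 49 * v + 1 := by
  
  subst hv hF
  obtain ⟨n, hn, hq⟩ := hq
  haveI : Fact p.Prime := ⟨hp⟩
  have hp0 : (p : F) = 0 := by
    have h := Nat.cast_card_eq_zero F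
    rw [hq, Nat.cast_pow] at h
    exact eq_zero_of_pow_eq_zero h
  haveI : CharP F p := (CharP.charP_iff_prime_eq_zero hp).2 hp0
  have h2 : (2 : F) ≠ 0 := by
    intro h
    obtain ⟨m, rfl⟩ := hodd
    push_cast at hp0
    rw [h, zero_mul, zero_add] at hp0
    exact one_ne_zero hp0
  obtain ⟨e⟩ := SpC.sylow_Umax hq P
  have hk : Nat.card (ConjClasses (P : Subgroup (Matrix.symplecticGroup (Fin 7) F))) = Nat.card (ConjClasses (SpC.Umax F)) := by
    refine Nat.card_congr ⟨ConjClasses.map e.toMonoidHom, ConjClasses.map e.symm.toMonoidHom, fun a => ?_, fun a => ?_⟩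
    · induction a using Quotient.inductionOn with
      | h a => exact congrArg ConjClasses.mk (e.symm_apply_apply a)
    · induction a using Quotient.inductionOn with
      | h a => exact congrArg ConjClasses.mk (e.apply_symm_apply a)
  rw [hk]
  have h3 := SpC.k_Umax (F := F) h2
  have h4 := SpC.main_sum (F := F) SpC.chk h2
  have hc : 0 < Fintype.card F := Fintype.card_pos
  rw [← Nat.cast_sum, ← h3, SpC.tp_eval] at h4
  push_cast at h4
  rw [mul_comm] at h4
  have h5 := mul_left_cancel₀ (pow_ne_zero 21 (by exact_mod_cast hc.ne')) h4
  zify [Nat.succ_le_of_lt hc]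
  rw [h5]
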